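/- (Chow's theorem) Let V be a closed subset of the complex projective space ℙₙ(ℂ) (the projectivization of ℂ^{n+1}) such that its affine cone C = {v ∈ ℂ^{n+1} ∖ {0} : [v] ∈ V} is an analytic subset of ℂ^{n+1} ∖ {0}. Then V is an algebraic variety: there exist finitely many homogeneous polynomials p₁, …, p_k in n+1 complex variables such that C = {v ∈ ℂ^{n+1} ∖ {0} : p₁(v) = ⋯ = p_k(v) = 0}. -/

import Mathlib

open scoped LinearAlgebra.Projectivization

/-- `A` is an analytic subset of the open set `U ⊆ ℂⁿ`: it is contained in `U`, closed in `U`,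
and every point of `A` has an open neighborhood `W ⊆ U` on which `A` is the common zero set of
finitely many holomorphic functions. -/
def IsAnalyticSubset {n : ℕ} (U A : Set (EuclideanSpace ℂ (Fin n))) : Prop :=
  A ⊆ U ∧ (∀ z ∈ U, z ∈ closure A → z ∈ A) ∧
  ∀ a ∈ A, ∃ W : Set (EuclideanSpace ℂ (Fin n)), IsOpen W ∧ a ∈ W ∧ W ⊆ U ∧
    ∃ (k : ℕ) (f : Fin k → EuclideanSpace ℂ (Fin n) → ℂ),
      (∀ i, DifferentiableOn ℂ (f i) W) ∧
      A ∩ W = {z ∈ W | ∀ i, f i z = 0}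

/-- Complex projective space carries the quotient topology from `ℂ^{n+1} \ {0}`. -/
instance {K V : Type*} [DivisionRing K] [AddCommGroup V] [Module K V] [TopologicalSpace V] :
    TopologicalSpace (ℙ K V) :=
  inferInstanceAs (TopologicalSpace (Quotient _))

section Development

open Filter Topology Metric Set

section Gateaux

variable {E F : Type*} [NormedAddCommGroup E] [NormedSpace ℂ E]
  [NormedAddCommGroup F] [NormedSpace ℂ F]

/-- `f` is continuous at `x` and complex differentiable at `x` along every complex line. -/
def HolAt (f : E → ℂ) (x : E) : Prop :=
  ContinuousAt f x ∧ ∀ v : E, DifferentiableAt ℂ (fun t : ℂ => f (x + t • v)) 0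

/-- `f` is continuous and complex differentiable along complex lines at all points of `W`. -/
def HolOn (f : E → ℂ) (W : Set E) : Prop := ∀ x ∈ W, HolAt f x

variable {f g : E → ℂ} {x : E} {W U : Set E}

theorem tendsto_line (x v : E) : Tendsto (fun t : ℂ => x + t • v) (𝓝 0) (𝓝 x) := by
  have : Continuous (fun t : ℂ => x + t • v) := by fun_prop
  simpa using this.tendsto 0

theorem HolAt.congr (hf : HolAt f x) (h : f =ᶠ[𝓝 x] g) : HolAt g x :=
  ⟨hf.1.congr h, fun v => (hf.2 v).congr_of_eventuallyEq
    (((tendsto_line x v).eventually h).mono fun _ ht => ht.symm)⟩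

theorem holAt_const (c : ℂ) : HolAt (fun _ : E => c) x :=
  ⟨continuousAt_const, fun _ => differentiableAt_const c⟩

theorem HolAt.add (hf : HolAt f x) (hg : HolAt g x) : HolAt (fun y => f y + g y) x :=
  ⟨hf.1.add hg.1, fun v => (hf.2 v).add (hg.2 v)⟩

theorem HolAt.sub (hf : HolAt f x) (hg : HolAt g x) : HolAt (fun y => f y - g y) x :=
  ⟨hf.1.sub hg.1, fun v => (hf.2 v).sub (hg.2 v)⟩

theorem HolAt.neg (hf : HolAt f x) : HolAt (fun y => - f y) x :=
  ⟨hf.1.neg, fun v => (hf.2 v).neg⟩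

theorem HolAt.mul (hf : HolAt f x) (hg : HolAt g x) : HolAt (fun y => f y * g y) x :=
  ⟨hf.1.mul hg.1, fun v => (hf.2 v).mul (hg.2 v)⟩

theorem HolAt.const_mul (c : ℂ) (hf : HolAt f x) : HolAt (fun y => c * f y) x :=
  (holAt_const c).mul hf

theorem HolAt.pow (hf : HolAt f x) (n : ℕ) : HolAt (fun y => f y ^ n) x :=
  ⟨hf.1.pow n, fun v => (hf.2 v).pow n⟩

theorem HolAt.inv (hf : HolAt f x) (h : f x ≠ 0) : HolAt (fun y => (f y)⁻¹) x :=
  ⟨hf.1.inv₀ h, fun v => (hf.2 v).inv (by simpa using h)⟩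

theorem HolAt.sum {ι : Type*} (s : Finset ι) {f : ι → E → ℂ} (hf : ∀ i ∈ s, HolAt (f i) x) :
    HolAt (fun y => ∑ i ∈ s, f i y) x := by
  classical
  induction s using Finset.induction_on with
  | empty => simpa using holAt_const 0
  | insert a s ha ih =>
    simp only [Finset.sum_insert ha]
    exact (hf a (by simp)).add (ih fun i hi => hf i (by simp [hi]))

theorem HolAt.prod {ι : Type*} (s : Finset ι) {f : ι → E → ℂ} (hf : ∀ i ∈ s, HolAt (f i) x) :
    HolAt (fun y => ∏ i ∈ s, f i y) x := by
  classical
  induction s using Finset.induction_on with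
  | empty => simpa using holAt_const 1
  | insert a s ha ih =>
    simp only [Finset.prod_insert ha]
    exact (hf a (by simp)).mul (ih fun i hi => hf i (by simp [hi]))

theorem holAt_continuousLinearMap (L : E →L[ℂ] ℂ) : HolAt (fun y => L y) x :=
  ⟨L.continuous.continuousAt, fun v => by
    simp only [map_add, map_smul, smul_eq_mul]; fun_prop⟩

theorem HolAt.comp_clm (L : F →L[ℂ] E) (c : E) {y : F} (hf : HolAt f (c + L y)) :
    HolAt (fun z => f (c + L z)) y := by
  refine ⟨ContinuousAt.comp (f := fun z => c + L z) hf.1 (by fun_prop), fun v => ?_⟩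
  have := hf.2 (L v)
  simpa only [map_add, map_smul, add_assoc] using this

theorem HolAt.comp_linear (L : F →L[ℂ] E) {y : F} (hf : HolAt f (L y)) :
    HolAt (fun z => f (L z)) y := by
  have := HolAt.comp_clm (f := f) L 0 (y := y) (by simpa using hf)
  simpa using this

theorem HolAt.comp_add (c : E) (hf : HolAt f (x + c)) :
    HolAt (fun z => f (z + c)) x := by
  have := HolAt.comp_clm (f := f) (ContinuousLinearMap.id ℂ E) c (y := x)
    (by simpa [add_comm] using hf)
  simpa [add_comm] using this

theorem DifferentiableAt.holAt (hf : DifferentiableAt ℂ f x) : HolAt f x := by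
  refine ⟨hf.continuousAt, fun v => ?_⟩
  have h0 : DifferentiableAt ℂ f (x + (0 : ℂ) • v) := by simpa using hf
  exact DifferentiableAt.comp (f := fun t : ℂ => x + t • v) (0 : ℂ) h0 (by fun_prop)

theorem HolOn.continuousOn (hf : HolOn f W) : ContinuousOn f W :=
  fun x hx => (hf x hx).1.continuousWithinAt

theorem HolOn.mono (hf : HolOn f W) (h : U ⊆ W) : HolOn f U := fun x hx => hf x (h hx)

theorem HolOn.differentiableAt_line (hf : HolAt f x) {y v : E} {t : ℂ} (h : y + t • v = x) :
    DifferentiableAt ℂ (fun s : ℂ => f (y + s • v)) t := by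
  have := hf.2 v
  have h2 : (fun s : ℂ => f (y + s • v)) = (fun s : ℂ => f (x + s • v)) ∘ (fun s => s - t) := by
    ext s; simp only [Function.comp, ← h]; congr 1; module
  rw [h2]
  exact DifferentiableAt.comp (f := fun s : ℂ => s - t) t (by simpa using this) (by fun_prop)

theorem HolAt.differentiableAt {f : ℂ → ℂ} {t : ℂ} (hf : HolAt f t) : DifferentiableAt ℂ f t := by
  have := HolOn.differentiableAt_line (y := 0) (v := (1 : ℂ)) (t := t) hf (by simp)
  simpa using this

theorem HolOn.intervalIntegral (hU : IsOpen U) {G : E → ℝ → ℂ} (a b : ℝ)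
    (hc : ContinuousOn (Function.uncurry G) (U ×ˢ univ))
    (hh : ∀ θ, HolOn (fun x => G x θ) U) : HolOn (fun x => ∫ θ in a..b, G x θ) U := by
  have hcθ : ∀ x ∈ U, Continuous (G x) := fun x hx => by
    have := hc.comp (f := fun θ : ℝ => (x, θ)) (s := univ) (by fun_prop)
      (fun θ _ => ⟨hx, mem_univ _⟩)
    exact continuousOn_univ.1 this
  intro x hx
  refine ⟨?_, fun v => ?_⟩
  · have h1 : Continuous (fun x : U => ∫ θ in a..b, G x θ) := by
      apply intervalIntegral.continuous_parametric_intervalIntegral_of_continuous'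
      have := hc.comp_continuous (f := fun p : U × ℝ => (p.1.1, p.2)) (by fun_prop)
        (fun p => ⟨p.1.2, mem_univ _⟩)
      exact this
    have h2 : ContinuousOn (fun x => ∫ θ in a..b, G x θ) U :=
      continuousOn_iff_continuous_domRestrict.2 h1
    exact h2.continuousAt (hU.mem_nhds hx)
  · obtain ⟨ρ, hρ, hρU⟩ : ∃ ρ > 0, ∀ t ∈ closedBall (0 : ℂ) ρ, x + t • v ∈ U := by
      have := (tendsto_line x v).eventually (hU.mem_nhds hx)
      obtain ⟨ρ, h1, h2⟩ := Metric.nhds_basis_closedBall.mem_iff.1 this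
      exact ⟨ρ, h1, fun t ht => h2 ht⟩
    have hdiff : ∀ t ∈ closedBall (0 : ℂ) ρ, ∀ θ, DifferentiableAt ℂ (fun t => G (x + t • v) θ) t :=
      fun t ht θ => HolOn.differentiableAt_line (f := fun x => G x θ) (hh θ _ (hρU t ht)) rfl
    have hcomp : IsCompact (closedBall (0 : ℂ) ρ ×ˢ uIcc a b) :=
      (isCompact_closedBall 0 ρ).prod isCompact_uIcc
    obtain ⟨M, hM⟩ := hcomp.exists_bound_of_continuousOn
      (f := fun p : ℂ × ℝ => G (x + p.1 • v) p.2) (by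
        refine hc.comp (f := fun p : ℂ × ℝ => (x + p.1 • v, p.2)) (by fun_prop) ?_
        exact fun p hp => ⟨hρU _ hp.1, mem_univ _⟩)
    have h2 : 0 < ρ / 2 := by positivity
    have hsub : ∀ t ∈ ball (0 : ℂ) (ρ / 2), closedBall t (ρ / 2) ⊆ closedBall 0 ρ := fun t ht => by
      apply closedBall_subset_closedBall'
      have := mem_ball.1 ht
      linarith
    refine (intervalIntegral.hasDerivAt_integral_of_dominated_loc_of_deriv_le
      (F := fun t θ => G (x + t • v) θ) (F' := fun t θ => deriv (fun t => G (x + t • v) θ) t)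
      (bound := fun _ => M / (ρ / 2)) (ball_mem_nhds 0 h2) ?_ ?_ ?_ ?_ ?_ ?_).2.differentiableAt
    · filter_upwards [ball_mem_nhds 0 hρ] with t ht
      exact (hcθ _ (hρU t (ball_subset_closedBall ht))).aestronglyMeasurable
    · exact (hcθ _ (hρU 0 (by simp [hρ.le]))).intervalIntegrable _ _
    · refine aestronglyMeasurable_of_tendsto_ae (𝓝[≠] (0 : ℂ))
        (f := fun t θ => if ‖t‖ ≤ ρ then
          t⁻¹ • (G (x + (0 + t) • v) θ - G (x + (0 : ℂ) • v) θ) else 0) ?_ ?_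
      · intro t
        split_ifs with ht
        · have ha := hcθ _ (hρU t (by simpa using ht))
          have hb := hcθ _ (hρU 0 (by simp [hρ.le]))
          simp only [zero_add]
          have hab : Continuous fun θ => t⁻¹ • (G (x + t • v) θ - G (x + (0 : ℂ) • v) θ) := by
            fun_prop
          exact hab.aestronglyMeasurable
        · exact MeasureTheory.aestronglyMeasurable_const
      · refine Eventually.of_forall fun θ => ?_
        have := hasDerivAt_iff_tendsto_slope_zero.1 (hdiff 0 (by simp [hρ.le]) θ).hasDerivAt
        refine this.congr' ?_
        filter_upwards [mem_nhdsWithin_of_mem_nhds (closedBall_mem_nhds 0 hρ)] with t ht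
        rw [if_pos (by simpa using ht)]
    · refine Eventually.of_forall fun θ hθ t ht => ?_
      apply Complex.norm_deriv_le_of_forall_mem_sphere_norm_le h2
      · apply DifferentiableOn.diffContOnCl
        rw [closure_ball _ h2.ne']
        exact fun s hs => (hdiff s (hsub t ht hs) θ).differentiableWithinAt
      · intro s hs
        exact hM (s, θ) ⟨hsub t ht (sphere_subset_closedBall hs), uIoc_subset_uIcc hθ⟩
    · simp
    · refine Eventually.of_forall fun θ hθ t ht => ?_
      exact (hdiff t (hsub t ht (mem_closedBall_self h2.le)) θ).hasDerivAt

theorem HolOn.circleIntegral (hU : IsOpen U) {G : E → ℂ → ℂ} {c : ℂ} {R : ℝ} (hR : 0 ≤ R)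
    (hc : ContinuousOn (Function.uncurry G) (U ×ˢ sphere c R))
    (hh : ∀ τ ∈ sphere c R, HolOn (fun x => G x τ) U) :
    HolOn (fun x => ∮ τ in C(c, R), G x τ) U := by
  unfold _root_.circleIntegral
  apply HolOn.intervalIntegral hU
  · have : ContinuousOn (fun p : E × ℝ => G p.1 (circleMap c R p.2)) (U ×ˢ univ) := by
      have h2 : Continuous (circleMap c R) := continuous_circleMap c R
      refine hc.comp (f := fun p : E × ℝ => (p.1, circleMap c R p.2)) (by fun_prop) ?_
      exact fun p hp => ⟨hp.1, circleMap_mem_sphere c hR _⟩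
    have h2 : Continuous (circleMap 0 R) := continuous_circleMap 0 R
    simp only [deriv_circleMap, smul_eq_mul, Function.uncurry_def]
    exact ContinuousOn.mul (by fun_prop) this
  · intro θ x hx
    exact (hh _ (circleMap_mem_sphere c hR θ) x hx).const_mul _

/-- The derivative along a fixed direction is again holomorphic along lines. -/
theorem HolOn.deriv_line (hU : IsOpen U) (hf : HolOn f U) (v : E) :
    HolOn (fun x => deriv (fun t : ℂ => f (x + t • v)) 0) U := by
  intro x hx
  have hcont : Continuous (fun p : E × ℂ => p.1 + p.2 • v) := by fun_prop
  have h0 : ∀ᶠ p in 𝓝 (x, (0 : ℂ)), p.1 + p.2 • v ∈ U :=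
    hcont.continuousAt.eventually (hU.mem_nhds (by simpa using hx))
  rw [nhds_prod_eq] at h0
  obtain ⟨pa, ha, pb, hb, hab⟩ := eventually_prod_iff.1 h0
  obtain ⟨V, hVa, hV, hxV⟩ := _root_.eventually_nhds_iff.1 ha
  obtain ⟨ρ, hρ, hρb⟩ := Metric.nhds_basis_closedBall.mem_iff.1 hb
  have hmem : ∀ y ∈ V, ∀ t ∈ closedBall (0 : ℂ) ρ, y + t • v ∈ U :=
    fun y hy t ht => hab (hVa y hy) (hρb ht)
  have key : HolOn (fun y => (2 * Real.pi * Complex.I : ℂ)⁻¹ *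
      ∮ τ in C(0, ρ), (τ ^ 2)⁻¹ * f (y + τ • v)) V := by
    intro y hy
    refine HolAt.const_mul _ (HolOn.circleIntegral hV hρ.le
      (G := fun y τ => (τ ^ 2)⁻¹ * f (y + τ • v)) ?_ ?_ y hy)
    · refine ContinuousOn.mul (f := fun p : E × ℂ => (p.2 ^ 2)⁻¹)
        (g := fun p : E × ℂ => f (p.1 + p.2 • v)) ?_ ?_
      · refine ContinuousOn.inv₀ (by fun_prop) fun p hp => ?_
        have : p.2 ≠ 0 := by
          rintro h; have h3 := hp.2; rw [h] at h3; simp at h3; exact hρ.ne h3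
        exact pow_ne_zero 2 this
      · exact hf.continuousOn.comp (by fun_prop)
          fun p hp => hmem p.1 hp.1 p.2 (sphere_subset_closedBall hp.2)
    · exact fun τ hτ z hz => ((hf _ (hmem z hz τ (sphere_subset_closedBall hτ))).comp_add
        _).const_mul _
  refine (key x hxV).congr ?_
  filter_upwards [hV.mem_nhds hxV] with y hy
  have hd : DifferentiableOn ℂ (fun t : ℂ => f (y + t • v)) (closedBall 0 ρ) := fun t ht =>
    (HolOn.differentiableAt_line (hf _ (hmem y hy t ht)) rfl).differentiableWithinAt
  have h3 := hd.deriv_eq_smul_circleIntegral hρ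
  simp only [sub_zero, one_div, smul_eq_mul] at h3
  rw [h3, inv_mul_cancel_left₀ Complex.two_pi_I_ne_zero]

end Gateaux

section Thin

variable {E F : Type*} [NormedAddCommGroup E] [NormedSpace ℂ E]
  [NormedAddCommGroup F] [NormedSpace ℂ F]
  {f g h : E → ℂ} {x : E} {W U : Set E}

/-- Identity theorem along a line. -/
theorem HolOn.eventually_line_ne_zero (hU : IsOpen U) (hc : Convex ℝ U) (hf : HolOn f U)
    {a v : E} {t₀ t₁ : ℂ} (h₀ : a + t₀ • v ∈ U) (h₁ : a + t₁ • v ∈ U) (hne : f (a + t₁ • v) ≠ 0) :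
    ∀ᶠ t in 𝓝[≠] t₀, f (a + t • v) ≠ 0 := by
  by_contra hcon
  have hfr : ∃ᶠ t in 𝓝[≠] t₀, f (a + t • v) = 0 :=
    (Filter.not_eventually.1 hcon).mono fun _ ht => not_not.1 ht
  have hcont : Continuous (fun t : ℂ => a + t • v) := by fun_prop
  have hD : IsOpen {t : ℂ | a + t • v ∈ U} := hU.preimage hcont
  have han : AnalyticOnNhd ℂ (fun t : ℂ => f (a + t • v)) {t : ℂ | a + t • v ∈ U} := by
    apply DifferentiableOn.analyticOnNhd _ hD
    exact fun t ht => (HolOn.differentiableAt_line (hf _ ht) rfl).differentiableWithinAt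
  have hconv : Convex ℝ {t : ℂ | a + t • v ∈ U} := by
    intro s hs t ht p q hp hq hpq
    have := hc hs ht hp hq hpq
    have h2 : a + (p • s + q • t) • v = p • (a + s • v) + q • (a + t • v) := by
      have : a = (p + q) • a := by rw [hpq, one_smul]
      nth_rw 1 [this]
      simp only [smul_add, add_smul, smul_assoc]; abel
    change _ ∈ U; rw [h2]
    exact this
  exact hne (han.eqOn_zero_of_preconnected_of_frequently_eq_zero hconv.isPreconnected h₀ hfr h₁)

/-- `h` is holomorphic near `x` and does not vanish identically near `x`. -/
def NonzeroGerm (h : E → ℂ) (x : E) : Prop :=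
  (∀ᶠ y in 𝓝 x, HolAt h y) ∧ ∃ᶠ y in 𝓝 x, h y ≠ 0

theorem HolOn.nonzeroGerm (hU : IsOpen U) (hc : Convex ℝ U) (hf : HolOn f U) {y : E}
    (hy : y ∈ U) (hne : f y ≠ 0) (hx : x ∈ U) : NonzeroGerm f x := by
  refine ⟨(hU.eventually_mem hx).mono hf, ?_⟩
  have h1 := hf.eventually_line_ne_zero hU hc (a := x) (v := y - x) (t₀ := 0) (t₁ := 1)
    (by simpa using hx) (by simpa using hy) (by simpa using hne)
  have h2 := (tendsto_line x (y - x)).mono_left (nhdsWithin_le_nhds (s := {0}ᶜ))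
  exact h2.frequently h1.frequently

theorem NonzeroGerm.exists_ball (hh : NonzeroGerm h x) : ∃ ε > 0, HolOn h (ball x ε) ∧
    ∃ y ∈ ball x ε, h y ≠ 0 := by
  obtain ⟨ε, hε, h1⟩ := Metric.eventually_nhds_iff_ball.1 hh.1
  obtain ⟨y, hy, h2⟩ := (hh.2.and_eventually (ball_mem_nhds x hε)).exists
  exact ⟨ε, hε, h1, y, h2, hy⟩

theorem NonzeroGerm.eventually (hh : NonzeroGerm h x) : ∀ᶠ y in 𝓝 x, NonzeroGerm h y := by
  obtain ⟨ε, hε, h1, y, hy, hne⟩ := hh.exists_ball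
  filter_upwards [ball_mem_nhds x hε] with z hz
  exact h1.nonzeroGerm isOpen_ball (convex_ball _ _) hy hne hz

theorem NonzeroGerm.exists_line (hh : NonzeroGerm h x) :
    ∃ v : E, ∀ᶠ t in 𝓝[≠] (0 : ℂ), h (x + t • v) ≠ 0 := by
  obtain ⟨ε, hε, h1, y, hy, hne⟩ := hh.exists_ball
  exact ⟨y - x, h1.eventually_line_ne_zero isOpen_ball (convex_ball _ _) (t₁ := 1)
    (by simpa using hε) (by simpa using hy) (by simpa using hne)⟩

theorem nonzeroGerm_one : NonzeroGerm (fun _ : E => (1 : ℂ)) x :=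
  ⟨Eventually.of_forall fun _ => holAt_const 1,
    (Eventually.of_forall fun _ => one_ne_zero).frequently⟩

theorem NonzeroGerm.mul (hf : NonzeroGerm f x) (hg : NonzeroGerm g x) :
    NonzeroGerm (fun y => f y * g y) x := by
  refine ⟨hf.1.and hg.1 |>.mono fun y hy => hy.1.mul hy.2, ?_⟩
  intro hcon
  have h1 := hcon.eventually_nhds
  obtain ⟨y, hy, h2, h3, h4⟩ := (hf.2.and_eventually (h1.and (hf.1.and hg.eventually))).exists
  have h5 := h3.1.eventually_ne hy
  obtain ⟨z, hz, h6, h7⟩ := (h4.2.and_eventually (h2.and h5)).exists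
  exact h6 (mul_ne_zero h7 hz)

theorem NonzeroGerm.prod {ι : Type*} (s : Finset ι) {f : ι → E → ℂ}
    (hf : ∀ i ∈ s, NonzeroGerm (f i) x) : NonzeroGerm (fun y => ∏ i ∈ s, f i y) x := by
  classical
  induction s using Finset.induction_on with
  | empty => simpa using nonzeroGerm_one
  | insert a s ha ih =>
    simp only [Finset.prod_insert ha]
    exact (hf a (by simp)).mul (ih fun i hi => hf i (by simp [hi]))

/-- One-variable Cauchy formula for bounded functions with isolated singularities. -/
theorem circleIntegral_inv_mul_of_isolated {φ : ℂ → ℂ} {D : Set ℂ} {P : ℂ → Prop} {r B : ℝ}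
    (hr : 0 < r) (hD : IsOpen D) (hrD : closedBall 0 r ⊆ D)
    (hP : ∀ t ∈ D, ∀ᶠ s in 𝓝[≠] t, P s) (hP0 : P 0) (hPs : ∀ t ∈ sphere (0 : ℂ) r, P t)
    (hd : ∀ t ∈ D, P t → DifferentiableAt ℂ φ t) (hB : ∀ t ∈ D, P t → ‖φ t‖ ≤ B) :
    ∮ τ in C(0, r), τ⁻¹ * φ τ = (2 * Real.pi * Complex.I) * φ 0 := by
  set ψ : ℂ → ℂ := fun t => limUnder (𝓝[≠] t) φ with hψ
  have heq : ∀ t ∈ D, P t → ψ t = φ t := fun t ht hpt =>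
    ((hd t ht hpt).continuousAt.tendsto.mono_left nhdsWithin_le_nhds).limUnder_eq
  have hdiff : ∀ t ∈ D, DifferentiableAt ℂ ψ t := by
    intro t ht
    have h1 : ∀ᶠ s in 𝓝 t, s ∈ D ∧ (s ≠ t → P s) :=
      (hD.eventually_mem ht).and (eventually_nhdsWithin_iff.1 (hP t ht))
    have h2 := Complex.differentiableOn_update_limUnder_of_bddAbove (f := φ) (c := t) h1
      (fun s hs => (hd s hs.1.1 (hs.1.2 hs.2)).differentiableWithinAt)
      ⟨B, by rintro _ ⟨s, hs, rfl⟩; exact hB s hs.1.1 (hs.1.2 hs.2)⟩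
    refine (h2.differentiableAt h1).congr_of_eventuallyEq ?_
    filter_upwards [h1] with s hs
    rcases eq_or_ne s t with rfl | hst
    · simp [hψ]
    · rw [Function.update_of_ne hst, heq s hs.1 (hs.2 hst)]
  have h1 : DiffContOnCl ℂ ψ (ball 0 r) := by
    apply DifferentiableOn.diffContOnCl
    rw [closure_ball _ hr.ne']
    exact fun t ht => (hdiff t (hrD ht)).differentiableWithinAt
  have h2 := h1.circleIntegral_sub_inv_smul (w := 0) (by simpa using hr)
  rw [heq 0 (hrD (by simp [hr.le])) hP0] at h2
  rw [← smul_eq_mul, ← h2]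
  refine circleIntegral.integral_congr hr.le fun t ht => ?_
  simp [heq t (hrD (sphere_subset_closedBall ht)) (hPs t ht)]

/-- Local Riemann extension theorem. -/
theorem NonzeroGerm.exists_extension (hh : NonzeroGerm h x) {B : ℝ}
    (hg : ∀ᶠ y in 𝓝 x, h y ≠ 0 → HolAt g y ∧ ‖g y‖ ≤ B) :
    ∃ G : E → ℂ, ∀ᶠ y in 𝓝 x, HolAt G y ∧ (h y ≠ 0 → G y = g y) := by
  obtain ⟨v, hv⟩ := hh.exists_line
  obtain ⟨ε, hε, hε'⟩ := Metric.eventually_nhds_iff_ball.1 (hh.1.and hg)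
  have hcont : Continuous (fun p : E × ℂ => p.1 + p.2 • v) := by fun_prop
  have hv2 : ∀ᶠ t in 𝓝 (0 : ℂ), (t ≠ 0 → h (x + t • v) ≠ 0) ∧ x + t • v ∈ ball x ε :=
    (eventually_nhdsWithin_iff.1 hv).and ((tendsto_line x v).eventually (ball_mem_nhds x hε))
  obtain ⟨r, hr, hr'⟩ := Metric.nhds_basis_closedBall.mem_iff.1 hv2
  have hV1 : ∀ᶠ y in 𝓝 x, ∀ t ∈ closedBall (0 : ℂ) r, y + t • v ∈ ball x ε := by
    apply (isCompact_closedBall (0 : ℂ) r).eventually_forall_of_forall_eventually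
    exact fun t ht => hcont.continuousAt.eventually (isOpen_ball.mem_nhds (hr' ht).2)
  have hV2 : ∀ᶠ y in 𝓝 x, ∀ t ∈ sphere (0 : ℂ) r, h (y + t • v) ≠ 0 := by
    apply (isCompact_sphere (0 : ℂ) r).eventually_forall_of_forall_eventually
    intro t ht
    have ht' := hr' (sphere_subset_closedBall ht)
    have h1 : ContinuousAt h (x + t • v) := (hε' _ ht'.2).1.1
    have h2 : ContinuousAt (fun p : E × ℂ => h (p.1 + p.2 • v)) (x, t) :=
      ContinuousAt.comp (f := fun p : E × ℂ => p.1 + p.2 • v) h1 hcont.continuousAt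
    refine h2.eventually_ne (ht'.1 ?_)
    rintro rfl
    simp only [mem_sphere, dist_self] at ht
    exact hr.ne ht
  obtain ⟨V, hVV, hV, hxV⟩ := _root_.eventually_nhds_iff.1 (hV1.and hV2)
  refine ⟨fun y => (2 * Real.pi * Complex.I : ℂ)⁻¹ * ∮ τ in C(0, r), τ⁻¹ * g (y + τ • v), ?_⟩
  filter_upwards [hV.mem_nhds hxV] with y hy
  have hgs : ∀ y ∈ V, ∀ t ∈ sphere (0 : ℂ) r, HolAt g (y + t • v) := fun y hy t ht =>
    ((hε' _ ((hVV y hy).1 t (sphere_subset_closedBall ht))).2 ((hVV y hy).2 t ht)).1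
  constructor
  · refine HolAt.const_mul _ (HolOn.circleIntegral hV hr.le
      (G := fun y τ => τ⁻¹ * g (y + τ • v)) ?_ ?_ y hy)
    · refine ContinuousOn.mul (f := fun p : E × ℂ => p.2⁻¹)
        (g := fun p : E × ℂ => g (p.1 + p.2 • v)) ?_ ?_
      · refine ContinuousOn.inv₀ (by fun_prop) fun p hp => ?_
        rintro h
        have h3 := hp.2; rw [h] at h3; simp at h3; exact hr.ne h3
      · intro p hp
        exact (ContinuousAt.comp (f := fun p : E × ℂ => p.1 + p.2 • v) (hgs _ hp.1 _ hp.2).1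
          hcont.continuousAt).continuousWithinAt
    · exact fun τ hτ z hz => (hgs z hz τ hτ).comp_add _ |>.const_mul _
  · intro hy0
    have := circleIntegral_inv_mul_of_isolated (φ := fun t : ℂ => g (y + t • v))
      (D := {t : ℂ | y + t • v ∈ ball x ε}) (P := fun t => h (y + t • v) ≠ 0) (B := B) hr
      (isOpen_ball.preimage (by fun_prop)) (fun t ht => (hVV y hy).1 t ht) ?_ (by simpa using hy0)
      (hVV y hy).2 ?_ ?_
    · rw [this, inv_mul_cancel_left₀ Complex.two_pi_I_ne_zero]; simp
    · intro t ht
      refine HolOn.eventually_line_ne_zero (U := ball x ε) isOpen_ball (convex_ball _ _)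
        (fun z hz => (hε' z hz).1) ht (t₁ := 0) ?_ (by simpa using hy0)
      exact (hVV y hy).1 0 (by simp [hr.le])
    · exact fun t ht hp => HolOn.differentiableAt_line (((hε' _ ht).2 hp).1) rfl
    · exact fun t ht hp => ((hε' _ ht).2 hp).2

/-- `S` is locally contained, near every point of `U`, in the zero set of a nonzero germ. -/
def ThinOn (S U : Set E) : Prop :=
  ∀ x ∈ U, ∃ h, NonzeroGerm h x ∧ ∀ᶠ y in 𝓝 x, h y ≠ 0 → y ∉ S

theorem ThinOn.frequently {S : Set E} (hS : ThinOn S U) (hx : x ∈ U) : ∃ᶠ y in 𝓝 x, y ∉ S := by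
  obtain ⟨h, h1, h2⟩ := hS x hx
  exact (h1.2.and_eventually h2).mono fun y hy => hy.2 hy.1

/-- Riemann extension theorem. -/
theorem ThinOn.exists_extension {S : Set E} (hU : IsOpen U) (hS : ThinOn S U)
    (hg : ∀ y ∈ U, y ∉ S → HolAt g y)
    (hb : ∀ x ∈ U, ∃ B : ℝ, ∀ᶠ y in 𝓝 x, y ∉ S → ‖g y‖ ≤ B) :
    ∃ G : E → ℂ, HolOn G U ∧ ∀ y ∈ U, y ∉ S → G y = g y := by
  set G : E → ℂ := fun x => limUnder (𝓝[Sᶜ] x) g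
  have hne : ∀ x ∈ U, (𝓝[Sᶜ] x).NeBot := fun x hx =>
    mem_closure_iff_nhdsWithin_neBot.1 (mem_closure_iff_frequently.2 (hS.frequently hx))
  refine ⟨G, fun x hx => ?_, fun y hy hyS => ?_⟩
  · obtain ⟨h, h1, h2⟩ := hS x hx
    obtain ⟨B, hB⟩ := hb x hx
    obtain ⟨G₁, hG₁⟩ := h1.exists_extension (g := g) (B := B) (by
      filter_upwards [h2, hB, hU.mem_nhds hx] with y a b c d
      exact ⟨hg y c (a d), b (a d)⟩)
    have h3 : ∀ᶠ y in 𝓝 x, y ∉ S → G₁ y = g y := by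
      filter_upwards [hG₁.eventually_nhds, h1.eventually, hU.mem_nhds hx] with y a b c d
      have e1 : ContinuousAt G₁ y := a.self_of_nhds.1.1
      have e2 : ContinuousAt g y := (hg y c d).1
      by_contra hcon
      have e3 := (e1.sub e2).eventually_ne (sub_ne_zero.2 hcon)
      obtain ⟨z, z1, z2, z3⟩ := (b.2.and_eventually (a.and e3)).exists
      exact z3 (sub_eq_zero.2 (z2.2 z1))
    have h4 : G₁ =ᶠ[𝓝 x] G := by
      filter_upwards [h3.eventually_nhds, hG₁, hU.mem_nhds hx] with y a b c
      have := hne y c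
      symm
      apply Tendsto.limUnder_eq
      refine (b.1.1.tendsto.mono_left nhdsWithin_le_nhds).congr' ?_
      exact eventually_nhdsWithin_iff.2 a
    exact hG₁.self_of_nhds.1.congr h4
  · have := hne y hy
    exact Tendsto.limUnder_eq ((hg y hy hyS).1.tendsto.mono_left nhdsWithin_le_nhds)

end Thin

section Newton

theorem Multiset.newton_identity (m : Multiset ℂ) (k : ℕ) :
    (k : ℂ) * m.esymm k = (-1) ^ (k + 1) *
      ∑ a ∈ Finset.HasAntidiagonal.antidiagonal k with a.1 < k,
        (-1) ^ a.1 * m.esymm a.1 * (m.map (· ^ a.2)).sum := by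
  obtain ⟨l, rfl⟩ : ∃ l : List ℂ, m = (l : Multiset ℂ) := ⟨m.toList, m.coe_toList.symm⟩
  have hl : (l : Multiset ℂ) =
      Multiset.map l.get (Finset.univ : Finset (Fin l.length)).val := by
    simp [Fin.univ_def]
  have hp : ∀ j : ℕ, ((l : Multiset ℂ).map (· ^ j)).sum = ∑ i, l.get i ^ j := by
    intro j; rw [hl, Multiset.map_map]; rfl
  simp only [hp]
  rw [hl]
  have := congrArg (MvPolynomial.aeval (R := ℤ) l.get)
    (MvPolynomial.mul_esymm_eq_sum (Fin l.length) ℤ k)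
  simpa [MvPolynomial.psum, MvPolynomial.aeval_esymm_eq_multiset_esymm, map_sum] using this

theorem Multiset.prod_add_eq_sum_esymm (m : Multiset ℂ) (T : ℂ) :
    (m.map (T + ·)).prod =
      ∑ j ∈ Finset.range (m.card + 1), m.esymm j * T ^ (m.card - j) := by
  have := congrArg (Polynomial.eval T) (Multiset.prod_X_add_C_eq_sum_esymm m)
  rw [Polynomial.eval_multiset_prod, Multiset.map_map] at this
  simpa [Polynomial.eval_finsetSum] using this

theorem Multiset.prod_eq_esymm_card (m : Multiset ℂ) : m.prod = m.esymm m.card := by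
  have := m.prod_add_eq_sum_esymm 0
  simp only [zero_add, Multiset.map_id'] at this
  rw [this, Finset.sum_eq_single m.card]
  · simp
  · intro b hb hne
    rw [zero_pow, mul_zero]
    have := Finset.mem_range.1 hb
    omega
  · simp

end Newton

section MultiSection

variable {E F G : Type*} [NormedAddCommGroup E] [NormedSpace ℂ E]
  [NormedAddCommGroup F] [NormedSpace ℂ F] [NormedAddCommGroup G] [NormedSpace ℂ G]

/-- A multiset valued map is holomorphic at `x₁` if its members stay in any given neighbourhood of
those at `x₁` and the trace of every locally defined holomorphic function is holomorphic. -/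
def HolMultiAt (s : F → Multiset E) (x₁ : F) : Prop :=
  ∀ W : Set E, IsOpen W → (∀ z ∈ s x₁, z ∈ W) → ∀ φ : E → ℂ, HolOn φ W →
    ∀ᶠ x in 𝓝 x₁, (∀ z ∈ s x, z ∈ W) ∧ HolAt (fun y => ((s y).map φ).sum) x

variable {s t : F → Multiset E} {x₁ : F} {W : Set E} {φ : E → ℂ}

theorem HolMultiAt.eventually_mem (hs : HolMultiAt s x₁) (hW : IsOpen W)
    (h : ∀ z ∈ s x₁, z ∈ W) : ∀ᶠ x in 𝓝 x₁, ∀ z ∈ s x, z ∈ W :=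
  (hs W hW h (fun _ => 0) fun _ _ => holAt_const 0).mono fun _ hx => hx.1

theorem HolMultiAt.trace (hs : HolMultiAt s x₁) (hW : IsOpen W)
    (h : ∀ z ∈ s x₁, z ∈ W) (hφ : HolOn φ W) : HolAt (fun y => ((s y).map φ).sum) x₁ :=
  (hs W hW h φ hφ).self_of_nhds.2

theorem HolMultiAt.congr (hs : HolMultiAt s x₁) (h : ∀ᶠ x in 𝓝 x₁, s x = t x) :
    HolMultiAt t x₁ := by
  intro W hW hW' φ hφ
  have h0 := h.self_of_nhds
  filter_upwards [hs W hW (by rwa [h0]) φ hφ, h.eventually_nhds] with x hx hx'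
  refine ⟨by rw [← hx'.self_of_nhds]; exact hx.1, hx.2.congr (hx'.mono fun y hy => by simp [hy])⟩

theorem HolMultiAt.add (hs : HolMultiAt s x₁) (ht : HolMultiAt t x₁) :
    HolMultiAt (fun x => s x + t x) x₁ := by
  intro W hW h φ hφ
  filter_upwards [hs W hW (fun z hz => h z (Multiset.mem_add.2 (.inl hz))) φ hφ,
    ht W hW (fun z hz => h z (Multiset.mem_add.2 (.inr hz))) φ hφ] with x h1 h2
  refine ⟨fun z hz => (Multiset.mem_add.1 hz).elim (h1.1 z) (h2.1 z), ?_⟩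
  simpa using h1.2.add h2.2

theorem holMultiAt_zero : HolMultiAt (fun _ : F => (0 : Multiset E)) x₁ := fun W _ _ φ _ =>
  Eventually.of_forall fun x => ⟨by simp, by simpa using holAt_const 0⟩

theorem HolMultiAt.sum {ι : Type*} (I : Finset ι) {s : ι → F → Multiset E}
    (hs : ∀ i ∈ I, HolMultiAt (s i) x₁) : HolMultiAt (fun x => ∑ i ∈ I, s i x) x₁ := by
  classical
  induction I using Finset.induction_on with
  | empty => simpa using holMultiAt_zero
  | insert a I ha ih =>
    simp only [Finset.sum_insert ha]
    exact (hs a (by simp)).add (ih fun i hi => hs i (by simp [hi]))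

theorem HolMultiAt.bind {s₂ : F → Multiset G} {s₁ : G → Multiset E} (h₂ : HolMultiAt s₂ x₁)
    (h₁ : ∀ y ∈ s₂ x₁, HolMultiAt s₁ y) : HolMultiAt (fun x => (s₂ x).bind s₁) x₁ := by
  intro W hW h φ hφ
  set P : G → Prop := fun y => (∀ z ∈ s₁ y, z ∈ W) ∧ HolAt (fun y => ((s₁ y).map φ).sum) y
  have hP : ∀ y ∈ s₂ x₁, ∀ᶠ y' in 𝓝 y, P y' := fun y hy =>
    h₁ y hy W hW (fun z hz => h z (Multiset.mem_bind.2 ⟨y, hy, hz⟩)) φ hφ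
  have hO : IsOpen {y | ∀ᶠ y' in 𝓝 y, P y'} := isOpen_setOfPred_eventually_nhds
  filter_upwards [h₂ _ hO hP (fun y => ((s₁ y).map φ).sum)
    (fun y hy => (Eventually.self_of_nhds (p := P) hy).2)] with x hx
  refine ⟨fun z hz => ?_, ?_⟩
  · obtain ⟨y, hy, hz⟩ := Multiset.mem_bind.1 hz
    exact (Eventually.self_of_nhds (p := P) (hx.1 y hy)).1 z hz
  · simpa [Multiset.map_bind, Multiset.sum_bind] using hx.2

theorem eventually_eq_of_continuousAt_natCast {F : Type*} [TopologicalSpace F] {x₁ : F}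
    {n : F → ℕ} (h : ContinuousAt (fun x => (n x : ℂ)) x₁) :
    ∀ᶠ x in 𝓝 x₁, n x = n x₁ := by
  filter_upwards [h.eventually (ball_mem_nhds _ one_pos)] with x hx
  rw [Complex.dist_eq, ← Int.cast_natCast, ← Int.cast_natCast (R := ℂ) (n x₁),
    ← Int.cast_sub, Complex.norm_intCast] at hx
  have : |(n x : ℤ) - n x₁| < 1 := by exact_mod_cast hx
  rw [Int.abs_lt_one_iff] at this
  omega

theorem HolMultiAt.eventually_card (hs : HolMultiAt s x₁) :
    ∀ᶠ x in 𝓝 x₁, (s x).card = (s x₁).card := by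
  apply eventually_eq_of_continuousAt_natCast
  have := hs.trace isOpen_univ (by simp) (φ := fun _ => 1) (fun _ _ => holAt_const 1)
  simpa using this.1

theorem HolMultiAt.eventually_countP (hs : HolMultiAt s x₁) {O O' : Set E} (hO : IsOpen O)
    (hO' : IsOpen O') (hd : Disjoint O O') (h : ∀ z ∈ s x₁, z ∈ O ∪ O')
    [DecidablePred (· ∈ O)] :
    ∀ᶠ x in 𝓝 x₁, (s x).countP (· ∈ O) = (s x₁).countP (· ∈ O) := by
  apply eventually_eq_of_continuousAt_natCast
  have hφ : HolOn (fun z => if z ∈ O then (1 : ℂ) else 0) (O ∪ O') := by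
    rintro z (hz | hz)
    · refine (holAt_const 1).congr ?_
      filter_upwards [hO.mem_nhds hz] with w hw
      simp [hw]
    · refine (holAt_const 0).congr ?_
      filter_upwards [hO'.mem_nhds hz] with w hw
      have : w ∉ O := fun hw' => hd.le_bot ⟨hw', hw⟩
      simp [this]
  have := hs.trace (hO.union hO') h hφ
  have h2 : ∀ m : Multiset E, (m.map fun z => if z ∈ O then (1 : ℂ) else 0).sum =
      (m.countP (· ∈ O) : ℂ) := by
    intro m
    induction m using Multiset.induction_on with
    | empty => simp
    | cons a m ih =>
      by_cases ha : a ∈ O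
      · simp [ha, ih, add_comm]
      · simp [ha, ih]
  simpa only [h2] using this.1

theorem HolMultiAt.esymm (hs : HolMultiAt s x₁) (hW : IsOpen W)
    (h : ∀ z ∈ s x₁, z ∈ W) (hφ : HolOn φ W) (k : ℕ) :
    HolAt (fun y => ((s y).map φ).esymm k) x₁ := by
  induction k using Nat.strong_induction_on with
  | _ k ih =>
    rcases Nat.eq_zero_or_pos k with rfl | hk
    · simpa [Multiset.esymm] using holAt_const 1
    · have h1 : (fun y => ((s y).map φ).esymm k) = fun y => (k : ℂ)⁻¹ * ((-1) ^ (k + 1) *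
          ∑ a ∈ Finset.HasAntidiagonal.antidiagonal k with a.1 < k,
            (-1) ^ a.1 * ((s y).map φ).esymm a.1 * ((s y).map (fun z => φ z ^ a.2)).sum) := by
        ext y
        have := Multiset.newton_identity ((s y).map φ) k
        simp only [Multiset.map_map, Function.comp_def] at this
        rw [← this, inv_mul_cancel_left₀]
        exact_mod_cast hk.ne'
      rw [h1]
      refine HolAt.const_mul _ (HolAt.const_mul _ (HolAt.sum _ fun a ha => ?_))
      refine HolAt.mul (HolAt.const_mul _ (ih a.1 (Finset.mem_filter.1 ha).2)) ?_
      exact hs.trace hW h fun z hz => (hφ z hz).pow _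

theorem HolMultiAt.prod (hs : HolMultiAt s x₁) (hW : IsOpen W)
    (h : ∀ z ∈ s x₁, z ∈ W) (hφ : HolOn φ W) :
    HolAt (fun y => ((s y).map φ).prod) x₁ := by
  refine (hs.esymm hW h hφ (s x₁).card).congr ?_
  filter_upwards [hs.eventually_card] with x hx
  rw [Multiset.prod_eq_esymm_card, Multiset.card_map, hx]

end MultiSection

section OneVariable

theorem exists_zero_multiset_aux {K : Set ℂ} (n : ℕ) : ∀ g : ℂ → ℂ, AnalyticOnNhd ℂ g K →
    (∀ t ∈ K, ¬ ∀ᶠ z in 𝓝 t, g z = 0) → {t ∈ K | g t = 0}.Finite →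
    {t ∈ K | g t = 0}.ncard = n →
    ∃ (Z : Multiset ℂ) (u : ℂ → ℂ), AnalyticOnNhd ℂ u K ∧ (∀ t ∈ K, u t ≠ 0) ∧
      (∀ a ∈ Z, a ∈ K) ∧ ∀ t, g t = (Z.map (t - ·)).prod * u t := by
  induction n with
  | zero =>
    intro g hg _ hfin hcard
    rw [Set.ncard_eq_zero hfin] at hcard
    refine ⟨0, g, hg, fun t ht h => ?_, by simp, by simp⟩
    exact Set.eq_empty_iff_forall_notMem.1 hcard t ⟨ht, h⟩
  | succ n ih =>
    intro g hg hne hfin hcard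
    obtain ⟨a, haK, ha⟩ : {t ∈ K | g t = 0}.Nonempty := by
      rw [← Set.ncard_pos hfin]; omega
    obtain ⟨m, w, hw, hwa, hgw⟩ :=
      ((hg a haK).exists_eventuallyEq_pow_smul_nonzero_iff).2 (hne a haK)
    have hm : m ≠ 0 := by
      rintro rfl
      have := hgw.self_of_nhds
      simp [ha] at this
      exact hwa this.symm
    classical
    set u : ℂ → ℂ := fun t => if t = a then w a else g t / (t - a) ^ m with hu
    have hgu : ∀ t, g t = (t - a) ^ m * u t := by
      intro t
      by_cases h : t = a
      · subst h; simp [ha, hm]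
      · have : (t - a) ^ m ≠ 0 := pow_ne_zero _ (sub_ne_zero.2 h)
        simp only [hu, if_neg h]; field_simp
    have hua : u =ᶠ[𝓝 a] w := by
      filter_upwards [hgw] with t ht
      by_cases h : t = a
      · subst h; simp [hu]
      · have : (t - a) ^ m ≠ 0 := pow_ne_zero _ (sub_ne_zero.2 h)
        simp only [hu, if_neg h, ht, smul_eq_mul]; field_simp
    have huan : AnalyticOnNhd ℂ u K := by
      intro t ht
      by_cases h : t = a
      · subst h; exact hw.congr hua.symm
      · have h1 : AnalyticAt ℂ (fun t => g t / (t - a) ^ m) t :=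
          (hg t ht).div ((analyticAt_id.sub analyticAt_const).pow m)
            (pow_ne_zero _ (sub_ne_zero.2 h))
        refine h1.congr ?_
        filter_upwards [isOpen_ne.mem_nhds h] with s hs
        simp only [hu, if_neg hs]
    have hzero : {t ∈ K | u t = 0} = {t ∈ K | g t = 0} \ {a} := by
      ext t
      simp only [Set.mem_sdiff, Set.mem_singleton_iff]
      constructor
      · rintro ⟨h1, h2⟩
        refine ⟨⟨h1, by rw [hgu, h2, mul_zero]⟩, ?_⟩
        rintro rfl
        exact hwa (by simpa [hu] using h2)
      · rintro ⟨⟨h1, h2⟩, h3⟩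
        refine ⟨h1, ?_⟩
        rw [hgu] at h2
        exact (mul_eq_zero.1 h2).resolve_left (pow_ne_zero _ (sub_ne_zero.2 h3))
    obtain ⟨Z, v, hv, hv0, hZ, hZv⟩ := ih u huan
      (fun t ht h => hne t ht (h.mono fun s hs => by rw [hgu, hs, mul_zero]))
      (by rw [hzero]; exact hfin.sdiff)
      (by
        rw [hzero, Set.ncard_sdiff_singleton_of_mem
          (show a ∈ {t | t ∈ K ∧ g t = 0} from ⟨haK, ha⟩), hcard]; rfl)
    refine ⟨Multiset.replicate m a + Z, v, hv, hv0, fun b hb => ?_, fun t => ?_⟩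
    · rcases Multiset.mem_add.1 hb with hb | hb
      · rw [Multiset.eq_of_mem_replicate hb]; exact haK
      · exact hZ b hb
    · rw [hgu, hZv]; simp [mul_assoc]

theorem exists_zero_multiset {K : Set ℂ} (hK : IsCompact K) (hc : IsPreconnected K) {g : ℂ → ℂ}
    (hg : AnalyticOnNhd ℂ g K) {t₀ : ℂ} (ht₀ : t₀ ∈ K) (h₀ : g t₀ ≠ 0) :
    ∃ (Z : Multiset ℂ) (u : ℂ → ℂ), AnalyticOnNhd ℂ u K ∧ (∀ t ∈ K, u t ≠ 0) ∧
      (∀ a ∈ Z, a ∈ K) ∧ ∀ t, g t = (Z.map (t - ·)).prod * u t := by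
  refine exists_zero_multiset_aux _ g hg (fun t ht h => ?_) ?_ rfl
  · exact h₀ (hg.eqOn_zero_of_preconnected_of_eventuallyEq_zero hc ht h ht₀)
  · by_contra hinf
    obtain ⟨x, hx, hacc⟩ := Set.Infinite.exists_accPt_of_subset_isCompact hinf hK fun t ht => ht.1
    rw [accPt_iff_frequently_nhdsNE] at hacc
    exact h₀ (hg.eqOn_zero_of_preconnected_of_frequently_eq_zero hc hx
      (hacc.mono fun t ht => ht.2) ht₀)

theorem logDeriv_multiset_prod_mul (Z : Multiset ℂ) {u : ℂ → ℂ} {t : ℂ}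
    (hu : DifferentiableAt ℂ u t) (hut : u t ≠ 0) (ht : t ∉ Z) :
    logDeriv (fun t => (Z.map (t - ·)).prod * u t) t =
      (Z.map fun a => (t - a)⁻¹).sum + logDeriv u t := by
  have hd : ∀ Z : Multiset ℂ, Differentiable ℂ (fun t : ℂ => (Z.map (t - ·)).prod) := by
    intro Z
    induction Z using Multiset.induction_on with
    | empty => simp
    | cons a Z ih => simp only [Multiset.map_cons, Multiset.prod_cons]; fun_prop
  induction Z using Multiset.induction_on with
  | empty => simp
  | cons a Z ih =>
    rw [Multiset.mem_cons, not_or] at ht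
    have hne : (Z.map (t - ·)).prod ≠ 0 := by
      rw [Ne, Multiset.prod_eq_zero_iff, Multiset.mem_map]
      rintro ⟨b, hb, h⟩
      exact ht.2 (sub_eq_zero.1 h ▸ hb)
    simp only [Multiset.map_cons, Multiset.prod_cons, Multiset.sum_cons, mul_assoc]
    have h1 := logDeriv_mul (f := fun t => t - a)
      (g := fun t => (Z.map (t - ·)).prod * u t) t (sub_ne_zero.2 ht.1) (mul_ne_zero hne hut)
      (by fun_prop) (((hd Z) t).mul hu)
    rw [h1, ih ht.2, add_assoc]
    congr 1
    simp [logDeriv_apply]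

theorem circleIntegral_mul_sum_inv (Z : Multiset ℂ) {φ : ℂ → ℂ} {c : ℂ} {ρ : ℝ} (hρ : 0 < ρ)
    (hφ : DiffContOnCl ℂ φ (ball c ρ)) (hZ : ∀ a ∈ Z, a ∉ sphere c ρ)
    [DecidablePred (· ∈ ball c ρ)] :
    ContinuousOn (fun τ => φ τ * (Z.map fun a => (τ - a)⁻¹).sum) (sphere c ρ) ∧
    ∮ τ in C(c, ρ), φ τ * (Z.map fun a => (τ - a)⁻¹).sum =
      2 * Real.pi * Complex.I * ((Z.filter (· ∈ ball c ρ)).map φ).sum := by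
  have hφc : ContinuousOn φ (sphere c ρ) := hφ.continuousOn_ball.mono sphere_subset_closedBall
  induction Z using Multiset.induction_on with
  | empty => simp [continuousOn_const, circleIntegral]
  | cons a Z ih =>
    obtain ⟨h1, h2⟩ := ih fun b hb => hZ b (Multiset.mem_cons_of_mem hb)
    have ha := hZ a (Multiset.mem_cons_self a Z)
    have hne : ∀ τ ∈ sphere c ρ, τ - a ≠ 0 := fun τ hτ h => ha (sub_eq_zero.1 h ▸ hτ)
    have h3 : ContinuousOn (fun τ => φ τ * (τ - a)⁻¹) (sphere c ρ) :=
      hφc.mul (ContinuousOn.inv₀ (by fun_prop) hne)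
    simp only [Multiset.map_cons, Multiset.sum_cons, mul_add]
    refine ⟨h3.add h1, ?_⟩
    rw [circleIntegral.integral_add (h3.circleIntegrable hρ.le) (h1.circleIntegrable hρ.le), h2]
    by_cases hab : a ∈ ball c ρ
    · rw [Multiset.filter_cons_of_pos _ hab, Multiset.map_cons, Multiset.sum_cons, mul_add]
      congr 1
      have := hφ.circleIntegral_sub_inv_smul hab
      simpa [mul_comm] using this
    · rw [Multiset.filter_cons_of_neg _ hab]
      have hac : ∀ τ ∈ closedBall c ρ, τ - a ≠ 0 := fun τ hτ h => by
        rw [sub_eq_zero] at h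
        subst h
        rw [← ball_union_sphere] at hτ
        exact hτ.elim hab ha
      have h4 : DiffContOnCl ℂ (fun τ => φ τ * (τ - a)⁻¹) (ball c ρ) := by
        refine hφ.smul (DiffContOnCl.inv (f := fun τ => τ - a) ?_ ?_)
        · exact (differentiable_id.sub_const a).diffContOnCl
        · rw [closure_ball _ hρ.ne']; exact hac
      rw [h4.circleIntegral_eq_zero hρ.le, zero_add]

/-- The argument principle with weights, for a function with an explicit factorization. -/
theorem circleIntegral_mul_logDeriv {Z : Multiset ℂ} {g u φ : ℂ → ℂ} {c : ℂ} {ρ : ℝ} (hρ : 0 < ρ)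
    (hu : AnalyticOnNhd ℂ u (closedBall c ρ)) (hu0 : ∀ t ∈ closedBall c ρ, u t ≠ 0)
    (hg : ∀ t, g t = (Z.map (t - ·)).prod * u t) (hg0 : ∀ t ∈ sphere c ρ, g t ≠ 0)
    (hφ : ∀ t ∈ closedBall c ρ, DifferentiableAt ℂ φ t) [DecidablePred (· ∈ ball c ρ)] :
    ∮ τ in C(c, ρ), φ τ * (deriv g τ / g τ) =
      2 * Real.pi * Complex.I * ((Z.filter (· ∈ ball c ρ)).map φ).sum := by
  have hZ : ∀ a ∈ Z, a ∉ sphere c ρ := fun a ha has => hg0 a has (by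
    rw [hg, Multiset.prod_eq_zero, zero_mul]
    exact Multiset.mem_map.2 ⟨a, ha, sub_self a⟩)
  have hφ' : DiffContOnCl ℂ φ (ball c ρ) := by
    apply DifferentiableOn.diffContOnCl
    rw [closure_ball _ hρ.ne']
    exact fun t ht => (hφ t ht).differentiableWithinAt
  obtain ⟨h1, h2⟩ := circleIntegral_mul_sum_inv Z hρ hφ' hZ
  have h3 : DiffContOnCl ℂ (fun τ => φ τ * (deriv u τ / u τ)) (ball c ρ) := by
    apply DifferentiableOn.diffContOnCl
    rw [closure_ball _ hρ.ne']
    intro t ht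
    exact ((hφ t ht).mul ((hu t ht).deriv.differentiableAt.div (hu t ht).differentiableAt
      (hu0 t ht))).differentiableWithinAt
  have e := circleIntegral.integral_add (h1.circleIntegrable hρ.le)
    ((h3.continuousOn_ball.mono sphere_subset_closedBall).circleIntegrable hρ.le)
  rw [h3.circleIntegral_eq_zero hρ.le, add_zero] at e
  rw [← h2, ← e]
  refine circleIntegral.integral_congr hρ.le fun t ht => ?_
  have ht' := sphere_subset_closedBall ht
  have := logDeriv_multiset_prod_mul Z (hu t ht').differentiableAt (hu0 t ht')
    (fun h => hZ t h ht)
  rw [← funext hg] at this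
  simp only [logDeriv_apply] at this
  simp only [this, mul_add]

end OneVariable

section Projection

variable {F : Type*} [NormedAddCommGroup F] [NormedSpace ℂ F]

theorem Multiset.sum_map_eq_sum_filter {α ι : Type*} {T : Finset ι} {P : ι → α → Prop}
    [∀ i, DecidablePred (P i)] (φ : α → ℂ) (Z : Multiset α)
    (h : ∀ z ∈ Z, ∃ a ∈ T, P a z ∧ ∀ b ∈ T, P b z → b = a) :
    (Z.map φ).sum = ∑ a ∈ T, ((Z.filter (P a)).map φ).sum := by
  induction Z using Multiset.induction_on with
  | empty => simp
  | cons z Z ih =>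
    obtain ⟨a, haT, ha, hu⟩ := h z (Multiset.mem_cons_self z Z)
    have key : ∀ b, (((z ::ₘ Z).filter (P b)).map φ).sum =
        (if P b z then φ z else 0) + ((Z.filter (P b)).map φ).sum := by
      intro b
      by_cases hb : P b z
      · simp [Multiset.filter_cons_of_pos _ hb, hb]
      · simp [Multiset.filter_cons_of_neg _ hb, hb]
    simp only [key, Finset.sum_add_distrib, Multiset.map_cons, Multiset.sum_cons]
    have hs : (∑ b ∈ T, if P b z then φ z else 0) = φ z := by
      rw [Finset.sum_eq_single a, if_pos ha]
      · exact fun b hb hba => if_neg fun hP => hba (hu b hb hP)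
      · exact fun h => absurd haT h
    rw [ih fun w hw => h w (Multiset.mem_cons_of_mem hw), hs]

theorem HolOn.slice_left {f : F × ℂ → ℂ} {O : Set (F × ℂ)} {x : F} {t : ℂ} (hf : HolOn f O)
    (h : (x, t) ∈ O) : HolAt (fun y => f (y, t)) x := by
  have := HolAt.comp_clm (f := f) (ContinuousLinearMap.inl ℂ F ℂ) ((0 : F), t) (y := x)
    (by simpa using hf _ h)
  simpa using this

theorem HolOn.slice_right {f : F × ℂ → ℂ} {O : Set (F × ℂ)} {x : F} {t : ℂ} (hf : HolOn f O)
    (h : (x, t) ∈ O) : DifferentiableAt ℂ (fun s => f (x, s)) t := by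
  have := HolAt.comp_clm (f := f) (ContinuousLinearMap.inr ℂ F ℂ) (x, (0 : ℂ)) (y := t)
    (by simpa using hf _ h)
  simpa using this.differentiableAt

theorem holMultiAt_zeros {f : F × ℂ → ℂ} {O : Set (F × ℂ)} (hO : IsOpen O) (hf : HolOn f O)
    {x₁ : F} {t₀ : ℂ} {r : ℝ} (hmem : ∀ t ∈ closedBall t₀ r, (x₁, t) ∈ O)
    (hne : ∀ t ∈ sphere t₀ r, f (x₁, t) ≠ 0) {Z : F → Multiset ℂ} {u : F → ℂ → ℂ}
    (hZ : ∀ᶠ x in 𝓝 x₁, AnalyticOnNhd ℂ (u x) (closedBall t₀ r) ∧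
      (∀ t ∈ closedBall t₀ r, u x t ≠ 0) ∧ (∀ a ∈ Z x, a ∈ closedBall t₀ r) ∧
      ∀ t, f (x, t) = ((Z x).map (t - ·)).prod * u x t) :
    HolMultiAt (fun x => (Z x).map (Prod.mk x)) x₁ := by
  classical
  intro W hW hsW φ hφ
  have hzero : ∀ x t, (∀ t, f (x, t) = ((Z x).map (t - ·)).prod * u x t) → t ∈ Z x →
      f (x, t) = 0 := by
    intro x t h1 h2
    rw [h1, Multiset.prod_eq_zero, zero_mul]
    exact Multiset.mem_map.2 ⟨t, h2, sub_self t⟩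
  obtain ⟨-, hu1, hZ1, hf1⟩ := hZ.self_of_nhds
  have hZb : ∀ a ∈ Z x₁, a ∈ ball t₀ r := by
    intro a ha
    have h1 := hZ1 a ha
    rw [← ball_union_sphere] at h1
    exact h1.resolve_right fun h => hne a h (hzero x₁ a hf1 ha)
  set T := (Z x₁).toFinset with hT
  have hρ1 : ∀ᶠ ρ in 𝓝[>] (0 : ℝ), ∀ a ∈ T,
      closedBall a ρ ⊆ {t | t ∈ ball t₀ r ∧ (x₁, t) ∈ W} := by
    rw [Finset.eventually_all]
    intro a ha
    rw [hT, Multiset.mem_toFinset] at ha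
    have hn : {t | t ∈ ball t₀ r ∧ (x₁, t) ∈ W} ∈ 𝓝 a := by
      refine (isOpen_ball.inter (hW.preimage (by fun_prop :
        Continuous fun t : ℂ => (x₁, t)))).mem_nhds
        ⟨hZb a ha, ?_⟩
      exact hsW _ (Multiset.mem_map_of_mem _ ha)
    exact nhdsWithin_le_nhds (eventually_closedBall_subset hn)
  have hρ2 : ∀ᶠ ρ in 𝓝[>] (0 : ℝ), ∀ a ∈ T, ∀ b ∈ T, a ≠ b →
      Disjoint (closedBall a ρ) (closedBall b ρ) := by
    rw [Finset.eventually_all]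
    intro a _
    rw [Finset.eventually_all]
    intro b _
    by_cases hab : a = b
    · exact Eventually.of_forall fun _ h => absurd hab h
    · filter_upwards [nhdsWithin_le_nhds (Iio_mem_nhds (half_pos (dist_pos.2 hab)))] with ρ hρ _
      apply closedBall_disjoint_closedBall
      have : ρ < dist a b / 2 := hρ
      linarith
  obtain ⟨ρ, ⟨h1, h2⟩, hρ⟩ := ((hρ1.and hρ2).and self_mem_nhdsWithin).exists
  replace hρ : 0 < ρ := hρ
  set K := closedBall t₀ r \ ⋃ a ∈ T, ball a ρ with hK
  have hKc : IsCompact K := (isCompact_closedBall t₀ r).diff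
    (isOpen_biUnion fun a _ => isOpen_ball)
  have hsK : ∀ a ∈ T, sphere a ρ ⊆ K := by
    intro a ha t ht
    refine ⟨ball_subset_closedBall (h1 a ha (sphere_subset_closedBall ht)).1, ?_⟩
    simp only [mem_iUnion, not_exists]
    intro b hb htb
    by_cases hab : a = b
    · subst hab
      exact absurd (mem_ball.1 htb) (by rw [mem_sphere.1 ht]; exact lt_irrefl _)
    · exact Set.disjoint_left.1 (h2 a ha b hb hab) (sphere_subset_closedBall ht)
        (ball_subset_closedBall htb)
  have ev1 : ∀ᶠ x in 𝓝 x₁, ∀ t ∈ closedBall t₀ r, (x, t) ∈ O :=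
    (isCompact_closedBall t₀ r).eventually_forall_of_forall_eventually
      fun t ht => hO.eventually_mem (hmem t ht)
  have ev2 : ∀ᶠ x in 𝓝 x₁, ∀ t ∈ K, f (x, t) ≠ 0 := by
    refine hKc.eventually_forall_of_forall_eventually fun t ht => ?_
    have h3 : f (x₁, t) ≠ 0 := by
      rw [hf1]
      refine mul_ne_zero ?_ (hu1 t ht.1)
      rw [Ne, Multiset.prod_eq_zero_iff, Multiset.mem_map]
      rintro ⟨b, hb, h⟩
      apply ht.2
      have hb' : b ∈ T := Multiset.mem_toFinset.2 hb
      rw [sub_eq_zero.1 h]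
      exact mem_iUnion₂.2 ⟨b, hb', mem_ball_self hρ⟩
    exact (hf _ (hmem t ht.1)).1.eventually_ne h3
  have ev3 : ∀ᶠ x in 𝓝 x₁, ∀ a ∈ T, ∀ t ∈ closedBall a ρ, (x, t) ∈ W := by
    rw [Finset.eventually_all]
    exact fun a ha => (isCompact_closedBall a ρ).eventually_forall_of_forall_eventually
      fun t ht => hW.eventually_mem (h1 a ha ht).2
  obtain ⟨U, hU, hUo, hxU⟩ := _root_.eventually_nhds_iff.1 (((hZ.and ev1).and ev2).and ev3)
  set ft : F × ℂ → ℂ := fun z => deriv (fun t : ℂ => f (z + t • ((0 : F), (1 : ℂ)))) 0 with hft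
  have hftO : HolOn ft O := hf.deriv_line hO _
  have hftd : ∀ x τ, ft (x, τ) = deriv (fun s => f (x, s)) τ := by
    intro x τ
    have := deriv_comp_const_add (fun s => f (x, s)) τ 0
    simp only [add_zero] at this
    rw [← this]
    simp [hft]
  have hpart : ∀ x ∈ U, ∀ z ∈ Z x, ∃ a ∈ T, z ∈ ball a ρ ∧ ∀ b ∈ T, z ∈ ball b ρ → b = a := by
    intro x hx z hz
    obtain ⟨⟨⟨⟨-, -, hZx, hfx⟩, -⟩, hK0⟩, -⟩ := hU x hx
    have h3 : z ∉ K := fun h => hK0 z h (hzero x z hfx hz)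
    have h4 : z ∈ ⋃ a ∈ T, ball a ρ := by
      by_contra h; exact h3 ⟨hZx z hz, h⟩
    obtain ⟨a, ha, hza⟩ := mem_iUnion₂.1 h4
    refine ⟨a, ha, hza, fun b hb hzb => ?_⟩
    by_contra hab
    exact Set.disjoint_left.1 (h2 b hb a ha hab) (ball_subset_closedBall hzb)
      (ball_subset_closedBall hza)
  have htr : ∀ x ∈ U, ((((Z x).map (Prod.mk x)).map φ).sum) =
      ∑ a ∈ T, (2 * Real.pi * Complex.I)⁻¹ *
        ∮ τ in C(a, ρ), φ (x, τ) * (ft (x, τ) / f (x, τ)) := by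
    intro x hx
    obtain ⟨⟨⟨⟨hux, hux0, hZx, hfx⟩, hxO⟩, hK0⟩, hxW⟩ := hU x hx
    rw [Multiset.map_map,
      Multiset.sum_map_eq_sum_filter (P := fun a z => z ∈ ball a ρ) _ _ (hpart x hx)]
    refine Finset.sum_congr rfl fun a ha => ?_
    have hsub : closedBall a ρ ⊆ closedBall t₀ r :=
      fun t ht => ball_subset_closedBall (h1 a ha ht).1
    have := circleIntegral_mul_logDeriv (g := fun t => f (x, t)) (φ := fun t => φ (x, t)) hρ
      (hux.mono hsub) (fun t ht => hux0 t (hsub ht)) hfx (fun t ht => hK0 t (hsK a ha ht))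
      (fun t ht => hφ.slice_right (hxW a ha t ht))
    simp only [← hftd] at this
    rw [this, ← mul_assoc, inv_mul_cancel₀ Complex.two_pi_I_ne_zero, one_mul]
    rfl
  have hhol : HolOn (fun x => ∑ a ∈ T, (2 * Real.pi * Complex.I)⁻¹ *
        ∮ τ in C(a, ρ), φ (x, τ) * (ft (x, τ) / f (x, τ))) U := by
    intro x hx
    refine HolAt.sum _ fun a ha => HolAt.const_mul _ ?_
    refine HolOn.circleIntegral hUo (G := fun x τ => φ (x, τ) * (ft (x, τ) / f (x, τ)))
      hρ.le ?_ ?_ x hx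
    · have hOs : U ×ˢ sphere a ρ ⊆ O := fun z hz =>
        (hU z.1 hz.1).1.1.2 z.2 (hsK a ha hz.2).1
      have hWs : U ×ˢ sphere a ρ ⊆ W := fun z hz =>
        (hU z.1 hz.1).2 a ha z.2 (sphere_subset_closedBall hz.2)
      exact (hφ.continuousOn.mono hWs).mul ((hftO.continuousOn.mono hOs).div
        (hf.continuousOn.mono hOs) fun z hz => (hU z.1 hz.1).1.2 z.2 (hsK a ha hz.2))
    · intro τ hτ y hy
      have hyO := (hU y hy).1.1.2 τ (hsK a ha hτ).1
      simp only [div_eq_mul_inv]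
      exact (hφ.slice_left ((hU y hy).2 a ha τ (sphere_subset_closedBall hτ))).mul
        ((hftO.slice_left hyO).mul ((hf.slice_left hyO).inv ((hU y hy).1.2 τ (hsK a ha hτ))))
  filter_upwards [hUo.mem_nhds hxU] with x hx
  refine ⟨?_, (hhol x hx).congr ?_⟩
  · intro z hz
    obtain ⟨t, ht, rfl⟩ := Multiset.mem_map.1 hz
    obtain ⟨a, ha, hta, -⟩ := hpart x hx t ht
    exact (hU x hx).2 a ha t (ball_subset_closedBall hta)
  · filter_upwards [hUo.mem_nhds hx] with y hy
    exact (htr y hy).symm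

/-- Zeros of a holomorphic function in a family of discs form a holomorphic multisection. -/
theorem exists_holMultiAt_zeros {f : F × ℂ → ℂ} {O : Set (F × ℂ)} (hO : IsOpen O)
    (hf : HolOn f O) {x₀ : F} {t₀ : ℂ} {r : ℝ} (hr : 0 < r)
    (hmem : ∀ t ∈ closedBall t₀ r, (x₀, t) ∈ O)
    (hne : ∀ t ∈ sphere t₀ r, f (x₀, t) ≠ 0) :
    ∃ s : F → Multiset (F × ℂ), ∀ᶠ x in 𝓝 x₀, HolMultiAt s x ∧
      (∀ y ∈ s x, y.1 = x ∧ y.2 ∈ ball t₀ r ∧ f y = 0) ∧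
      ∀ t ∈ ball t₀ r, f (x, t) = 0 → (x, t) ∈ s x := by
  classical
  have ev1 : ∀ᶠ x in 𝓝 x₀, ∀ t ∈ closedBall t₀ r, (x, t) ∈ O :=
    (isCompact_closedBall t₀ r).eventually_forall_of_forall_eventually
      fun t ht => hO.eventually_mem (hmem t ht)
  have ev2 : ∀ᶠ x in 𝓝 x₀, ∀ t ∈ sphere t₀ r, f (x, t) ≠ 0 :=
    (isCompact_sphere t₀ r).eventually_forall_of_forall_eventually
      fun t ht => (hf _ (hmem t (sphere_subset_closedBall ht))).1.eventually_ne (hne t ht)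
  have key : ∀ x : F, ∃ (Z : Multiset ℂ) (u : ℂ → ℂ), ((∀ t ∈ closedBall t₀ r, (x, t) ∈ O) ∧
      (∀ t ∈ sphere t₀ r, f (x, t) ≠ 0)) → AnalyticOnNhd ℂ u (closedBall t₀ r) ∧
      (∀ t ∈ closedBall t₀ r, u t ≠ 0) ∧ (∀ a ∈ Z, a ∈ closedBall t₀ r) ∧
      ∀ t, f (x, t) = (Z.map (t - ·)).prod * u t := by
    intro x
    by_cases h : (∀ t ∈ closedBall t₀ r, (x, t) ∈ O) ∧ (∀ t ∈ sphere t₀ r, f (x, t) ≠ 0)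
    · obtain ⟨t₁, ht₁⟩ : (sphere t₀ r).Nonempty := NormedSpace.sphere_nonempty.2 hr.le
      have hop : IsOpen {t | (x, t) ∈ O} :=
        hO.preimage (by fun_prop : Continuous fun t : ℂ => (x, t))
      have han : AnalyticOnNhd ℂ (fun t => f (x, t)) (closedBall t₀ r) := by
        have hd : DifferentiableOn ℂ (fun t => f (x, t)) {t | (x, t) ∈ O} :=
          fun t ht => (hf.slice_right ht).differentiableWithinAt
        exact fun t ht => hd.analyticAt (hop.mem_nhds (h.1 t ht))
      obtain ⟨Z, u, hZu⟩ := exists_zero_multiset (isCompact_closedBall t₀ r)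
        (convex_closedBall t₀ r).isPreconnected han (sphere_subset_closedBall ht₁) (h.2 t₁ ht₁)
      exact ⟨Z, u, fun _ => hZu⟩
    · exact ⟨0, 0, fun h' => absurd h' h⟩
  choose Z u hZu using key
  refine ⟨fun x => (Z x).map (Prod.mk x), ?_⟩
  have ev := ev1.and ev2
  filter_upwards [ev, ev.eventually_nhds] with x hx hx'
  obtain ⟨-, hu0, hZ, hfx⟩ := hZu x hx
  refine ⟨holMultiAt_zeros hO hf hx.1 hx.2 (hx'.mono fun y hy => hZu y hy), ?_, ?_⟩
  · intro y hy
    obtain ⟨t, ht, rfl⟩ := Multiset.mem_map.1 hy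
    have h0 : f (x, t) = 0 := by
      rw [hfx, Multiset.prod_eq_zero, zero_mul]
      exact Multiset.mem_map.2 ⟨t, ht, sub_self t⟩
    refine ⟨rfl, ?_, h0⟩
    have h1 := hZ t ht
    rw [← ball_union_sphere] at h1
    exact h1.resolve_right fun h => hx.2 t h h0
  · intro t ht h0
    rw [hfx] at h0
    have h1 := (mul_eq_zero.1 h0).resolve_right (hu0 t (ball_subset_closedBall ht))
    rw [Multiset.prod_eq_zero_iff, Multiset.mem_map] at h1
    obtain ⟨b, hb, h⟩ := h1
    rw [sub_eq_zero.1 h]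
    exact Multiset.mem_map_of_mem _ hb

end Projection

section Analytic

variable {E F : Type*} [NormedAddCommGroup E] [NormedSpace ℂ E]
  [NormedAddCommGroup F] [NormedSpace ℂ F] {A B : Set E} {a : E}

/-- Near `a`, the set `A` is the common zero set of a family of holomorphic functions. -/
def AnaAt (A : Set E) (a : E) : Prop :=
  ∃ W : Set E, IsOpen W ∧ a ∈ W ∧ ∃ 𝓕 : Submodule ℂ (E → ℂ), (∀ f ∈ 𝓕, HolOn f W) ∧
    ∀ z ∈ W, (z ∈ A ↔ ∀ f ∈ 𝓕, f z = 0)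

theorem AnaAt.of_family {W : Set E} (hW : IsOpen W) (ha : a ∈ W) (𝓕 : Set (E → ℂ))
    (h𝓕 : ∀ f ∈ 𝓕, HolOn f W) (hA : ∀ z ∈ W, (z ∈ A ↔ ∀ f ∈ 𝓕, f z = 0)) : AnaAt A a := by
  refine ⟨W, hW, ha, Submodule.span ℂ 𝓕, fun f hf => ?_, fun z hz => ?_⟩
  · refine Submodule.span_induction (p := fun f _ => HolOn f W) h𝓕 (fun x _ => holAt_const 0)
      (fun f g _ _ hf hg x hx => (hf x hx).add (hg x hx))
      (fun c f _ hf x hx => (hf x hx).const_mul c) hf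
  · rw [hA z hz]
    refine ⟨fun h f hf => ?_, fun h f hf => h f (Submodule.subset_span hf)⟩
    refine Submodule.span_induction (p := fun f _ => f z = 0) h rfl
      (fun f g _ _ hf hg => by simp [hf, hg]) (fun c f _ hf => by simp [hf]) hf

theorem AnaAt.congr (hA : AnaAt A a) (h : ∀ᶠ z in 𝓝 a, (z ∈ A ↔ z ∈ B)) : AnaAt B a := by
  obtain ⟨W, hW, ha, 𝓕, h1, h2⟩ := hA
  obtain ⟨U, hU, hUo, haU⟩ := _root_.eventually_nhds_iff.1 h
  exact ⟨W ∩ U, hW.inter hUo, ⟨ha, haU⟩, 𝓕, fun f hf => (h1 f hf).mono inter_subset_left,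
    fun z hz => by rw [← hU z hz.2, h2 z hz.1]⟩

theorem AnaAt.inter (hA : AnaAt A a) (hB : AnaAt B a) : AnaAt (A ∩ B) a := by
  obtain ⟨W, hW, ha, 𝓕, h1, h2⟩ := hA
  obtain ⟨W', hW', ha', 𝓖, h1', h2'⟩ := hB
  refine AnaAt.of_family (hW.inter hW') ⟨ha, ha'⟩ (𝓕 ∪ 𝓖) ?_ ?_
  · rintro f (hf | hf)
    · exact (h1 f hf).mono inter_subset_left
    · exact (h1' f hf).mono inter_subset_right
  · intro z hz
    rw [Set.mem_inter_iff, h2 z hz.1, h2' z hz.2]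
    constructor
    · rintro ⟨h3, h4⟩ f (hf | hf)
      · exact h3 f hf
      · exact h4 f hf
    · exact fun h => ⟨fun f hf => h f (Or.inl hf), fun f hf => h f (Or.inr hf)⟩

theorem AnaAt.union (hA : AnaAt A a) (hB : AnaAt B a) : AnaAt (A ∪ B) a := by
  obtain ⟨W, hW, ha, 𝓕, h1, h2⟩ := hA
  obtain ⟨W', hW', ha', 𝓖, h1', h2'⟩ := hB
  refine AnaAt.of_family (hW.inter hW') ⟨ha, ha'⟩
    {k | ∃ f ∈ 𝓕, ∃ g ∈ 𝓖, k = fun z => f z * g z} ?_ ?_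
  · rintro k ⟨f, hf, g, hg, rfl⟩ x hx
    exact (h1 f hf x hx.1).mul (h1' g hg x hx.2)
  · intro z hz
    rw [Set.mem_union, h2 z hz.1, h2' z hz.2]
    constructor
    · rintro (h | h) k ⟨f, hf, g, hg, rfl⟩
      · simp [h f hf]
      · simp [h g hg]
    · intro h
      by_contra! hcon
      obtain ⟨⟨f, hf, hfz⟩, ⟨g, hg, hgz⟩⟩ := hcon
      exact mul_ne_zero hfz hgz (h _ ⟨f, hf, g, hg, rfl⟩)

theorem anaAt_empty : AnaAt (∅ : Set E) a :=
  AnaAt.of_family isOpen_univ (mem_univ a) {fun _ => 1} (by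
    rintro f rfl x _; exact holAt_const 1) (by simp)

theorem exists_mem_submodule_forall_ne_zero {X : Type*} (𝓕 : Submodule ℂ (X → ℂ)) (T : Finset X)
    (h : ∀ z ∈ T, ∃ f ∈ 𝓕, f z ≠ 0) : ∃ f ∈ 𝓕, ∀ z ∈ T, f z ≠ 0 := by
  classical
  induction T using Finset.induction_on with
  | empty => exact ⟨0, 𝓕.zero_mem, by simp⟩
  | insert z T hz ih =>
    obtain ⟨f, hf, hfT⟩ := ih fun w hw => h w (Finset.mem_insert_of_mem hw)
    obtain ⟨g, hg, hgz⟩ := h z (Finset.mem_insert_self z T)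
    obtain ⟨c, hc⟩ := Infinite.exists_notMem_finset ((insert z T).image fun w => -(f w) / g w)
    refine ⟨f + c • g, 𝓕.add_mem hf (𝓕.smul_mem c hg), fun w hw h0 => ?_⟩
    by_cases hgw : g w = 0
    · have h1 : f w = 0 := by simpa [hgw] using h0
      rcases Finset.mem_insert.1 hw with rfl | hw
      · exact hgz hgw
      · exact hfT w hw h1
    · apply hc
      refine Finset.mem_image.2 ⟨w, hw, ?_⟩
      have h1 : f w + c * g w = 0 := by simpa using h0
      field_simp
      linear_combination -h1

theorem exists_clm_forall_ne_zero (T : Finset E) (h : ∀ z ∈ T, z ≠ 0) :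
    ∃ L : E →L[ℂ] ℂ, ∀ z ∈ T, L z ≠ 0 := by
  let 𝓛 : (E →L[ℂ] ℂ) →ₗ[ℂ] (E → ℂ) :=
    { toFun := fun L => ⇑L, map_add' := fun _ _ => rfl, map_smul' := fun _ _ => rfl }
  obtain ⟨f, ⟨L, rfl⟩, hL⟩ := exists_mem_submodule_forall_ne_zero (LinearMap.range 𝓛) T
    fun z hz => by
      obtain ⟨L, hL⟩ := SeparatingDual.exists_ne_zero (R := ℂ) (h z hz)
      exact ⟨𝓛 L, ⟨L, rfl⟩, hL⟩
  exact ⟨L, hL⟩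

theorem exists_clm_injOn (T : Finset E) : ∃ L : E →L[ℂ] ℂ, Set.InjOn L (T : Set E) := by
  classical
  obtain ⟨L, hL⟩ := exists_clm_forall_ne_zero
    (((T ×ˢ T).image fun p => p.1 - p.2).filter (· ≠ 0)) fun z hz => (Finset.mem_filter.1 hz).2
  refine ⟨L, fun x hx y hy hxy => ?_⟩
  by_contra hne
  refine hL (x - y) (Finset.mem_filter.2 ⟨Finset.mem_image.2 ⟨(x, y), ?_, rfl⟩,
    sub_ne_zero.2 hne⟩) ?_
  · exact Finset.mem_product.2 ⟨hx, hy⟩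
  · rw [map_sub, hxy, sub_self]

theorem holMultiAt_singleton (e : F →L[ℂ] E) (x₁ : F) :
    HolMultiAt (fun x => ({e x} : Multiset E)) x₁ := by
  intro W hW hW1 φ hφ
  have h1 : ∀ᶠ x in 𝓝 x₁, e x ∈ W :=
    e.continuous.continuousAt.eventually (hW.mem_nhds (hW1 _ (Multiset.mem_singleton_self _)))
  filter_upwards [h1] with x hx
  refine ⟨by simpa using hx, ?_⟩
  simpa using (hφ _ hx).comp_linear e

end Analytic

section LocalProjection

variable {E : Type*} [NormedAddCommGroup E] [NormedSpace ℂ E] [FiniteDimensional ℂ E]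

/-- A local analytic set which meets a fibre of a linear projection in an isolated point is
contained, near that point, in a holomorphic multisection of the projection. -/
theorem AnaAt.exists_multisection (l : ℕ) : ∀ {F : Type*} [NormedAddCommGroup F]
    [NormedSpace ℂ F] (π : E →L[ℂ] F), Function.Surjective π →
    Module.finrank ℂ E = Module.finrank ℂ F + l → ∀ {A : Set E} {a : E}, AnaAt A a →
    (∀ᶠ z in 𝓝 a, π z = π a → z ∈ A → z = a) → ∀ {N : Set E}, N ∈ 𝓝 a →
    ∃ (s : F → Multiset E) (W : Set E), IsOpen W ∧ a ∈ W ∧ W ⊆ N ∧ ∀ᶠ x in 𝓝 (π a),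
      HolMultiAt s x ∧ (∀ z ∈ s x, z ∈ W ∧ π z = x) ∧
      ∀ z ∈ W, π z = x → z ∈ A → z ∈ s x := by
  induction l with
  | zero =>
    intro F _ _ π hπ hdim A a hA hiso N hN
    have : FiniteDimensional ℂ F := Module.Finite.of_surjective (π : E →ₗ[ℂ] F) hπ
    have hinj : Function.Injective π :=
      (LinearMap.injective_iff_surjective_of_finrank_eq_finrank (f := (π : E →ₗ[ℂ] F))
        (by simpa using hdim)).2 hπ
    let e : E ≃L[ℂ] F :=
      (LinearEquiv.ofBijective (π : E →ₗ[ℂ] F) ⟨hinj, hπ⟩).toContinuousLinearEquiv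
    have heπ : ∀ z, e.symm (π z) = z := fun z => e.symm_apply_apply z
    have hπe : ∀ x, π (e.symm x) = x := fun x => e.apply_symm_apply x
    refine ⟨fun x => {e.symm x}, interior N, isOpen_interior, mem_interior_iff_mem_nhds.2 hN,
      interior_subset, ?_⟩
    have h1 : ∀ᶠ x in 𝓝 (π a), e.symm x ∈ interior N := by
      refine e.symm.continuous.continuousAt.eventually (isOpen_interior.mem_nhds ?_)
      rw [heπ]; exact mem_interior_iff_mem_nhds.2 hN
    filter_upwards [h1] with x hx
    refine ⟨holMultiAt_singleton (e.symm : F →L[ℂ] E) x, ?_, ?_⟩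
    · intro z hz
      rw [Multiset.mem_singleton.1 hz]
      exact ⟨hx, hπe x⟩
    · rintro z - rfl -
      rw [heπ]; exact Multiset.mem_singleton_self z
  | succ l ih =>
    intro F _ _ π hπ hdim A a hA hiso N hN
    have : FiniteDimensional ℂ F := Module.Finite.of_surjective (π : E →ₗ[ℂ] F) hπ
    obtain ⟨v, hv, hv0⟩ : ∃ v, π v = 0 ∧ v ≠ 0 := by
      by_contra! hcon
      have hinj : Function.Injective (π : E →ₗ[ℂ] F) :=
        (injective_iff_map_eq_zero (π : E →ₗ[ℂ] F)).2 hcon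
      have := LinearMap.finrank_le_finrank_of_injective hinj
      omega
    obtain ⟨L, hL⟩ := SeparatingDual.exists_ne_zero (R := ℂ) hv0
    let π' : E →L[ℂ] F × ℂ := π.prod L
    have hπ' : Function.Surjective π' := by
      rintro ⟨x, c⟩
      obtain ⟨z, rfl⟩ := hπ x
      refine ⟨z + ((c - L z) / L v) • v, ?_⟩
      simp [π', hv, hL]
    obtain ⟨W, hW, haW, 𝓕, h𝓕, hAW⟩ := id hA
    obtain ⟨s₁, W₁, hW₁, haW₁, hW₁N, hs₁⟩ := ih π' hπ'
      (by rw [Module.finrank_prod, Module.finrank_self, hdim]; ring) hA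
      (hiso.mono fun z hz h => hz (congrArg Prod.fst h))
      (inter_mem hN (inter_mem (hW.mem_nhds haW) hiso))
    have hπa : π' a = (π a, L a) := rfl
    rw [hπa] at hs₁
    obtain ⟨ε, hε, hs₁ε⟩ := Metric.eventually_nhds_iff_ball.1 hs₁
    set t₁ : ℂ := L a + (ε / 2 : ℝ) with ht₁
    have ht₁O : (π a, t₁) ∈ ball (π a, L a) ε := by
      rw [← ball_prod_same]
      refine ⟨mem_ball_self hε, ?_⟩
      simp [ht₁, abs_of_pos hε]
      exact hε
    have ht₁ne : t₁ ≠ L a := by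
      intro h
      have : ((ε / 2 : ℝ) : ℂ) = 0 := by simpa [ht₁] using h
      rw [Complex.ofReal_eq_zero] at this
      linarith
    classical
    obtain ⟨f, hf, hfne⟩ := exists_mem_submodule_forall_ne_zero 𝓕 (s₁ (π a, t₁)).toFinset (by
      intro z hz
      obtain ⟨hzW, hzπ⟩ := (hs₁ε _ ht₁O).2.1 z (Multiset.mem_toFinset.1 hz)
      have hzN := hW₁N hzW
      have hzA : z ∉ A := by
        intro hzA
        have h1 : z = a := hzN.2.2 (congrArg Prod.fst hzπ) hzA
        rw [h1, hπa] at hzπ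
        exact ht₁ne (congrArg Prod.snd hzπ).symm
      rw [hAW z hzN.2.1] at hzA
      push Not at hzA
      exact hzA)
    have hfW : HolOn f W₁ := (h𝓕 f hf).mono fun z hz => (hW₁N hz).2.1
    set Nf : F × ℂ → ℂ := fun y => ((s₁ y).map f).prod with hNf
    have hNfO : HolOn Nf (ball (π a, L a) ε) := fun y hy =>
      (hs₁ε y hy).1.prod hW₁ (fun z hz => ((hs₁ε y hy).2.1 z hz).1) hfW
    have hline : ∀ t : ℂ, ((π a, 0) : F × ℂ) + t • ((0 : F), (1 : ℂ)) = (π a, t) := by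
      intro t; simp
    have hpunct := HolOn.eventually_line_ne_zero isOpen_ball (convex_ball _ _) hNfO
      (a := (π a, 0)) (v := (0, 1)) (t₀ := L a) (t₁ := t₁)
      (by rw [hline]; exact mem_ball_self hε) (by rw [hline]; exact ht₁O) (by
        rw [hline, hNf, Ne, Multiset.prod_eq_zero_iff, Multiset.mem_map]
        rintro ⟨z, hz, h0⟩
        exact hfne z (Multiset.mem_toFinset.2 hz) h0)
    simp only [hline] at hpunct
    rw [eventually_nhdsWithin_iff] at hpunct
    obtain ⟨r, hr, hrsub⟩ := Metric.nhds_basis_closedBall.mem_iff.1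
      (inter_mem hpunct (ball_mem_nhds (L a) hε))
    have hrO : ∀ t ∈ closedBall (L a) r, (π a, t) ∈ ball (π a, L a) ε := by
      intro t ht
      rw [← ball_prod_same]
      exact ⟨mem_ball_self hε, (hrsub ht).2⟩
    obtain ⟨s₂, hs₂⟩ := exists_holMultiAt_zeros isOpen_ball hNfO hr hrO fun t ht =>
      (hrsub (sphere_subset_closedBall ht)).1 (by
        rintro rfl
        simp at ht
        exact hr.ne ht)
    refine ⟨fun x => (s₂ x).bind s₁, W₁ ∩ π' ⁻¹' (ball (π a) ε ×ˢ ball (L a) r),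
      hW₁.inter ((isOpen_ball.prod isOpen_ball).preimage π'.continuous),
      ⟨haW₁, mem_ball_self hε, mem_ball_self hr⟩, fun z hz => (hW₁N hz.1).1, ?_⟩
    filter_upwards [hs₂, ball_mem_nhds (π a) hε] with x hx hxε
    obtain ⟨hx1, hx2, hx3⟩ := hx
    have hyO : ∀ y : F × ℂ, y.1 = x → y.2 ∈ ball (L a) r → y ∈ ball (π a, L a) ε := by
      rintro ⟨y1, y2⟩ rfl h2
      rw [← ball_prod_same]
      exact ⟨hxε, (hrsub (ball_subset_closedBall h2)).2⟩
    refine ⟨hx1.bind fun y hy => (hs₁ε y (hyO y (hx2 y hy).1 (hx2 y hy).2.1)).1, ?_, ?_⟩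
    · intro z hz
      obtain ⟨y, hy, hzy⟩ := Multiset.mem_bind.1 hz
      obtain ⟨hy1, hy2, -⟩ := hx2 y hy
      obtain ⟨hzW, hzπ⟩ := (hs₁ε y (hyO y hy1 hy2)).2.1 z hzy
      refine ⟨⟨hzW, ?_⟩, ?_⟩
      · rw [Set.mem_preimage, hzπ]
        exact ⟨by rw [hy1]; exact hxε, hy2⟩
      · rw [← hy1, ← hzπ]; rfl
    · rintro z ⟨hzW, hz1, hz2⟩ rfl hzA
      have hy := hyO (π' z) rfl hz2
      have hzs := (hs₁ε _ hy).2.2 z hzW rfl hzA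
      refine Multiset.mem_bind.2 ⟨π' z, hx3 _ hz2 ?_, hzs⟩
      change Nf (π' z) = 0
      rw [hNf]
      refine Multiset.prod_eq_zero (Multiset.mem_map.2 ⟨z, hzs, ?_⟩)
      exact (hAW z (hW₁N hzW).2.1).1 hzA f hf

end LocalProjection

section Hankel

variable {E : Type*}

/-- The weighted Hankel matrix of power sums over a multiset of points. -/
def hankel (m : Multiset E) (w : E → ℂ) (L : E → ℂ) (k : ℕ) : Matrix (Fin k) (Fin k) ℂ :=
  Matrix.of fun i j => (m.map fun z => w z * L z ^ ((i : ℕ) + j)).sum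

open Classical in
theorem hankel_apply_eq (m : Multiset E) (w L : E → ℂ) {k : ℕ} (i j : Fin k) :
    hankel m w L k i j = ∑ z ∈ m.toFinset with w z ≠ 0,
      L z ^ (i : ℕ) * (m.count z * w z * L z ^ (j : ℕ)) := by
  rw [hankel, Matrix.of_apply, Finset.sum_multiset_map_count, Finset.sum_filter]
  refine Finset.sum_congr rfl fun z _ => ?_
  by_cases hz : w z = 0
  · simp [hz]
  · simp only [nsmul_eq_mul, ne_eq, hz, not_false_eq_true, if_true]; ring

open Classical in
theorem le_card_of_hankel_det_ne_zero {m : Multiset E} {w L : E → ℂ} {k : ℕ}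
    (h : (hankel m w L k).det ≠ 0) : k ≤ {z ∈ m.toFinset | w z ≠ 0}.card := by
  set P := {z ∈ m.toFinset | w z ≠ 0} with hP
  have hfac : hankel m w L k = (Matrix.of fun (i : Fin k) (z : P) => L z ^ (i : ℕ)) *
      (Matrix.of fun (z : P) (j : Fin k) => m.count (z : E) * w z * L z ^ (j : ℕ)) := by
    ext i j
    rw [hankel_apply_eq, Matrix.mul_apply, ← hP, ← Finset.sum_coe_sort]
    rfl
  have h1 := Matrix.rank_of_isUnit _ ((Matrix.isUnit_iff_isUnit_det _).2 (isUnit_iff_ne_zero.2 h))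
  rw [Fintype.card_fin] at h1
  rw [← h1, hfac]
  refine (Matrix.rank_mul_le_left _ _).trans ((Matrix.rank_le_card_width _).trans ?_)
  simp

open Classical in
theorem hankel_det_ne_zero {m : Multiset E} {w L : E → ℂ} {k : ℕ}
    (hk : {z ∈ m.toFinset | w z ≠ 0}.card = k) (hL : Set.InjOn L (m.toFinset : Set E)) :
    (hankel m w L k).det ≠ 0 := by
  set P := {z ∈ m.toFinset | w z ≠ 0} with hP
  let e : Fin k ≃ P := (P.equivFinOfCardEq hk).symm
  have hfac : hankel m w L k = (Matrix.vandermonde fun i => L (e i)).transpose *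
      (Matrix.diagonal (fun i => (m.count (e i : E) : ℂ) * w (e i)) *
        Matrix.vandermonde fun i => L (e i)) := by
    ext i j
    rw [hankel_apply_eq, Matrix.mul_apply, ← hP, ← Finset.sum_coe_sort, ← e.sum_comp]
    refine Finset.sum_congr rfl fun l _ => ?_
    rw [Matrix.diagonal_mul]
    rfl
  have hmem : ∀ i, (e i : E) ∈ m.toFinset ∧ w (e i) ≠ 0 := fun i =>
    Finset.mem_filter.1 (e i).2
  have hV : (Matrix.vandermonde fun i => L (e i)).det ≠ 0 := by
    rw [Matrix.det_vandermonde_ne_zero_iff]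
    intro i j hij
    exact e.injective (Subtype.ext (hL (hmem i).1 (hmem j).1 hij))
  rw [hfac, Matrix.det_mul, Matrix.det_mul, Matrix.det_transpose, Matrix.det_diagonal]
  refine mul_ne_zero hV (mul_ne_zero (Finset.prod_ne_zero_iff.2 fun i _ => ?_) hV)
  refine mul_ne_zero (Nat.cast_ne_zero.2 ?_) (hmem i).2
  exact (Multiset.count_pos.2 (Multiset.mem_toFinset.1 (hmem i).1)).ne'

end Hankel

section Generic

variable {E F : Type*} [NormedAddCommGroup E] [NormedSpace ℂ E]
  [NormedAddCommGroup F] [NormedSpace ℂ F]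

theorem HolMultiAt.hankel_det {s : F → Multiset E} {x : F} {W : Set E} (hs : HolMultiAt s x)
    (hW : IsOpen W) (h : ∀ z ∈ s x, z ∈ W) {w : E → ℂ} (hw : HolOn w W) (L : E →L[ℂ] ℂ) (k : ℕ) :
    HolAt (fun y => (hankel (s y) w L k).det) x := by
  simp only [Matrix.det_apply']
  refine HolAt.sum _ fun σ _ => HolAt.const_mul _ (HolAt.prod _ fun i _ => ?_)
  exact hs.trace hW h fun z hz => (hw z hz).mul ((holAt_continuousLinearMap L).pow _)

open Classical in
/-- Off a thin set, the common zeros of a family inside a multisection are the zeros of one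
member of the family, and their number is constant. -/
theorem exists_generic_member {s : F → Multiset E} {U : Set F} {W : Set E} {d : ℕ}
    (hU : U.Nonempty) (hW : IsOpen W)
    (hs : ∀ x ∈ U, HolMultiAt s x ∧ (∀ z ∈ s x, z ∈ W) ∧ (s x).card ≤ d)
    (𝓕 : Submodule ℂ (E → ℂ)) (h𝓕 : ∀ f ∈ 𝓕, HolOn f W) :
    ∃ f ∈ 𝓕, ∃ h : F → ℂ, ∃ k : ℕ, HolOn h U ∧ (∃ x ∈ U, h x ≠ 0) ∧ ∀ x ∈ U, h x ≠ 0 →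
      {z ∈ (s x).toFinset | f z ≠ 0}.card = k ∧
      ∀ z ∈ s x, (f z = 0 ↔ ∀ g ∈ 𝓕, g z = 0) := by
  set S : Set ℕ := {k | ∃ f ∈ 𝓕, ∃ x ∈ U, {z ∈ (s x).toFinset | f z ≠ 0}.card = k} with hS
  have hSne : S.Nonempty := by
    obtain ⟨x, hx⟩ := hU
    exact ⟨_, 0, 𝓕.zero_mem, x, hx, rfl⟩
  have hSb : BddAbove S := by
    refine ⟨d, ?_⟩
    rintro k ⟨f, -, x, hx, rfl⟩
    exact (Finset.card_filter_le _ _).trans ((Multiset.toFinset_card_le _).trans (hs x hx).2.2)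
  obtain ⟨f, hf, x₁, hx₁, hk⟩ := Nat.sSup_mem hSne hSb
  obtain ⟨L, hL⟩ := exists_clm_injOn (s x₁).toFinset
  refine ⟨f, hf, fun x => (hankel (s x) f L (sSup S)).det, sSup S, fun x hx =>
    (hs x hx).1.hankel_det hW (hs x hx).2.1 (h𝓕 f hf) L _,
    ⟨x₁, hx₁, hankel_det_ne_zero hk hL⟩, fun x hx hhx => ?_⟩
  have hcard : {z ∈ (s x).toFinset | f z ≠ 0}.card = sSup S :=
    le_antisymm (le_csSup hSb ⟨f, hf, x, hx, rfl⟩) (le_card_of_hankel_det_ne_zero hhx)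
  refine ⟨hcard, fun z hz => ⟨fun h0 g' hg' => ?_, fun h => h f hf⟩⟩
  by_contra hne
  obtain ⟨g, hg, hgne⟩ := exists_mem_submodule_forall_ne_zero 𝓕
    {z ∈ (s x).toFinset | ∃ g ∈ 𝓕, g z ≠ 0} fun z hz => (Finset.mem_filter.1 hz).2
  have hsub : {z ∈ (s x).toFinset | f z ≠ 0} ⊆ {z ∈ (s x).toFinset | g z ≠ 0} := by
    intro y hy
    rw [Finset.mem_filter] at hy ⊢
    exact ⟨hy.1, hgne y (Finset.mem_filter.2 ⟨hy.1, f, hf, hy.2⟩)⟩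
  have heq := Finset.eq_of_subset_of_card_le hsub
    ((le_csSup hSb ⟨g, hg, x, hx, rfl⟩).trans hcard.ge)
  have hz' := Multiset.mem_toFinset.2 hz
  have hzg : z ∈ {z ∈ (s x).toFinset | g z ≠ 0} :=
    Finset.mem_filter.2 ⟨hz', hgne z (Finset.mem_filter.2 ⟨hz', g', hg', hne⟩)⟩
  rw [← heq] at hzg
  exact (Finset.mem_filter.1 hzg).2 h0

open Classical in
/-- Where the number of distinct points is locally constant, a multisection is locally a disjoint
union of sections with constant multiplicities. -/
theorem HolMultiAt.exists_sections {s : F → Multiset E} {x₁ : F} (hs : HolMultiAt s x₁)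
    (hν : ∀ᶠ x in 𝓝 x₁, (s x).toFinset.card = (s x₁).toFinset.card) {N : E → Set E}
    (hN : ∀ z ∈ s x₁, N z ∈ 𝓝 z) :
    ∃ O : E → Set E, (∀ z ∈ s x₁, IsOpen (O z) ∧ z ∈ O z ∧ O z ⊆ N z) ∧
      (∀ z ∈ s x₁, ∀ z' ∈ s x₁, z ≠ z' → Disjoint (O z) (O z')) ∧
      ∀ᶠ x in 𝓝 x₁, ∃ y : E → E,
        (∀ z ∈ s x₁, y z ∈ O z ∧ (s x).count (y z) = (s x₁).count z) ∧
        Set.InjOn y ((s x₁).toFinset : Set E) ∧ (s x).toFinset = (s x₁).toFinset.image y := by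
  set T := (s x₁).toFinset with hT
  obtain ⟨V, hV, hVd⟩ := (T.finite_toSet).t2_separation
  set O : E → Set E := fun z => V z ∩ interior (N z) with hO
  have hOo : ∀ z, IsOpen (O z) := fun z => (hV z).2.inter isOpen_interior
  have hzO : ∀ z ∈ s x₁, z ∈ O z := fun z hz => ⟨(hV z).1, mem_interior_iff_mem_nhds.2 (hN z hz)⟩
  have hOd : ∀ z ∈ s x₁, ∀ z' ∈ s x₁, z ≠ z' → Disjoint (O z) (O z') := by
    intro z hz z' hz' hne
    exact (hVd (Multiset.mem_toFinset.2 hz) (Multiset.mem_toFinset.2 hz') hne).mono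
      inter_subset_left inter_subset_left
  have hcount : ∀ z ∈ s x₁, (s x₁).countP (· ∈ O z) = (s x₁).count z := by
    intro z hz
    refine Multiset.countP_congr rfl fun z' hz' => ?_
    simp only [eq_iff_iff]
    constructor
    · intro h
      by_contra hne
      exact Set.disjoint_left.1 (hOd z hz z' hz' hne) h (hzO z' hz')
    · rintro rfl
      exact hzO z hz
  refine ⟨O, fun z hz => ⟨hOo z, hzO z hz, inter_subset_right.trans interior_subset⟩, hOd, ?_⟩
  have ev1 : ∀ᶠ x in 𝓝 x₁, ∀ z ∈ T, (s x).countP (· ∈ O z) = (s x₁).countP (· ∈ O z) := by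
    rw [Finset.eventually_all]
    intro z hz
    rw [Multiset.mem_toFinset] at hz
    refine hs.eventually_countP (O' := ⋃ z' ∈ T.erase z, O z') (hOo z)
      (isOpen_biUnion fun z' _ => hOo z') ?_ ?_
    · rw [Set.disjoint_iUnion₂_right]
      intro z' hz'
      rw [Finset.mem_erase] at hz'
      exact hOd z hz z' (Multiset.mem_toFinset.1 hz'.2) hz'.1.symm
    · intro z' hz'
      by_cases h : z' = z
      · subst h; exact Or.inl (hzO z' hz)
      · exact Or.inr (mem_iUnion₂.2 ⟨z', Finset.mem_erase.2 ⟨h, Multiset.mem_toFinset.2 hz'⟩,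
          hzO z' hz'⟩)
  filter_upwards [ev1, hν] with x hx hνx
  have hex : ∀ z : E, ∃ y, z ∈ s x₁ → y ∈ s x ∧ y ∈ O z := by
    intro z
    by_cases hz : z ∈ s x₁
    · have h1 := hx z (Multiset.mem_toFinset.2 hz)
      rw [hcount z hz] at h1
      have h2 : 0 < (s x).countP (· ∈ O z) := by rw [h1]; exact Multiset.count_pos.2 hz
      obtain ⟨y, hy, hyO⟩ := Multiset.countP_pos.1 h2
      exact ⟨y, fun _ => ⟨hy, hyO⟩⟩
    · exact ⟨0, fun h => absurd h hz⟩
  choose y hy using hex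
  have hinj : Set.InjOn y (T : Set E) := by
    intro z hz z' hz' heq
    by_contra hne
    have hz1 := Multiset.mem_toFinset.1 hz
    have hz1' := Multiset.mem_toFinset.1 hz'
    exact Set.disjoint_left.1 (hOd z hz1 z' hz1' hne) (hy z hz1).2 (heq ▸ (hy z' hz1').2)
  have himg : T.image y = (s x).toFinset := by
    refine Finset.eq_of_subset_of_card_le ?_ ?_
    · intro w hw
      obtain ⟨z, hz, rfl⟩ := Finset.mem_image.1 hw
      exact Multiset.mem_toFinset.2 (hy z (Multiset.mem_toFinset.1 hz)).1
    · rw [hνx, Finset.card_image_of_injOn hinj]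
  refine ⟨y, fun z hz => ⟨(hy z hz).2, ?_⟩, hinj, himg.symm⟩
  rw [← hcount z hz, ← hx z (Multiset.mem_toFinset.2 hz)]
  refine Multiset.countP_congr rfl fun w hw => ?_
  simp only [eq_iff_iff]
  constructor
  · rintro rfl; exact (hy z hz).2
  · intro hwO
    rw [← Multiset.mem_toFinset, ← himg] at hw
    obtain ⟨z', hz', rfl⟩ := Finset.mem_image.1 hw
    by_contra hne
    have hz1' := Multiset.mem_toFinset.1 hz'
    exact Set.disjoint_left.1 (hOd z hz z' hz1' fun h => hne (by rw [h])) hwO (hy z' hz1').2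

end Generic

section Select

variable {E F : Type*} [NormedAddCommGroup E] [NormedSpace ℂ E]
  [NormedAddCommGroup F] [NormedSpace ℂ F]

open Classical in
theorem HolMultiAt.filter_zeros {s : F → Multiset E} {x₁ : F} (hs : HolMultiAt s x₁)
    (hν : ∀ᶠ x in 𝓝 x₁, (s x).toFinset.card = (s x₁).toFinset.card) {f g : E → ℂ}
    (hf : ∀ z ∈ s x₁, ContinuousAt f z) (hg : ∀ z ∈ s x₁, ContinuousAt g z)
    (hfc : ∀ᶠ x in 𝓝 x₁, {z ∈ (s x).toFinset | f z ≠ 0}.card =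
      {z ∈ (s x₁).toFinset | f z ≠ 0}.card)
    (hgc : ∀ᶠ x in 𝓝 x₁, {z ∈ (s x).toFinset | g z ≠ 0}.card =
      {z ∈ (s x₁).toFinset | g z ≠ 0}.card) :
    HolMultiAt (fun x => {z ∈ (s x).toFinset | f z = 0 ∧ g z ≠ 0}.val) x₁ := by
  intro W hW hWt φ hφ
  set T := (s x₁).toFinset with hT
  have hTm : ∀ {z}, z ∈ T ↔ z ∈ s x₁ := Multiset.mem_toFinset
  have hWt' : ∀ z ∈ T, f z = 0 ∧ g z ≠ 0 → z ∈ W := fun z hz h =>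
    hWt z (Finset.mem_filter.2 ⟨hz, h⟩)
  have hne : ∀ {k : E → ℂ}, (∀ z ∈ s x₁, ContinuousAt k z) → ∀ z ∈ s x₁,
      ∀ᶠ y in 𝓝 z, k z ≠ 0 → k y ≠ 0 := by
    intro k hk z hz
    by_cases h : k z = 0
    · exact Eventually.of_forall fun _ h' => absurd h h'
    · exact ((hk z hz).eventually_ne h).mono fun y hy _ => hy
  obtain ⟨O, hO, hOd, hev⟩ := hs.exists_sections hν
    (N := fun z => {y | ((f z ≠ 0 → f y ≠ 0) ∧ (g z ≠ 0 → g y ≠ 0)) ∧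
      (f z = 0 ∧ g z ≠ 0 → y ∈ W)}) (by
    intro z hz
    refine ((hne hf z hz).and (hne hg z hz)).and ?_
    by_cases h : f z = 0 ∧ g z ≠ 0
    · filter_upwards [hW.mem_nhds (hWt' z (hTm.2 hz) h)] with y hy _ using hy
    · exact Eventually.of_forall fun _ h' => absurd h' h)
  set J := {z ∈ T | f z = 0 ∧ g z ≠ 0} with hJ
  set Φ : E → ℂ := fun y => ∑ z ∈ J, if y ∈ O z then φ y * ((s x₁).count z : ℂ)⁻¹ else 0 with hΦ
  have hΦO : ∀ z ∈ T, ∀ y ∈ O z,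
      Φ y = if z ∈ J then φ y * ((s x₁).count z : ℂ)⁻¹ else 0 := by
    intro z hz y hy
    have hoff : ∀ z' ∈ J, z' ≠ z → (if y ∈ O z' then φ y * ((s x₁).count z' : ℂ)⁻¹ else 0) = 0 := by
      intro z' hz' hne
      refine if_neg fun h => ?_
      exact Set.disjoint_left.1 (hOd z' (hTm.1 (Finset.mem_filter.1 hz').1) z (hTm.1 hz) hne) h hy
    split_ifs with hzJ
    · rw [hΦ]
      simp only
      rw [Finset.sum_eq_single z hoff (fun h => absurd hzJ h), if_pos hy]
    · exact Finset.sum_eq_zero fun z' hz' => hoff z' hz' fun h => hzJ (h ▸ hz')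
  have hΦhol : HolOn Φ (⋃ z ∈ T, O z) := by
    intro y hy
    obtain ⟨z, hz, hyz⟩ := mem_iUnion₂.1 hy
    have hnear : ∀ᶠ y' in 𝓝 y, (if z ∈ J then φ y' * ((s x₁).count z : ℂ)⁻¹ else 0) = Φ y' := by
      filter_upwards [(hO z (hTm.1 hz)).1.mem_nhds hyz] with y' hy'
      exact (hΦO z hz y' hy').symm
    refine HolAt.congr ?_ hnear
    by_cases hzJ : z ∈ J
    · simp only [hzJ, if_true]
      exact (hφ y (((hO z (hTm.1 hz)).2.2 hyz).2 (Finset.mem_filter.1 hzJ).2)).mul (holAt_const _)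
    · simp only [hzJ, if_false]
      exact holAt_const 0
  have hΦs := hs (⋃ z ∈ T, O z)
    (isOpen_biUnion fun z hz => (hO z (hTm.1 hz)).1)
    (fun z hz => mem_iUnion₂.2 ⟨z, hTm.2 hz, (hO z hz).2.1⟩) Φ hΦhol
  have hkey : ∀ᶠ x in 𝓝 x₁,
      (∀ z ∈ {z ∈ (s x).toFinset | f z = 0 ∧ g z ≠ 0}, z ∈ W) ∧
      ((s x).map Φ).sum = ∑ z ∈ (s x).toFinset with f z = 0 ∧ g z ≠ 0, φ z := by
    filter_upwards [hev, hfc, hgc] with x hx hfx hgx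
    obtain ⟨y, hy, hinj, himg⟩ := hx
    have hiff : ∀ k : E → ℂ, (∀ z ∈ T, k z ≠ 0 → k (y z) ≠ 0) →
        {z ∈ (s x).toFinset | k z ≠ 0}.card = {z ∈ T | k z ≠ 0}.card →
        ∀ z ∈ T, (k (y z) ≠ 0 ↔ k z ≠ 0) := by
      intro k hk hc z hz
      refine ⟨fun h => ?_, hk z hz⟩
      have hsub : {z ∈ T | k z ≠ 0} ⊆ {z ∈ T | k (y z) ≠ 0} := by
        intro w hw
        rw [Finset.mem_filter] at hw ⊢
        exact ⟨hw.1, hk w hw.1 hw.2⟩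
      have hcard : {z ∈ T | k (y z) ≠ 0}.card = {z ∈ T | k z ≠ 0}.card := by
        rw [← hc, himg, Finset.filter_image, Finset.card_image_of_injOn]
        exact hinj.mono (Finset.coe_subset.2 (Finset.filter_subset _ _))
      have heq := Finset.eq_of_subset_of_card_le hsub hcard.le
      have : z ∈ {z ∈ T | k (y z) ≠ 0} := Finset.mem_filter.2 ⟨hz, h⟩
      rw [← heq] at this
      exact (Finset.mem_filter.1 this).2
    have hN := fun z (hz : z ∈ T) => (hO z (hTm.1 hz)).2.2 (hy z (hTm.1 hz)).1
    have hfi := hiff f (fun z hz => (hN z hz).1.1) hfx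
    have hgi := hiff g (fun z hz => (hN z hz).1.2) hgx
    have hsel : {z ∈ (s x).toFinset | f z = 0 ∧ g z ≠ 0} = J.image y := by
      rw [himg, Finset.filter_image, hJ]
      congr 1
      refine Finset.filter_congr fun z hz => ?_
      rw [hgi z hz, not_iff_not.1 (hfi z hz)]
    rw [hsel]
    refine ⟨fun w hw => ?_, ?_⟩
    · obtain ⟨z, hz, rfl⟩ := Finset.mem_image.1 hw
      rw [Finset.mem_filter] at hz
      exact (hN z hz.1).2 hz.2
    · rw [Finset.sum_multiset_map_count, himg, Finset.sum_image hinj,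
        Finset.sum_image (hinj.mono (Finset.coe_subset.2 (Finset.filter_subset _ _))),
        Finset.sum_filter]
      refine Finset.sum_congr rfl fun z hz => ?_
      rw [hΦO z hz _ (hy z (hTm.1 hz)).1, (hy z (hTm.1 hz)).2]
      have hc : ((s x₁).count z : ℂ) ≠ 0 :=
        Nat.cast_ne_zero.2 (Multiset.count_pos.2 (hTm.1 hz)).ne'
      by_cases h : f z = 0 ∧ g z ≠ 0
      · rw [if_pos (Finset.mem_filter.2 ⟨hz, h⟩), if_pos h, nsmul_eq_mul]
        field_simp
      · have hzJ : z ∉ J := fun h' => h (Finset.mem_filter.1 h').2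
        rw [if_neg hzJ, if_neg h, smul_zero]
  filter_upwards [hΦs, hkey, hkey.eventually_nhds] with x hx hkx hkx'
  refine ⟨hkx.1, hx.2.congr ?_⟩
  filter_upwards [hkx'] with y hy
  exact hy.2

end Select

section Good

variable {E : Type*} [NormedAddCommGroup E] [NormedSpace ℂ E] [FiniteDimensional ℂ E]

open Classical in
/-- Local structure of a difference of analytic sets over a linear projection with an isolated
fibre point: off a thin set the fibres form a holomorphic multisection with constant
cardinality. -/
theorem AnaAt.exists_good_multisection {F : Type*} [NormedAddCommGroup F] [NormedSpace ℂ F]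
    (π : E →L[ℂ] F) (hπ : Function.Surjective π) {A Y : Set E} {a : E} (hA : AnaAt A a)
    (hY : AnaAt Y a) (hiso : ∀ᶠ z in 𝓝 a, π z = π a → z ∈ A → z = a) {N : Set E}
    (hN : N ∈ 𝓝 a) :
    ∃ (W : Set E) (s : F → Multiset E) (t : F → Finset E) (h : F → ℂ) (n : ℕ),
      IsOpen W ∧ a ∈ W ∧ W ⊆ N ∧ NonzeroGerm h (π a) ∧ ∀ᶠ x in 𝓝 (π a),
        HolMultiAt s x ∧ (∀ z ∈ s x, z ∈ W ∧ π z = x) ∧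
        (∀ z ∈ W, π z = x → z ∈ A → z ∈ s x) ∧
        (∀ z, z ∈ t x ↔ z ∈ W ∧ π z = x ∧ z ∈ A ∧ z ∉ Y) ∧
        (h x ≠ 0 → HolMultiAt (fun x => (t x).val) x ∧ (t x).card = n) := by
  have : FiniteDimensional ℂ F := Module.Finite.of_surjective (π : E →ₗ[ℂ] F) hπ
  obtain ⟨l, hl⟩ := Nat.exists_eq_add_of_le
    (LinearMap.finrank_le_finrank_of_surjective (f := (π : E →ₗ[ℂ] F)) hπ)
  obtain ⟨WA, hWA, haA, 𝓕, h𝓕, hA'⟩ := id hA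
  obtain ⟨WB, hWB, haB, 𝓖, h𝓖, hB'⟩ := hA.inter hY
  obtain ⟨s, W, hW, haW, hWN, hs⟩ := hA.exists_multisection l π hπ hl hiso
    (inter_mem hN (inter_mem (hWA.mem_nhds haA) (hWB.mem_nhds haB)))
  obtain ⟨ε, hε, hsε⟩ := Metric.eventually_nhds_iff_ball.1
    (hs.and hs.self_of_nhds.1.eventually_card)
  set U := ball (π a) ε with hU
  have hUo : IsOpen U := isOpen_ball
  have hsU : ∀ x ∈ U, HolMultiAt s x ∧ (∀ z ∈ s x, z ∈ W) ∧ (s x).card ≤ (s (π a)).card :=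
    fun x hx => ⟨(hsε x hx).1.1, fun z hz => ((hsε x hx).1.2.1 z hz).1, (hsε x hx).2.le⟩
  have hfW : ∀ f ∈ 𝓕, HolOn f W := fun f hf => (h𝓕 f hf).mono fun z hz => (hWN hz).2.1
  have hgW : ∀ f ∈ 𝓖, HolOn f W := fun f hf => (h𝓖 f hf).mono fun z hz => (hWN hz).2.2
  have hUne : U.Nonempty := ⟨_, mem_ball_self hε⟩
  obtain ⟨f, hf, h₁, k₁, hh₁, ⟨x₁, hx₁, hne₁⟩, H₁⟩ := exists_generic_member hUne hW hsU 𝓕 hfW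
  obtain ⟨g, hg, h₂, k₂, hh₂, ⟨x₂, hx₂, hne₂⟩, H₂⟩ := exists_generic_member hUne hW hsU 𝓖 hgW
  obtain ⟨e, he, h₃, k₃, hh₃, ⟨x₃, hx₃, hne₃⟩, H₃⟩ := exists_generic_member hUne hW hsU
    (Submodule.span ℂ {fun _ => (1 : ℂ)}) (by
      intro e he
      obtain ⟨c, rfl⟩ := Submodule.mem_span_singleton.1 he
      exact fun x _ => (holAt_const 1).const_mul c)
  have hnz : ∀ {h : F → ℂ} {x : F}, HolOn h U → x ∈ U → h x ≠ 0 → NonzeroGerm h (π a) :=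
    fun hh hx hne => hh.nonzeroGerm hUo (convex_ball _ _) hx hne (mem_ball_self hε)
  refine ⟨W, s, fun x => {z ∈ (s x).toFinset | z ∈ A ∧ z ∉ Y}, fun x => h₁ x * h₂ x * h₃ x,
    k₂ - k₁, hW, haW, fun z hz => (hWN hz).1,
    ((hnz hh₁ hx₁ hne₁).mul (hnz hh₂ hx₂ hne₂)).mul (hnz hh₃ hx₃ hne₃), ?_⟩
  have hzA : ∀ x ∈ U, h₁ x ≠ 0 → ∀ z ∈ s x, (f z = 0 ↔ z ∈ A) := fun x hx hne z hz => by
    rw [hA' z (hWN ((hsU x hx).2.1 z hz)).2.1]; exact (H₁ x hx hne).2 z hz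
  have hzB : ∀ x ∈ U, h₂ x ≠ 0 → ∀ z ∈ s x, (g z = 0 ↔ z ∈ A ∩ Y) := fun x hx hne z hz => by
    rw [hB' z (hWN ((hsU x hx).2.1 z hz)).2.2]; exact (H₂ x hx hne).2 z hz
  have hν : ∀ x ∈ U, h₃ x ≠ 0 → (s x).toFinset.card = k₃ := by
    intro x hx hne
    rw [← (H₃ x hx hne).1, Finset.filter_true_of_mem]
    intro z hz h0
    have := ((H₃ x hx hne).2 z (Multiset.mem_toFinset.1 hz)).1 h0 _
      (Submodule.mem_span_singleton_self _)
    exact one_ne_zero this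
  have hsel : ∀ x ∈ U, h₁ x ≠ 0 → h₂ x ≠ 0 → {z ∈ (s x).toFinset | f z = 0 ∧ g z ≠ 0} =
      {z ∈ (s x).toFinset | z ∈ A ∧ z ∉ Y} := by
    intro x hx hn1 hn2
    refine Finset.filter_congr fun z hz => ?_
    rw [Multiset.mem_toFinset] at hz
    rw [Ne, hzA x hx hn1 z hz, hzB x hx hn2 z hz, Set.mem_inter_iff]
    tauto
  filter_upwards [hUo.mem_nhds (mem_ball_self hε)] with x hx
  obtain ⟨⟨hx1, hx2, hx3⟩, -⟩ := hsε x hx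
  refine ⟨hx1, hx2, hx3, fun z => ?_, fun hhx => ?_⟩
  · rw [Finset.mem_filter, Multiset.mem_toFinset]
    constructor
    · rintro ⟨hz, hzA, hzY⟩
      exact ⟨(hx2 z hz).1, (hx2 z hz).2, hzA, hzY⟩
    · rintro ⟨hzW, hzx, hzA, hzY⟩
      exact ⟨hx3 z hzW hzx hzA, hzA, hzY⟩
  · have hn12 := left_ne_zero_of_mul hhx
    have hn1 := left_ne_zero_of_mul hn12
    have hn2 := right_ne_zero_of_mul hn12
    have hn3 := right_ne_zero_of_mul hhx
    have e1 : ∀ᶠ y in 𝓝 x, (h₁ y ≠ 0 ∧ h₂ y ≠ 0 ∧ h₃ y ≠ 0) ∧ y ∈ U :=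
      (((hh₁ x hx).1.eventually_ne hn1).and (((hh₂ x hx).1.eventually_ne hn2).and
        ((hh₃ x hx).1.eventually_ne hn3))).and (hUo.mem_nhds hx)
    refine ⟨HolMultiAt.congr (s := fun x => {z ∈ (s x).toFinset | f z = 0 ∧ g z ≠ 0}.val)
      (hx1.filter_zeros ?_ ?_ ?_ ?_ ?_) ?_, ?_⟩
    · filter_upwards [e1] with y hy
      rw [hν y hy.2 hy.1.2.2, hν x hx hn3]
    · exact fun z hz => (hfW f hf z (hx2 z hz).1).1
    · exact fun z hz => (hgW g hg z (hx2 z hz).1).1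
    · filter_upwards [e1] with y hy
      rw [(H₁ y hy.2 hy.1.1).1, (H₁ x hx hn1).1]
    · filter_upwards [e1] with y hy
      rw [(H₂ y hy.2 hy.1.2.1).1, (H₂ x hx hn2).1]
    · filter_upwards [e1] with y hy
      rw [hsel y hy.2 hy.1.1 hy.1.2.1]
    · rw [← hsel x hx hn1 hn2, ← (H₂ x hx hn2).1, ← (H₁ x hx hn1).1, ← Finset.card_sdiff_of_subset]
      · congr 1
        ext z
        simp only [Finset.mem_filter, Finset.mem_sdiff]
        tauto
      · intro z hz
        rw [Finset.mem_filter] at hz ⊢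
        refine ⟨hz.1, fun h0 => hz.2 ?_⟩
        have hzs := Multiset.mem_toFinset.1 hz.1
        exact (hzA x hx hn1 z hzs).2 ((hzB x hx hn2 z hzs).1 h0).1

end Good

section Extension

theorem Multiset.norm_esymm_le {m : Multiset ℂ} {B : ℝ} (hB : ∀ a ∈ m, ‖a‖ ≤ B) (k : ℕ) :
    ‖m.esymm k‖ ≤ m.card.choose k * B ^ k := by
  have hsum : ∀ p : Multiset ℂ, ‖p.sum‖ ≤ (p.map (‖·‖)).sum := by
    intro p
    induction p using Multiset.induction_on with
    | empty => simp
    | cons a p ih => simpa using (norm_add_le _ _).trans (by gcongr)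
  have hprod : ∀ p : Multiset ℂ, (∀ a ∈ p, ‖a‖ ≤ B) → ‖p.prod‖ ≤ B ^ p.card := by
    intro p
    induction p using Multiset.induction_on with
    | empty => simp
    | cons a p ih =>
      intro h
      have h1 := h a (Multiset.mem_cons_self a p)
      have h2 := ih fun b hb => h b (Multiset.mem_cons_of_mem hb)
      rw [Multiset.prod_cons, Multiset.card_cons, pow_succ', norm_mul]
      exact mul_le_mul h1 h2 (norm_nonneg _) ((norm_nonneg _).trans h1)
  rw [Multiset.esymm]
  refine (hsum _).trans ?_
  refine (Multiset.sum_le_card_nsmul _ (B ^ k) ?_).trans ?_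
  · intro x hx
    simp only [Multiset.mem_map] at hx
    obtain ⟨_, ⟨p, hp, rfl⟩, rfl⟩ := hx
    rw [Multiset.mem_powersetCard] at hp
    rw [← hp.2]
    exact hprod p fun a ha => hB a (Multiset.mem_of_le hp.1 ha)
  · simp

theorem Multiset.prod_sub_eq_sum_esymm {X : Type*} (m : Multiset X) (L : X → ℂ) (T : ℂ) :
    (m.map fun z => T - L z).prod =
      ∑ j ∈ Finset.range (m.card + 1), (m.map fun z => -L z).esymm j * T ^ (m.card - j) := by
  have := Multiset.prod_add_eq_sum_esymm (m.map fun z => -L z) T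
  rw [Multiset.map_map, Multiset.card_map] at this
  rw [← this]
  simp [sub_eq_add_neg]

variable {E F : Type*} [NormedAddCommGroup E] [NormedSpace ℂ E]
  [NormedAddCommGroup F] [NormedSpace ℂ F]

/-- The coefficients of the characteristic polynomial of a multisection extend holomorphically
across a thin set near which the multisection is bounded. -/
theorem ThinOn.exists_extension_esymm {U S : Set F} (hU : IsOpen U) (hS : ThinOn S U)
    {t : F → Multiset E} {n : ℕ} (ht : ∀ x ∈ U, x ∉ S → HolMultiAt t x ∧ (t x).card = n)
    (hb : ∀ x ∈ U, ∃ B : ℝ, ∀ᶠ y in 𝓝 x, y ∉ S → ∀ z ∈ t y, ‖z‖ ≤ B) (L : E →L[ℂ] ℂ) :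
    ∃ e : ℕ → F → ℂ, (∀ j, HolOn (e j) U) ∧
      ∀ x ∈ U, x ∉ S → ∀ j, e j x = ((t x).map fun z => -L z).esymm j := by
  have key : ∀ j : ℕ, ∃ G : F → ℂ, HolOn G U ∧
      ∀ x ∈ U, x ∉ S → G x = ((t x).map fun z => -L z).esymm j := by
    intro j
    refine hS.exists_extension hU (fun y hy hyS => ?_) fun x hx => ?_
    · exact (ht y hy hyS).1.esymm isOpen_univ (fun _ _ => mem_univ _)
        (fun z _ => (holAt_continuousLinearMap L).neg) j
    · obtain ⟨B, hB⟩ := hb x hx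
      refine ⟨n.choose j * (‖L‖ * B) ^ j, ?_⟩
      filter_upwards [hB, hU.mem_nhds hx] with y hy hyU hyS
      have h1 := Multiset.norm_esymm_le (m := (t y).map fun z => -L z) (B := ‖L‖ * B) (by
        intro a ha
        obtain ⟨z, hz, rfl⟩ := Multiset.mem_map.1 ha
        rw [norm_neg]
        exact (L.le_opNorm z).trans (by gcongr; exact hy hyS z hz)) j
      rwa [Multiset.card_map, (ht y hyU hyS).2] at h1
  choose e he1 he2 using key
  exact ⟨e, he1, fun x hx hxS j => he2 j x hx hxS⟩

theorem HolMultiAt.exists_bound {s : F → Multiset E} {x : F} (hs : HolMultiAt s x) :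
    ∃ B : ℝ, ∀ᶠ y in 𝓝 x, ∀ z ∈ s y, ‖z‖ ≤ B := by
  classical
  obtain ⟨B, hB⟩ := ((s x).toFinset.image norm).bddAbove
  refine ⟨B + 1, (hs.eventually_mem (W := ball 0 (B + 1)) isOpen_ball ?_).mono ?_⟩
  · intro z hz
    rw [mem_ball_zero_iff]
    have := hB (Finset.mem_coe.2 (Finset.mem_image_of_mem norm (Multiset.mem_toFinset.2 hz)))
    linarith
  · intro y hy z hz
    exact (mem_ball_zero_iff.1 (hy z hz)).le

theorem exists_clm_ker_eq_span {e : ℕ} {v : Fin (e + 1) → ℂ} (hv : v ≠ 0) :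
    ∃ (κ : (Fin (e + 1) → ℂ) →L[ℂ] (Fin e → ℂ)) (ψ : (Fin (e + 1) → ℂ) →L[ℂ] ℂ),
      Function.Surjective κ ∧ κ v = 0 ∧ ∀ x, κ x = 0 → x = ψ x • v := by
  obtain ⟨i, hi⟩ := Function.ne_iff.1 hv
  replace hi : v i ≠ 0 := hi
  let ψ : (Fin (e + 1) → ℂ) →L[ℂ] ℂ := (v i)⁻¹ • ContinuousLinearMap.proj i
  have hψ : ∀ x, ψ x = (v i)⁻¹ * x i := fun x => rfl
  let κ : (Fin (e + 1) → ℂ) →L[ℂ] (Fin e → ℂ) := ContinuousLinearMap.pi fun j =>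
    ContinuousLinearMap.proj (i.succAbove j) - v (i.succAbove j) • ψ
  have hκ : ∀ x j, κ x j = x (i.succAbove j) - v (i.succAbove j) * ψ x := fun x j => rfl
  refine ⟨κ, ψ, fun y => ⟨i.insertNth 0 y, ?_⟩, ?_, fun x hx => ?_⟩
  · ext j
    simp [hκ, hψ]
  · ext j
    simp [hκ, hψ, hi]
  · ext j
    rw [Pi.smul_apply, smul_eq_mul]
    rcases Fin.eq_self_or_eq_succAbove i j with rfl | ⟨j, rfl⟩
    · rw [hψ]; field_simp
    · have := congrFun hx j
      rw [hκ] at this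
      simp only [Pi.zero_apply] at this
      linear_combination this

end Extension

section ClosureDiff

variable {E : Type*} [NormedAddCommGroup E] [NormedSpace ℂ E] [FiniteDimensional ℂ E]

/-- Near a point with isolated fibre, the closure of a difference of analytic sets is an analytic
set together with the part of the closure lying over the zeros of a nonzero function. -/
theorem AnaAt.exists_closure_diff_eq {F : Type*} [NormedAddCommGroup F] [NormedSpace ℂ F]
    (π : E →L[ℂ] F) (hπ : Function.Surjective π) {A Y : Set E} {a : E} (hA : AnaAt A a)
    (hY : AnaAt Y a) (hiso : ∀ᶠ z in 𝓝 a, π z = π a → z ∈ A → z = a) :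
    ∃ (h : F → ℂ) (Q : Set E), NonzeroGerm h (π a) ∧ AnaAt Q a ∧ ∀ᶠ w in 𝓝 a,
      (w ∈ Q ∪ closure ((A ∩ π ⁻¹' {x | h x = 0}) \ Y) ↔ w ∈ closure (A \ Y)) := by
  classical
  obtain ⟨W, s, t, h, n, hW, haW, -, hh, hev⟩ :=
    hA.exists_good_multisection π hπ hY hiso univ_mem
  obtain ⟨ε, hε, hU⟩ := Metric.eventually_nhds_iff_ball.1 (hev.and hh.eventually)
  set U := ball (π a) ε with hUdef
  have hUo : IsOpen U := isOpen_ball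
  have hhU : HolOn h U := fun x hx => (hU x hx).2.1.self_of_nhds
  set S : Set F := {x | h x = 0} with hSdef
  have hS : ThinOn S U := fun x hx => ⟨h, (hU x hx).2, Eventually.of_forall fun _ h1 => h1⟩
  have hts : ∀ x ∈ U, ∀ z ∈ t x, z ∈ s x := fun x hx z hz => by
    obtain ⟨h1, h2, h3, -⟩ := ((hU x hx).1.2.2.2.1 z).1 hz
    exact (hU x hx).1.2.2.1 z h1 h2 h3
  have hext := fun L : E →L[ℂ] ℂ => hS.exists_extension_esymm hUo
    (t := fun x => (t x).val) (n := n) (fun x hx hxS => (hU x hx).1.2.2.2.2 hxS) (fun x hx => by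
      obtain ⟨B, hB⟩ := (hU x hx).1.1.exists_bound
      refine ⟨B, ?_⟩
      filter_upwards [hB, hUo.mem_nhds hx] with y hy hyU _ z hz
      exact hy z (hts y hyU z hz)) L
  choose e he1 he2 using hext
  set R : (E →L[ℂ] ℂ) → F → ℂ → ℂ := fun L x T =>
    ∑ j ∈ Finset.range (n + 1), e L j x * T ^ (n - j) with hR
  have hRprod : ∀ L, ∀ x ∈ U, x ∉ S → ∀ T, R L x T = ((t x).val.map fun z => T - L z).prod := by
    intro L x hx hxS T
    rw [Multiset.prod_sub_eq_sum_esymm,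
      show (t x).val.card = n from ((hU x hx).1.2.2.2.2 hxS).2]
    exact Finset.sum_congr rfl fun j _ => by rw [he2 L x hx hxS j]
  have hRhol : ∀ L, HolOn (fun w => R L (π w) (L w)) (W ∩ π ⁻¹' U) := by
    intro L w hw
    exact HolAt.sum _ fun j _ => ((he1 L j _ hw.2).comp_linear π).mul
      ((holAt_continuousLinearMap L).pow _)
  have hRx : ∀ L T, ∀ x ∈ U, ContinuousAt (fun x => R L x T) x := fun L T x hx =>
    (HolAt.sum _ fun j _ => (he1 L j x hx).mul (holAt_const _)).1
  have hV : IsOpen (W ∩ π ⁻¹' U) := hW.inter (hUo.preimage π.continuous)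
  have haV : a ∈ W ∩ π ⁻¹' U := ⟨haW, mem_ball_self hε⟩
  refine ⟨h, {w | ∀ L, R L (π w) (L w) = 0}, hh, AnaAt.of_family hV haV
    {f | ∃ L, f = fun w => R L (π w) (L w)} ?_ ?_, ?_⟩
  · rintro f ⟨L, rfl⟩
    exact hRhol L
  · intro z _
    constructor
    · rintro hz f ⟨L, rfl⟩
      exact hz L
    · exact fun hz L => hz _ ⟨L, rfl⟩
  filter_upwards [hV.mem_nhds haV] with w hw
  have hx := hw.2
  constructor
  · rintro (hwQ | hwQ)
    · by_contra hwc
      obtain ⟨L, hL⟩ := exists_clm_forall_ne_zero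
        (((s (π w)).toFinset.erase w).image fun z => z - w) (by
          intro y hy
          obtain ⟨z, hz, rfl⟩ := Finset.mem_image.1 hy
          exact sub_ne_zero.2 (Finset.mem_erase.1 hz).1)
      obtain ⟨c, hc, hcL⟩ : ∃ c > 0, ∀ z ∈ (s (π w)).toFinset.erase w, c < ‖L z - L w‖ := by
        have h1 : ∀ z ∈ (s (π w)).toFinset.erase w, ∀ᶠ c in 𝓝[>] (0 : ℝ), c < ‖L z - L w‖ := by
          intro z hz
          refine nhdsWithin_le_nhds (Iio_mem_nhds (norm_pos_iff.2 ?_))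
          have := hL (z - w) (Finset.mem_image.2 ⟨z, hz, rfl⟩)
          rwa [map_sub] at this
        obtain ⟨c, h2, h3⟩ := (((Finset.eventually_all _).2 h1).and self_mem_nhdsWithin).exists
        exact ⟨c, h3, h2⟩
      have hopen : IsOpen ({z | c < ‖L z - L w‖} ∪ (closure (A \ Y))ᶜ) :=
        (isOpen_lt continuous_const (by fun_prop)).union isClosed_closure.isOpen_compl
      have hsx := (hU _ hx).1.1.eventually_mem hopen (by
        intro z hz
        by_cases hzw : z = w
        · subst hzw; exact Or.inr hwc
        · exact Or.inl (hcL z (Finset.mem_erase.2 ⟨hzw, Multiset.mem_toFinset.2 hz⟩)))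
      have hbound : ∃ᶠ x in 𝓝 (π w), c ^ n ≤ ‖R L x (L w)‖ := by
        refine ((hS.frequently hx).and_eventually (hsx.and (hUo.mem_nhds hx))).mono ?_
        rintro x ⟨hxS, hxs, hxU⟩
        rw [hRprod L x hxU hxS, ← ((hU x hxU).1.2.2.2.2 hxS).2]
        have hle : ∀ z ∈ t x, c ≤ ‖L w - L z‖ := by
          intro z hz
          obtain ⟨-, -, hzA, hzY⟩ := ((hU x hxU).1.2.2.2.1 z).1 hz
          rcases hxs z (hts x hxU z hz) with h1 | h1
          · rw [norm_sub_rev]; exact le_of_lt h1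
          · exact absurd (subset_closure (show z ∈ A \ Y from ⟨hzA, hzY⟩)) h1
        change c ^ (t x).card ≤ ‖∏ z ∈ t x, (L w - L z)‖
        rw [norm_prod, ← Finset.prod_const]
        exact Finset.prod_le_prod (fun _ _ => hc.le) hle
      have hlim : ∀ᶠ x in 𝓝 (π w), ‖R L x (L w)‖ < c ^ n := by
        have := (hRx L (L w) (π w) hx).norm
        refine this.eventually_lt continuousAt_const ?_
        rw [hwQ L, norm_zero]
        exact pow_pos hc n
      obtain ⟨x, h1, h2⟩ := (hbound.and_eventually hlim).exists
      exact absurd h1 (not_le.2 h2)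
    · exact closure_mono (sdiff_subset_sdiff_left inter_subset_left) hwQ
  · intro hwc
    by_cases hw2 : w ∈ closure ((A ∩ π ⁻¹' {x | h x = 0}) \ Y)
    · exact Or.inr hw2
    · left
      intro L
      have hw3 : w ∈ closure {z | z ∈ A \ Y ∧ h (π z) ≠ 0} := by
        have hsplit : A \ Y = ((A ∩ π ⁻¹' {x | h x = 0}) \ Y) ∪ {z | z ∈ A \ Y ∧ h (π z) ≠ 0} := by
          ext z
          by_cases h0 : h (π z) = 0
          · constructor
            · rintro ⟨h1, h2⟩; exact Or.inl ⟨⟨h1, h0⟩, h2⟩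
            · rintro (⟨⟨h1, -⟩, h2⟩ | ⟨h1, -⟩)
              · exact ⟨h1, h2⟩
              · exact h1
          · constructor
            · intro h1; exact Or.inr ⟨h1, h0⟩
            · rintro (⟨⟨h1, -⟩, h2⟩ | ⟨h1, -⟩)
              · exact ⟨h1, h2⟩
              · exact h1
        rw [hsplit, closure_union] at hwc
        exact hwc.resolve_left hw2
      by_contra hne
      have h1 : ∀ᶠ z in 𝓝 w, R L (π z) (L z) ≠ 0 ∧ z ∈ W ∩ π ⁻¹' U :=
        ((hRhol L w hw).1.eventually_ne hne).and (hV.mem_nhds hw)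
      obtain ⟨z, ⟨hz1, hzne⟩, hz2, hz3⟩ :=
        ((mem_closure_iff_frequently.1 hw3).and_eventually h1).exists
      apply hz2
      rw [hRprod L _ hz3.2 hzne]
      refine Multiset.prod_eq_zero (Multiset.mem_map.2 ⟨z, ?_, sub_self _⟩)
      exact ((hU _ hz3.2).1.2.2.2.1 z).2 ⟨hz3.1, rfl, hz1.1, hz1.2⟩

theorem AnaAt.closure_diff_of_isolated (e : ℕ) (Y : Set E) (a : E) (hY : AnaAt Y a) :
    ∀ (π : E →L[ℂ] (Fin e → ℂ)), Function.Surjective π → ∀ A : Set E, AnaAt A a →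
    (∀ᶠ z in 𝓝 a, π z = π a → z ∈ A → z = a) → AnaAt (closure (A \ Y)) a := by
  induction e with
  | zero =>
    intro π hπ A hA hiso
    obtain ⟨h, Q, hh, hQ, hev⟩ := hA.exists_closure_diff_eq π hπ hY hiso
    obtain ⟨x, hx⟩ := hh.2.exists
    have h0 : ∀ z, h z ≠ 0 := fun z => by rwa [Subsingleton.elim z x]
    refine hQ.congr (hev.mono fun w hw => ?_)
    rw [← hw]
    have : (A ∩ π ⁻¹' {x | h x = 0}) \ Y = ∅ := by
      ext z
      simp only [Set.mem_sdiff, Set.mem_inter_iff, Set.mem_empty_iff_false, iff_false]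
      exact fun h1 => h0 _ h1.1.2
    rw [this, closure_empty, Set.union_empty]
  | succ e ih =>
    intro π hπ A hA hiso
    obtain ⟨h, Q, hh, hQ, hev⟩ := hA.exists_closure_diff_eq π hπ hY hiso
    refine AnaAt.congr (hQ.union ?_) hev
    obtain ⟨ε, hε, hhol, -⟩ := hh.exists_ball
    have hhπ : HolOn (fun z => h (π z)) (π ⁻¹' ball (π a) ε) := fun z hz =>
      (hhol _ hz).comp_linear π
    have hVo : IsOpen (π ⁻¹' ball (π a) ε) := isOpen_ball.preimage π.continuous
    by_cases h0 : h (π a) = 0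
    · obtain ⟨v, hv⟩ := hh.exists_line
      have hv0 : v ≠ 0 := by
        rintro rfl
        obtain ⟨c, hc⟩ := hv.exists
        simp [h0] at hc
      obtain ⟨κ, ψ, hκ, -, hκψ⟩ := exists_clm_ker_eq_span hv0
      refine ih (κ.comp π) (hκ.comp hπ) _ (hA.inter ?_) ?_
      · refine AnaAt.of_family hVo (mem_ball_self hε) {fun z => h (π z)} ?_ ?_
        · rintro f rfl; exact hhπ
        · intro z _
          constructor
          · rintro hz f rfl; exact hz
          · exact fun hz => hz _ rfl
      · rw [eventually_nhdsWithin_iff] at hv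
        have hc : Tendsto (fun z => ψ (π z - π a)) (𝓝 a) (𝓝 0) := by
          have : Continuous fun z => ψ (π z - π a) := by fun_prop
          simpa using this.tendsto a
        filter_upwards [hc.eventually hv, hiso] with z hz1 hz2 hz3 hz4
        have h1 : κ (π z - π a) = 0 := by
          rw [map_sub, sub_eq_zero]; exact hz3
        have h2 := hκψ _ h1
        by_cases h3 : ψ (π z - π a) = 0
        · rw [h3, zero_smul, sub_eq_zero] at h2
          exact hz2 h2 hz4.1
        · exfalso
          apply hz1 h3
          rw [← h2]
          simpa using hz4.2
    · refine anaAt_empty.congr ?_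
      have h1 : ∀ᶠ z in 𝓝 a, h (π z) ≠ 0 := (hhπ a (mem_ball_self hε)).1.eventually_ne h0
      filter_upwards [h1.eventually_nhds] with z hz
      simp only [Set.mem_empty_iff_false, false_iff]
      intro hzc
      obtain ⟨y, hy1, hy2⟩ := ((mem_closure_iff_frequently.1 hzc).and_eventually hz).exists
      exact hy2 hy1.1.2

theorem AnaAt.closure_diff {A Y : Set E} {a : E} (hA : AnaAt A a) (hY : AnaAt Y a) :
    AnaAt (closure (A \ Y)) a := by
  let φ : E ≃L[ℂ] (Fin (Module.finrank ℂ E) → ℂ) :=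
    ContinuousLinearEquiv.ofFinrankEq (by simp)
  refine AnaAt.closure_diff_of_isolated _ Y a hY
    (φ : E →L[ℂ] (Fin (Module.finrank ℂ E) → ℂ)) φ.surjective A hA
    (Eventually.of_forall fun z hz _ => φ.injective ?_)
  exact hz

end ClosureDiff

section CompactAnalytic

/-- Constant linear coordinates cut out analytic sets. -/
theorem anaAt_eq_const {E : Type*} [NormedAddCommGroup E] [NormedSpace ℂ E] (L : E →L[ℂ] ℂ) (c : ℂ)
    (a : E) : AnaAt {z | L z = c} a := by
  refine AnaAt.of_family isOpen_univ (mem_univ _) {fun z => L z - c} ?_ ?_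
  · rintro f rfl z -
    exact (holAt_continuousLinearMap L).sub (holAt_const c)
  · intro z _
    constructor
    · rintro hz f rfl
      exact sub_eq_zero.2 hz
    · exact fun hz => sub_eq_zero.1 (hz _ rfl)

variable {E : Type*} [NormedAddCommGroup E] [NormedSpace ℂ E] [FiniteDimensional ℂ E]
  {K : Set E} {a : E}

theorem NonzeroGerm.eventually_ne_zero {h : ℂ → ℂ} {x : ℂ} (hh : NonzeroGerm h x) :
    ∀ᶠ y in 𝓝[≠] x, h y ≠ 0 := by
  have h1 : AnalyticAt ℂ h x :=
    Complex.analyticAt_iff_eventually_differentiableAt.2 (hh.1.mono fun y hy => hy.differentiableAt)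
  refine h1.eventually_eq_zero_or_eventually_ne_zero.resolve_left fun h2 => ?_
  obtain ⟨y, hy1, hy2⟩ := (hh.2.and_eventually h2).exists
  exact hy1 hy2

/-- An analytic set which is isolated at `a` in the fibre of a linear form `L` is isolated at `a`
or covers a neighbourhood of `L a`. -/
theorem AnaAt.isolated_or_image_mem_nhds (L : E →L[ℂ] ℂ) (hL : Function.Surjective L)
    (hK : AnaAt K a) (ha : a ∈ K) (hiso : ∀ᶠ z in 𝓝 a, L z = L a → z ∈ K → z = a) :
    (∀ᶠ z in 𝓝 a, z ∈ K → z = a) ∨ L '' K ∈ 𝓝 (L a) := by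
  obtain ⟨W, s, t, h, n, hW, haW, -, hh, hev⟩ :=
    hK.exists_good_multisection L hL anaAt_empty hiso univ_mem
  have hh' := eventually_nhdsWithin_iff.1 hh.eventually_ne_zero
  rcases Nat.eq_zero_or_pos n with rfl | hn
  · left
    have hcont := L.continuous.tendsto a
    filter_upwards [hiso, hcont.eventually hev, hcont.eventually hh', hW.mem_nhds haW]
      with z hz1 hz2 hz3 hzW hzK
    refine hz1 ?_ hzK
    by_contra hne
    have h1 := (hz2.2.2.2.2 (hz3 hne)).2
    have h2 := (hz2.2.2.2.1 z).2 ⟨hzW, rfl, hzK, by simp⟩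
    rw [Finset.card_eq_zero] at h1
    simp [h1] at h2
  · right
    filter_upwards [hev, hh'] with y hy1 hy2
    by_cases hya : y = L a
    · exact ⟨a, ha, hya.symm⟩
    · have h1 := (hy1.2.2.2.2 (hy2 hya)).2
      obtain ⟨z, hz⟩ := Finset.card_pos.1 (h1 ▸ hn)
      obtain ⟨-, hz1, hz2, -⟩ := (hy1.2.2.2.1 z).1 hz
      exact ⟨z, hz2, hz1⟩

theorem IsCompact.finite_of_finite_slices (hKc : IsCompact K) (hK : ∀ a ∈ K, AnaAt K a)
    (L : E →L[ℂ] ℂ) (hfin : ∀ c, (K ∩ {z | L z = c}).Finite) : K.Finite := by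
  by_cases hL0 : L = 0
  · refine (hfin 0).subset fun z hz => ⟨hz, ?_⟩
    simp [hL0]
  have hL : Function.Surjective L :=
    LinearMap.surjective_of_ne_zero fun h => hL0 (ContinuousLinearMap.coe_injective h)
  have hiso : ∀ a ∈ K, ∀ᶠ z in 𝓝 a, L z = L a → z ∈ K → z = a := by
    intro a _
    have h1 : ((K ∩ {z | L z = L a}) \ {a})ᶜ ∈ 𝓝 a :=
      ((hfin (L a)).sdiff.isClosed.isOpen_compl).mem_nhds (by simp)
    filter_upwards [h1] with z hz hz1 hz2
    by_contra hne
    exact hz ⟨⟨hz2, hz1⟩, hne⟩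
  have hdich : ∀ a ∈ K, (∀ᶠ z in 𝓝 a, z ∈ K → z = a) ∨ L '' K ∈ 𝓝 (L a) := fun a ha =>
    AnaAt.isolated_or_image_mem_nhds L hL (hK a ha) ha (hiso a ha)
  have hLK : IsCompact (L '' K) := hKc.image L.continuous
  have hclopen : IsClopen (interior (L '' K)) := by
    refine ⟨isClosed_of_closure_subset fun x hx => ?_, isOpen_interior⟩
    by_contra hxi
    have h1 : ∀ᶠ y in 𝓝 x, ∀ z ∈ K, z ∈ K → L z = y → y = x := by
      refine hKc.eventually_forall_of_forall_eventually fun a ha => ?_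
      by_cases hax : L a = x
      · have h2 := (hdich a ha).resolve_right fun h => hxi (by
          rw [mem_interior_iff_mem_nhds, ← hax]; exact h)
        rw [nhds_prod_eq]
        refine (h2.prod_inr (𝓝 x)).mono ?_
        intro p hz hzK h
        rw [← h, hz hzK, hax]
      · have h2 : ∀ᶠ p : ℂ × E in 𝓝 (x, a), L p.2 ≠ p.1 :=
          (isOpen_ne_fun (by fun_prop) continuous_fst).mem_nhds hax
        exact h2.mono fun p hp _ h => absurd h hp
    obtain ⟨y, ⟨hy1, hy2⟩⟩ := ((mem_closure_iff_frequently.1 hx).and_eventually h1).exists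
    obtain ⟨z, hz, rfl⟩ := interior_subset hy1
    exact hxi (hy2 z hz hz rfl ▸ hy1)
  have hempty : interior (L '' K) = ∅ := by
    refine (isClopen_iff.1 hclopen).resolve_right fun h => ?_
    have : IsCompact (univ : Set ℂ) := by
      rwa [← univ_subset_iff.1 (h ▸ interior_subset : univ ⊆ L '' K)] 
    exact noncompact_univ ℂ this
  by_contra hinf
  obtain ⟨a, ha, hacc⟩ := Set.Infinite.exists_accPt_of_subset_isCompact hinf hKc Subset.rfl
  have h1 := (hdich a ha).resolve_right fun h => by
    have := mem_interior_iff_mem_nhds.2 h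
    simp [hempty] at this
  obtain ⟨z, ⟨hz1, hz2⟩, hz3⟩ := ((accPt_iff_frequently.1 hacc).and_eventually h1).exists
  exact hz1 (hz3 hz2)

/-- A compact analytic subset of a finite-dimensional space is finite. -/
theorem IsCompact.finite_of_anaAt (hKc : IsCompact K) (hK : ∀ a ∈ K, AnaAt K a) : K.Finite := by
  have key : ∀ (d : ℕ) (π : E →L[ℂ] (Fin d → ℂ)) (K : Set E), IsCompact K →
      (∀ a ∈ K, AnaAt K a) → InjOn π K → K.Finite := by
    intro d
    induction d with
    | zero =>
      intro π K _ _ hinj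
      exact Set.Subsingleton.finite fun x hx y hy => hinj hx hy (Subsingleton.elim _ _)
    | succ d ih =>
      intro π K hKc hK hinj
      refine hKc.finite_of_finite_slices hK ((ContinuousLinearMap.proj 0).comp π) fun c => ?_
      refine ih (ContinuousLinearMap.pi fun i => (ContinuousLinearMap.proj i.succ).comp π) _
        (hKc.inter_right (isClosed_eq (by fun_prop) continuous_const))
        (fun a ha => (hK a ha.1).inter (anaAt_eq_const _ c a)) ?_
      rintro x ⟨hx, hxc⟩ y ⟨hy, hyc⟩ hxy
      refine hinj hx hy (funext fun i => ?_)
      refine Fin.cases ?_ (fun j => ?_) i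
      · exact hxc.trans hyc.symm
      · exact congrFun hxy j
  let φ : E ≃L[ℂ] (Fin (Module.finrank ℂ E) → ℂ) :=
    ContinuousLinearEquiv.ofFinrankEq (by simp)
  exact key _ (φ : E →L[ℂ] (Fin (Module.finrank ℂ E) → ℂ)) K hKc hK φ.injective.injOn

end CompactAnalytic

section Growth

theorem exists_polynomial_of_growth (j : ℕ) : ∀ {g : ℂ → ℂ} {B : ℝ}, Differentiable ℂ g →
    (∀ s, ‖g s‖ ≤ B * (1 + ‖s‖) ^ j) →
    ∃ P : Polynomial ℂ, P.natDegree ≤ j ∧ ∀ s, g s = P.eval s := by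
  induction j with
  | zero =>
    intro g B hg hB
    have hb : Bornology.IsBounded (range g) := by
      refine isBounded_iff_forall_norm_le.2 ⟨B, ?_⟩
      rintro _ ⟨s, rfl⟩
      simpa using hB s
    exact ⟨Polynomial.C (g 0), by simp, fun s => by
      simpa using hg.apply_eq_apply_of_bounded hb s 0⟩
  | succ j ih =>
    intro g B hg hB
    have hq : Differentiable ℂ (dslope g 0) := by
      rw [← differentiableOn_univ] at hg ⊢
      exact (Complex.differentiableOn_dslope univ_mem).2 hg
    obtain ⟨M, hM⟩ := (isCompact_closedBall (0 : ℂ) 1).exists_bound_of_continuousOn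
      hq.continuous.continuousOn
    have hB0 : ‖g 0‖ ≤ B := by simpa using hB 0
    have hBnn : 0 ≤ B := (norm_nonneg _).trans hB0
    have hM0 : 0 ≤ M := (norm_nonneg _).trans (hM 0 (by simp))
    have hmul : ∀ s, s * dslope g 0 s = g s - g 0 := fun s => by
      simpa using sub_smul_dslope g 0 s
    obtain ⟨Q, hQ1, hQ2⟩ := ih (B := 4 * B + M) hq (by
      intro s
      have h1 : 1 ≤ (1 + ‖s‖) ^ j := one_le_pow₀ (by linarith [norm_nonneg s])
      rcases le_total ‖s‖ 1 with hs | hs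
      · calc _ ≤ M := hM s (by simpa using hs)
          _ ≤ M * (1 + ‖s‖) ^ j := le_mul_of_one_le_right hM0 h1
          _ ≤ _ := by gcongr; linarith
      · have h2 : ‖s‖ * ‖dslope g 0 s‖ ≤ ‖s‖ * ((4 * B + M) * (1 + ‖s‖) ^ j) := by
          rw [← norm_mul, hmul]
          calc ‖g s - g 0‖ ≤ B * (1 + ‖s‖) ^ (j + 1) + B * 1 := by
                rw [mul_one]; exact (norm_sub_le _ _).trans (add_le_add (hB s) hB0)
            _ ≤ B * (1 + ‖s‖) ^ (j + 1) + B * (1 + ‖s‖) ^ (j + 1) := by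
                gcongr; exact one_le_pow₀ (by linarith)
            _ = (1 + ‖s‖) * (2 * B * (1 + ‖s‖) ^ j) := by ring
            _ ≤ (2 * ‖s‖) * (2 * B * (1 + ‖s‖) ^ j) := by gcongr; linarith
            _ = ‖s‖ * ((4 * B) * (1 + ‖s‖) ^ j) := by ring
            _ ≤ _ := by gcongr; linarith
        exact le_of_mul_le_mul_left h2 (by linarith))
    refine ⟨Polynomial.C (g 0) + Polynomial.X * Q, ?_, fun s => ?_⟩
    · refine (Polynomial.natDegree_C_add).trans_le ((Polynomial.natDegree_mul_le).trans ?_)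
      rw [Polynomial.natDegree_X]; omega
    · have := hmul s
      rw [hQ2] at this
      simp only [Polynomial.eval_add, Polynomial.eval_C, Polynomial.eval_mul, Polynomial.eval_X]
      linear_combination -this

variable {E F : Type*} [NormedAddCommGroup E] [NormedSpace ℂ E]
  [NormedAddCommGroup F] [NormedSpace ℂ F]

variable (E) in
/-- Polynomial functions on `E`. -/
def polyFun : Subalgebra ℂ (E → ℂ) :=
  Algebra.adjoin ℂ (range fun (L : E →L[ℂ] ℂ) (z : E) => L z)

theorem clm_mem_polyFun (L : E →L[ℂ] ℂ) : (fun z => L z) ∈ polyFun E :=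
  Algebra.subset_adjoin ⟨L, rfl⟩

theorem polyFun_comp {f : F → ℂ} (hf : f ∈ polyFun F) (L : E →L[ℂ] F) :
    (fun z => f (L z)) ∈ polyFun E := by
  induction hf using Algebra.adjoin_induction with
  | mem f hf =>
    obtain ⟨l, rfl⟩ := hf
    exact clm_mem_polyFun (l.comp L)
  | algebraMap r => exact (polyFun E).algebraMap_mem r
  | add f g _ _ h1 h2 => exact add_mem h1 h2
  | mul f g _ _ h1 h2 => exact mul_mem h1 h2

theorem eval_mem_polyFun {f : E → ℂ} (hf : f ∈ polyFun E) (P : Polynomial ℂ) :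
    (fun z => P.eval (f z)) ∈ polyFun E := by
  induction P using Polynomial.induction_on' with
  | add p q h1 h2 =>
    simp only [Polynomial.eval_add]
    exact add_mem h1 h2
  | monomial n a =>
    simp only [Polynomial.eval_monomial]
    exact mul_mem ((polyFun E).algebraMap_mem a) (pow_mem hf n)

theorem holOn_of_mem_polyFun {f : E → ℂ} (hf : f ∈ polyFun E) (W : Set E) : HolOn f W := by
  intro x _
  induction hf using Algebra.adjoin_induction with
  | mem f hf =>
    obtain ⟨l, rfl⟩ := hf
    exact holAt_continuousLinearMap l
  | algebraMap r => exact holAt_const r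
  | add f g _ _ h1 h2 => exact h1.add h2
  | mul f g _ _ h1 h2 => exact h1.mul h2

/-- An entire function of polynomial growth is a polynomial. -/
theorem HolOn.mem_polyFun_of_growth (j d : ℕ) : ∀ {f : (Fin d → ℂ) → ℂ} {B : ℝ},
    HolOn f univ → (∀ x, ‖f x‖ ≤ B * (1 + ‖x‖) ^ j) → f ∈ polyFun (Fin d → ℂ) := by
  induction d with
  | zero =>
    intro f B _ _
    have : f = algebraMap ℂ _ (f 0) := by
      ext x; rw [Subsingleton.elim x 0]; rfl
    rw [this]
    exact (polyFun _).algebraMap_mem _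
  | succ d ih =>
    intro f B hf hB
    let T : (Fin (d + 1) → ℂ) →L[ℂ] (Fin d → ℂ) :=
      ContinuousLinearMap.pi fun i => ContinuousLinearMap.proj i.succ
    let J : (Fin d → ℂ) →L[ℂ] (Fin (d + 1) → ℂ) :=
      ContinuousLinearMap.pi (Fin.cons 0 fun i => ContinuousLinearMap.proj i)
    let v : Fin (d + 1) → ℂ := Pi.single 0 1
    have hJv : ∀ x, x = x 0 • v + J (T x) := by
      intro x
      ext i
      refine Fin.cases ?_ (fun k => ?_) i <;> simp [J, T, v]
    have hnorm : ∀ (s : ℂ) y, ‖s • v + J y‖ ≤ ‖s‖ + ‖y‖ := by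
      intro s y
      refine (pi_norm_le_iff_of_nonneg (by positivity)).2 fun i => ?_
      refine Fin.cases ?_ (fun k => ?_) i
      · simp [J, v]
      · have := norm_le_pi_norm y k
        simp [J, v]
        linarith [norm_nonneg s]
    have hBnn : 0 ≤ B := (norm_nonneg _).trans (by simpa using hB 0)
    have hbound : ∀ (s : ℂ) y, ‖f (s • v + J y)‖ ≤ (B * (1 + ‖s‖) ^ j) * (1 + ‖y‖) ^ j := by
      intro s y
      rw [mul_assoc, ← mul_pow]
      refine (hB _).trans ?_
      gcongr
      nlinarith [hnorm s y, norm_nonneg s, norm_nonneg y,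
          mul_nonneg (norm_nonneg s) (norm_nonneg y)]
    have hmem : ∀ s : ℂ, (fun y => f (s • v + J y)) ∈ polyFun (Fin d → ℂ) := fun s =>
      ih (B := B * (1 + ‖s‖) ^ j) (fun y _ => HolAt.comp_clm J (s • v) (hf _ (mem_univ _)))
        (hbound s)
    have hinj : InjOn (fun k : ℕ => (k : ℂ)) (Finset.range (j + 1)) := Nat.cast_injective.injOn
    have hsum : f = ∑ i ∈ Finset.range (j + 1), (fun x => f ((i : ℂ) • v + J (T x))) *
        fun x => (Lagrange.basis (Finset.range (j + 1)) (fun k : ℕ => (k : ℂ)) i).eval (x 0) := by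
      ext x
      obtain ⟨P, hP1, hP2⟩ := exists_polynomial_of_growth j
        (g := fun s => f (s • v + J (T x))) (B := B * (1 + ‖T x‖) ^ j)
        (fun s => by
          have := HolOn.differentiableAt_line (y := J (T x)) (v := v) (t := s)
            (hf _ (mem_univ _)) rfl
          simpa [add_comm] using this)
        (fun s => (hbound s (T x)).trans_eq (by ring))
      have h1 := Lagrange.eq_interpolate (f := P) hinj (by
        rw [Finset.card_range]
        exact (Polynomial.degree_le_of_natDegree_le hP1).trans_lt
          (by exact_mod_cast Nat.lt_succ_self j))
      have h2 := hP2 (x 0)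
      rw [← hJv, h1, Lagrange.interpolate_apply, Polynomial.eval_finsetSum] at h2
      rw [h2, Finset.sum_apply]
      refine Finset.sum_congr rfl fun i _ => ?_
      simp [hP2]
    rw [hsum]
    refine sum_mem fun i _ => mul_mem (polyFun_comp (hmem i) T) (eval_mem_polyFun ?_ _)
    exact clm_mem_polyFun (ContinuousLinearMap.proj 0 : (Fin (d + 1) → ℂ) →L[ℂ] ℂ)

end Growth

section ConeFibres

variable {E : Type*} [NormedAddCommGroup E] [NormedSpace ℂ E] {C : Set E}

theorem AnaAt.eventually_notMem {a : E} (hC : AnaAt C a) (ha : a ∉ C) : ∀ᶠ z in 𝓝 a, z ∉ C := by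
  obtain ⟨W, hW, haW, 𝓕, h1, h2⟩ := hC
  rw [h2 a haW] at ha
  push Not at ha
  obtain ⟨f, hf, hfa⟩ := ha
  filter_upwards [hW.mem_nhds haW, (h1 f hf a haW).1.eventually_ne hfa] with z hz1 hz2 hz3
  exact hz2 ((h2 z hz1).1 hz3 f hf)

theorem anaAt_of_polyFun (𝓕 : Set (E → ℂ)) (h𝓕 : ∀ f ∈ 𝓕, f ∈ polyFun E) (a : E) :
    AnaAt {z | ∀ f ∈ 𝓕, f z = 0} a :=
  AnaAt.of_family isOpen_univ (mem_univ a) 𝓕 (fun f hf => holOn_of_mem_polyFun (h𝓕 f hf) _)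
    fun _ _ => Iff.rfl

variable [FiniteDimensional ℂ E]

/-- The projection of an analytic cone is proper as soon as its kernel misses the cone. -/
theorem exists_cone_bound {F : Type*} [NormedAddCommGroup F] [NormedSpace ℂ F] (π : E →L[ℂ] F)
    (hC : ∀ a, a ≠ 0 → AnaAt C a) (hcone : ∀ z ∈ C, ∀ s : ℂ, s ≠ 0 → s • z ∈ C)
    (h0 : (0 : E) ∉ C) (hker : ∀ z ∈ C, π z ≠ 0) :
    ∃ c : ℝ, 0 ≤ c ∧ ∀ z ∈ C, ‖z‖ ≤ c * ‖π z‖ := by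
  have : ProperSpace E := FiniteDimensional.proper ℂ E
  have hK : IsCompact (sphere (0 : E) 1 ∩ C) := by
    refine (isCompact_sphere (0 : E) 1).of_isClosed_subset ?_ inter_subset_left
    refine isClosed_of_closure_subset fun z hz => ?_
    have h1 : z ∈ sphere (0 : E) 1 :=
      closure_minimal inter_subset_left isClosed_sphere hz
    refine ⟨h1, ?_⟩
    by_contra hzC
    have hz0 : z ≠ 0 := by rintro rfl; simp at h1
    obtain ⟨y, hy1, hy2⟩ := ((mem_closure_iff_frequently.1 hz).and_eventually
      ((hC z hz0).eventually_notMem hzC)).exists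
    exact hy2 hy1.2
  have hunit : ∀ z ∈ C, ((‖z‖⁻¹ : ℝ) : ℂ) • z ∈ sphere (0 : E) 1 ∩ C := by
    intro z hz
    have hz0 : ‖z‖ ≠ 0 := norm_ne_zero_iff.2 fun h => h0 (h ▸ hz)
    refine ⟨?_, hcone z hz _ (by exact_mod_cast inv_ne_zero hz0)⟩
    rw [mem_sphere_zero_iff_norm, norm_smul, Complex.norm_real, norm_inv, norm_norm,
      inv_mul_cancel₀ hz0]
  rcases (sphere (0 : E) 1 ∩ C).eq_empty_or_nonempty with he | hne
  · exact ⟨0, le_rfl, fun z hz => absurd (hunit z hz) (by simp [he])⟩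
  obtain ⟨m, hm, hmin⟩ := hK.exists_isMinOn hne (f := fun z => ‖π z‖) (by fun_prop)
  have hpos : 0 < ‖π m‖ := norm_pos_iff.2 (hker m hm.2)
  refine ⟨‖π m‖⁻¹, by positivity, fun z hz => ?_⟩
  have hz0 : 0 < ‖z‖ := norm_pos_iff.2 fun h => h0 (h ▸ hz)
  have h1 : ‖π m‖ ≤ ‖π (((‖z‖⁻¹ : ℝ) : ℂ) • z)‖ := hmin (hunit z hz)
  rw [map_smul, norm_smul, Complex.norm_real, norm_inv, norm_norm] at h1
  rw [inv_mul_eq_div, le_div_iff₀ hpos]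
  rwa [inv_mul_eq_div, le_div_iff₀ hz0, mul_comm] at h1

theorem eventually_fibre_subset {F : Type*} [NormedAddCommGroup F] [NormedSpace ℂ F]
    (π : E →L[ℂ] F) (hC : ∀ a, a ≠ 0 → AnaAt C a) {c : ℝ} (hc : 0 ≤ c)
    (hb : ∀ z ∈ C, ‖z‖ ≤ c * ‖π z‖) {x₀ : F} {Ω : Set E} (hΩ : IsOpen Ω)
    (h : ∀ z, z ∈ C ∨ z = 0 → π z = x₀ → z ∈ Ω) :
    ∀ᶠ x in 𝓝 x₀, ∀ z ∈ C, π z = x → z ∈ Ω := by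
  have : ProperSpace E := FiniteDimensional.proper ℂ E
  have h1 : ∀ᶠ x in 𝓝 x₀, ∀ z ∈ closedBall (0 : E) (c * (‖x₀‖ + 1)), z ∈ C → π z = x → z ∈ Ω := by
    refine (isCompact_closedBall _ _).eventually_forall_of_forall_eventually fun a _ => ?_
    by_cases hax : π a = x₀
    · have h2 : ∀ᶠ z in 𝓝 a, z ∈ C → z ∈ Ω := by
        by_cases haC : a ∈ C ∨ a = 0
        · exact mem_of_superset (hΩ.mem_nhds (h a haC hax)) fun z hz _ => hz
        · push Not at haC
          exact ((hC a haC.2).eventually_notMem haC.1).mono fun z hz hzC => absurd hzC hz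
      rw [nhds_prod_eq]
      exact (h2.prod_inr (𝓝 x₀)).mono fun p hp hpC _ => hp hpC
    · have h2 : ∀ᶠ p : F × E in 𝓝 (x₀, a), π p.2 ≠ p.1 :=
        (isOpen_ne_fun (by fun_prop) continuous_fst).mem_nhds hax
      exact h2.mono fun p hp _ h => absurd h hp
  have h2 : ∀ᶠ x in 𝓝 x₀, ‖x‖ < ‖x₀‖ + 1 :=
    continuous_norm.continuousAt.eventually_lt_const (by linarith)
  filter_upwards [h1, h2] with x hx1 hx2 z hz hzx
  refine hx1 z ?_ hz hzx
  rw [mem_closedBall_zero_iff]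
  refine (hb z hz).trans ?_
  rw [hzx]
  gcongr

theorem finite_cone_fibre {d : ℕ} (π : E →L[ℂ] (Fin d → ℂ)) (hC : ∀ a, a ≠ 0 → AnaAt C a)
    {c : ℝ} (hb : ∀ z ∈ C, ‖z‖ ≤ c * ‖π z‖) {x₀ : Fin d → ℂ} (hx₀ : x₀ ≠ 0) :
    (C ∩ {z | π z = x₀}).Finite := by
  have : ProperSpace E := FiniteDimensional.proper ℂ E
  have hne : ∀ z, π z = x₀ → z ≠ 0 := by
    rintro z hz rfl
    exact hx₀ (by rw [← hz, map_zero])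
  refine IsCompact.finite_of_anaAt ?_ ?_
  · refine (isCompact_closedBall (0 : E) (c * ‖x₀‖)).of_isClosed_subset ?_ ?_
    · refine isClosed_of_closure_subset fun z hz => ?_
      have h1 : π z = x₀ := closure_minimal inter_subset_right
        (isClosed_eq π.continuous continuous_const) hz
      refine ⟨?_, h1⟩
      by_contra hzC
      obtain ⟨y, hy1, hy2⟩ := ((mem_closure_iff_frequently.1 hz).and_eventually
        ((hC z (hne z h1)).eventually_notMem hzC)).exists
      exact hy2 hy1.1
    · rintro z ⟨hz, hzx⟩
      rw [mem_closedBall_zero_iff, ← show π z = x₀ from hzx]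
      exact hb z hz
  · rintro a ⟨-, ha⟩
    refine (hC a (hne a ha)).inter ?_
    refine AnaAt.of_family isOpen_univ (mem_univ _) {f | ∃ i, f = fun z => π z i - x₀ i} ?_ ?_
    · rintro f ⟨i, rfl⟩ z -
      exact (holAt_continuousLinearMap ((ContinuousLinearMap.proj i).comp π)).sub (holAt_const _)
    · intro z _
      constructor
      · rintro hz f ⟨i, rfl⟩
        exact sub_eq_zero.2 (congrFun hz i)
      · exact fun hz => funext fun i => sub_eq_zero.1 (hz _ ⟨i, rfl⟩)

end ConeFibres

section Sheets

variable {E : Type*} [NormedAddCommGroup E] [NormedSpace ℂ E] [FiniteDimensional ℂ E] {C : Set E}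
  {d : ℕ}

/-- Locally, the fibres of a proper projection form a holomorphic multisection away from the zeros
of a holomorphic function. -/
theorem exists_local_sheets (π : E →L[ℂ] (Fin d → ℂ)) (hπ : Function.Surjective π)
    (hC : ∀ a, a ≠ 0 → AnaAt C a) (h0 : (0 : E) ∉ C) {c : ℝ} (hc : 0 ≤ c)
    (hb : ∀ z ∈ C, ‖z‖ ≤ c * ‖π z‖) {t : (Fin d → ℂ) → Finset E}
    (ht : ∀ x, x ≠ 0 → ∀ z, z ∈ t x ↔ z ∈ C ∧ π z = x) {x₀ : Fin d → ℂ} (hx₀ : x₀ ≠ 0) :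
    ∃ (h : (Fin d → ℂ) → ℂ) (n : ℕ), NonzeroGerm h x₀ ∧ ∀ᶠ x in 𝓝 x₀, h x ≠ 0 →
      HolMultiAt (fun y => (t y).val) x ∧ (t x).card = n := by
  classical
  obtain ⟨V, hV1, hV2⟩ := (t x₀).finite_toSet.t2_separation
  have key : ∀ a ∈ t x₀, ∃ (W : Set E) (τ : (Fin d → ℂ) → Finset E) (h : (Fin d → ℂ) → ℂ) (n : ℕ),
      IsOpen W ∧ a ∈ W ∧ W ⊆ V a ∧ NonzeroGerm h x₀ ∧ ∀ᶠ x in 𝓝 x₀,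
        (∀ z, z ∈ τ x ↔ z ∈ W ∧ π z = x ∧ z ∈ C) ∧
        (h x ≠ 0 → HolMultiAt (fun x => (τ x).val) x ∧ (τ x).card = n) := by
    intro a ha
    obtain ⟨haC, hax⟩ := (ht x₀ hx₀ a).1 ha
    have hiso : ∀ᶠ z in 𝓝 a, π z = π a → z ∈ C → z = a := by
      have h1 : ((((t x₀).erase a : Finset E) : Set E))ᶜ ∈ 𝓝 a :=
        ((Finset.finite_toSet _).isClosed.isOpen_compl).mem_nhds (by simp)
      filter_upwards [h1] with z hz hz1 hz2
      by_contra hne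
      exact hz (Finset.mem_coe.2 (Finset.mem_erase.2 ⟨hne, (ht x₀ hx₀ z).2 ⟨hz2, hz1.trans hax⟩⟩))
    obtain ⟨W, s, τ, h, n, hW, haW, hWV, hh, hev⟩ :=
      (hC a fun h => h0 (h ▸ haC)).exists_good_multisection π hπ anaAt_empty hiso
        ((hV1 a).2.mem_nhds (hV1 a).1)
    rw [hax] at hh hev
    refine ⟨W, τ, h, n, hW, haW, hWV, hh, hev.mono fun x hx => ⟨fun z => ?_, hx.2.2.2.2⟩⟩
    rw [hx.2.2.2.1 z]
    simp
  choose! W τ h n hW haW hWV hh hev using key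
  have hfib := eventually_fibre_subset π hC hc hb (x₀ := x₀) (Ω := ⋃ a ∈ t x₀, W a)
    (isOpen_biUnion hW) (by
      rintro z (hz | rfl) hzx
      · have := (ht x₀ hx₀ z).2 ⟨hz, hzx⟩
        exact mem_biUnion this (haW z this)
      · exact absurd (by rw [← hzx, map_zero]) hx₀)
  have hsum : ∀ᶠ x in 𝓝 x₀, (t x).val = ∑ a ∈ t x₀, (τ a x).val := by
    filter_upwards [hfib, (Finset.eventually_all (t x₀)).2 hev, isOpen_ne.mem_nhds hx₀]
      with x hx1 hx2 hx3
    have hdisj : ((t x₀ : Finset E) : Set E).PairwiseDisjoint fun a => τ a x := by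
      intro a ha b hb hab
      refine Finset.disjoint_left.2 fun z hza hzb => ?_
      have h1 := hWV a ha (((hx2 a ha).1 z).1 hza).1
      have h2 := hWV b hb (((hx2 b hb).1 z).1 hzb).1
      exact Set.disjoint_left.1 (hV2 ha hb hab) h1 h2
    rw [show ∑ a ∈ t x₀, (τ a x).val = ((t x₀).disjiUnion (fun a => τ a x) hdisj).val from rfl]
    congr 1
    ext z
    rw [Finset.mem_disjiUnion, ht x hx3]
    constructor
    · rintro ⟨hzC, hzx⟩
      obtain ⟨a, ha, hza⟩ := mem_iUnion₂.1 (hx1 z hzC hzx)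
      exact ⟨a, ha, ((hx2 a ha).1 z).2 ⟨hza, hzx, hzC⟩⟩
    · rintro ⟨a, ha, hza⟩
      have := ((hx2 a ha).1 z).1 hza
      exact ⟨this.2.2, this.2.1⟩
  refine ⟨fun x => ∏ a ∈ t x₀, h a x, ∑ a ∈ t x₀, n a, NonzeroGerm.prod _ hh, ?_⟩
  filter_upwards [hsum.eventually_nhds, (Finset.eventually_all (t x₀)).2 hev] with x hx1 hx2 hne
  rw [Finset.prod_ne_zero_iff] at hne
  refine ⟨(HolMultiAt.sum _ fun a ha => ((hx2 a ha).2 (hne a ha)).1).congr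
    (hx1.mono fun y hy => hy.symm), ?_⟩
  rw [← Finset.card_val, hx1.self_of_nhds, Multiset.card_sum]
  exact Finset.sum_congr rfl fun a ha => ((hx2 a ha).2 (hne a ha)).2

theorem isPreconnected_compl_zero (d : ℕ) : IsPreconnected ({0}ᶜ : Set (Fin (d + 1) → ℂ)) := by
  refine (isConnected_compl_singleton_of_one_lt_rank ?_ 0).isPreconnected
  rw [rank_real_of_complex, rank_fin_fun]
  exact_mod_cast (by omega : 1 < 2 * (d + 1))

/-- The number of sheets is globally constant away from a thin set. -/
theorem exists_global_sheets (π : E →L[ℂ] (Fin (d + 1) → ℂ)) (hπ : Function.Surjective π)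
    (hC : ∀ a, a ≠ 0 → AnaAt C a) (h0 : (0 : E) ∉ C) {c : ℝ} (hc : 0 ≤ c)
    (hb : ∀ z ∈ C, ‖z‖ ≤ c * ‖π z‖) :
    ∃ (t : (Fin (d + 1) → ℂ) → Finset E) (n : ℕ) (S : Set (Fin (d + 1) → ℂ)),
      (∀ x, x ≠ 0 → ∀ z, z ∈ t x ↔ z ∈ C ∧ π z = x) ∧ ThinOn S {0}ᶜ ∧
      ∀ x, x ≠ 0 → x ∉ S → HolMultiAt (fun y => (t y).val) x ∧ (t x).card = n := by
  have hfin : ∀ x : Fin (d + 1) → ℂ, ∃ T : Finset E, x ≠ 0 → ∀ z, z ∈ T ↔ z ∈ C ∧ π z = x := by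
    intro x
    by_cases hx : x = 0
    · exact ⟨∅, fun h => absurd hx h⟩
    · exact ⟨(finite_cone_fibre π hC hb hx).toFinset, fun _ z => by simp⟩
  choose t ht using hfin
  have hloc : ∀ x : Fin (d + 1) → ℂ, ∃ (h : (Fin (d + 1) → ℂ) → ℂ) (n : ℕ), x ≠ 0 →
      NonzeroGerm h x ∧ ∀ᶠ y in 𝓝 x, h y ≠ 0 →
      HolMultiAt (fun y => (t y).val) y ∧ (t y).card = n := by
    intro x
    by_cases hx : x = 0
    · exact ⟨0, 0, fun h => absurd hx h⟩
    · obtain ⟨h, n, hh⟩ := exists_local_sheets π hπ hC h0 hc hb ht hx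
      exact ⟨h, n, fun _ => hh⟩
  choose h n hhn using hloc
  have hloc : ∀ x, x ≠ 0 → ∀ᶠ y in 𝓝 x, n y = n x := by
    intro x hx
    filter_upwards [(hhn x hx).1.eventually, (hhn x hx).2.eventually_nhds, isOpen_ne.mem_nhds hx]
      with y hy1 hy2 hy3
    obtain ⟨w, hw3, hw1, hw2⟩ :=
      ((hy1.mul (hhn y hy3).1).2.and_eventually (hy2.and (hhn y hy3).2)).exists
    rw [mul_ne_zero_iff] at hw3
    rw [← (hw1 hw3.1).2, ← (hw2 hw3.2).2]
  have hn : ∃ N, ∀ x, x ≠ 0 → n x = N := by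
    refine ⟨n (fun _ => 1), fun x hx => ?_⟩
    refine (isPreconnected_compl_zero d).constant (f := n) (fun y hy => ?_) hx ?_
    · exact ((continuousAt_const (y := n y)).congr ((hloc y hy).mono fun z hz =>
        hz.symm)).continuousWithinAt
    · exact fun h => one_ne_zero (congrFun h 0)
  obtain ⟨N, hN⟩ := hn
  refine ⟨t, N, {x | x ≠ 0 ∧ ¬ (HolMultiAt (fun y => (t y).val) x ∧ (t x).card = N)}, ht, ?_, ?_⟩
  · intro x hx
    refine ⟨h x, (hhn x hx).1, (hhn x hx).2.mono fun y hy hne hyS => hyS.2 ?_⟩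
    rw [← hN x hx]
    exact hy hne
  · intro x hx hxS
    by_contra hcon
    exact hxS ⟨hx, hcon⟩

end Sheets

section Top

theorem NonzeroGerm.comp_smul {F : Type*} [NormedAddCommGroup F] [NormedSpace ℂ F] {h : F → ℂ}
    {x : F} {s : ℂ} (hs : s ≠ 0) (hh : NonzeroGerm h (s • x)) :
    NonzeroGerm (fun y => h (s • y)) x := by
  constructor
  · have h1 : Tendsto (fun y : F => s • y) (𝓝 x) (𝓝 (s • x)) := (continuous_const_smul s).tendsto x
    filter_upwards [h1.eventually hh.1] with y hy
    exact HolAt.comp_linear (s • ContinuousLinearMap.id ℂ F) hy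
  · have h1 := hh.2
    rw [← show map (fun y : F => s • y) (𝓝 x) = 𝓝 (s • x) from
      (Homeomorph.smulOfNeZero s hs).map_nhds_eq x] at h1
    exact frequently_map.1 h1

theorem ThinOn.union_preimage_smul {F : Type*} [NormedAddCommGroup F] [NormedSpace ℂ F] {S : Set F}
    (hS : ThinOn S {0}ᶜ) {s : ℂ} (hs : s ≠ 0) : ThinOn (S ∪ {y | s • y ∈ S}) {0}ᶜ := by
  intro x hx
  obtain ⟨h, h1, h2⟩ := hS x hx
  obtain ⟨g, g1, g2⟩ := hS (s • x) (smul_ne_zero hs hx)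
  refine ⟨_, h1.mul (g1.comp_smul hs), ?_⟩
  have h3 : Tendsto (fun y : F => s • y) (𝓝 x) (𝓝 (s • x)) := (continuous_const_smul s).tendsto x
  filter_upwards [h2, h3.eventually g2] with y hy1 hy2 hne
  rw [mul_ne_zero_iff] at hne
  rintro (hy | hy)
  · exact hy1 hne.1 hy
  · exact hy2 hne.2 hy

theorem thinOn_zero (d : ℕ) : ThinOn ({0} : Set (Fin (d + 1) → ℂ)) univ := by
  intro x _
  refine ⟨fun y => y 0, ?_, Eventually.of_forall fun y hy h0 => hy ?_⟩
  · refine HolOn.nonzeroGerm isOpen_univ convex_univ (fun y _ => ?_) (mem_univ fun _ => (1 : ℂ))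
      one_ne_zero (mem_univ x)
    exact holAt_continuousLinearMap (ContinuousLinearMap.proj 0 : (Fin (d + 1) → ℂ) →L[ℂ] ℂ)
  · exact congrFun (mem_singleton_iff.1 h0) 0

theorem ThinOn.frequently_compl_zero {d : ℕ} {S : Set (Fin (d + 1) → ℂ)} (hS : ThinOn S {0}ᶜ)
    (x : Fin (d + 1) → ℂ) : ∃ᶠ y in 𝓝 x, y ≠ 0 ∧ y ∉ S := by
  rw [← frequently_frequently_nhds]
  refine ((thinOn_zero d).frequently (mem_univ x)).mono fun y hy => ?_
  exact ((hS.frequently hy).and_eventually (isOpen_ne.mem_nhds hy)).mono fun z hz => ⟨hz.2, hz.1⟩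

variable {E : Type*} [NormedAddCommGroup E] [NormedSpace ℂ E] {d : ℕ}

/-- The coefficients of the characteristic polynomials of the generic fibres are polynomials. -/
theorem exists_polyFun_esymm {t : (Fin (d + 1) → ℂ) → Finset E} {n : ℕ}
    {S : Set (Fin (d + 1) → ℂ)} (hS : ThinOn S {0}ᶜ)
    (ht : ∀ x, x ≠ 0 → x ∉ S → HolMultiAt (fun y => (t y).val) x ∧ (t x).card = n) {c : ℝ}
    (hc : 0 ≤ c) (hb : ∀ x, x ≠ 0 → ∀ z ∈ t x, ‖z‖ ≤ c * ‖x‖) (L : E →L[ℂ] ℂ) :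
    ∃ e : ℕ → (Fin (d + 1) → ℂ) → ℂ, (∀ j, e j ∈ polyFun (Fin (d + 1) → ℂ)) ∧
      ∀ x, x ≠ 0 → x ∉ S → ∀ j, e j x = ((t x).val.map fun z => -L z).esymm j := by
  obtain ⟨e, he1, he2⟩ := ThinOn.exists_extension_esymm isOpen_compl_singleton hS
    (t := fun x => (t x).val) ht (fun x hx => by
      refine ⟨c * (‖x‖ + 1), ?_⟩
      filter_upwards [continuous_norm.continuousAt.eventually_lt_const (lt_add_one ‖x‖),
        isOpen_ne.mem_nhds hx] with y hy1 hy2 _ z hz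
      exact (hb y hy2 z hz).trans (by gcongr)) L
  have hgood : ∀ x, x ≠ 0 → x ∉ S → ∀ j,
      ‖e j x‖ ≤ (n.choose j * (‖L‖ * c) ^ j) * (1 + ‖x‖) ^ j := by
    intro x hx hxS j
    rw [he2 x hx hxS j, mul_assoc, ← mul_pow]
    have h1 := Multiset.norm_esymm_le (m := (t x).val.map fun z => -L z)
      (B := ‖L‖ * c * (1 + ‖x‖)) (by
        intro a ha
        obtain ⟨z, hz, rfl⟩ := Multiset.mem_map.1 ha
        rw [norm_neg, mul_assoc]
        refine (L.le_opNorm z).trans ?_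
        gcongr
        exact (hb x hx z hz).trans (by gcongr; linarith)) j
    rwa [Multiset.card_map, Finset.card_val, (ht x hx hxS).2] at h1
  have hgrow : ∀ (j : ℕ) (f : (Fin (d + 1) → ℂ) → ℂ) (x : Fin (d + 1) → ℂ), ContinuousAt f x →
      (∀ y, y ≠ 0 → f y = e j y) → ‖f x‖ ≤ (n.choose j * (‖L‖ * c) ^ j) * (1 + ‖x‖) ^ j := by
    intro j f x hf hfe
    refine le_of_tendsto_of_tendsto_of_frequently hf.norm
      (g := fun x => (n.choose j * (‖L‖ * c) ^ j) * (1 + ‖x‖) ^ j)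
      (Continuous.tendsto (by fun_prop) x) ?_
    refine (hS.frequently_compl_zero x).mono fun y hy => ?_
    rw [hfe y hy.1]
    exact hgood y hy.1 hy.2 j
  have hext : ∀ j, ∃ G : (Fin (d + 1) → ℂ) → ℂ, HolOn G univ ∧ ∀ y ∈ univ, y ∉ ({0} : Set _) →
      G y = e j y := by
    intro j
    refine (thinOn_zero d).exists_extension isOpen_univ (fun y _ hy => he1 j y hy) fun x _ => ?_
    refine ⟨(n.choose j * (‖L‖ * c) ^ j) * (1 + (‖x‖ + 1)) ^ j, ?_⟩
    filter_upwards [continuous_norm.continuousAt.eventually_lt_const (lt_add_one ‖x‖)]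
      with y hy1 hy2
    refine (hgrow j (e j) y (he1 j y hy2).1 fun _ _ => rfl).trans ?_
    gcongr
  choose G hG1 hG2 using hext
  refine ⟨G, fun j => HolOn.mem_polyFun_of_growth j _ (hG1 j) fun x =>
    hgrow j (G j) x (hG1 j x (mem_univ x)).1 fun y hy => hG2 j y (mem_univ y) hy, ?_⟩
  intro x hx hxS j
  rw [hG2 j x (mem_univ x) hx, he2 x hx hxS j]

end Top

section GenericPart

variable {E : Type*} [NormedAddCommGroup E] [NormedSpace ℂ E]

/-- The evaluation at `T` of the monic polynomial of degree `n` with coefficients `e j x`. -/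
def monicEval {X : Type*} (n : ℕ) (e : ℕ → X → ℂ) (x : X) (T : ℂ) : ℂ :=
  ∑ j ∈ Finset.range (n + 1), e j x * T ^ (n - j)

theorem monicEval_eq_prod {X : Type*} {n : ℕ} {e : ℕ → X → ℂ} {x : X} {t : Finset E}
    (ht : t.card = n) (L : E →L[ℂ] ℂ) (he : ∀ j, e j x = (t.val.map fun z => -L z).esymm j)
    (T : ℂ) : monicEval n e x T = ∏ z ∈ t, (T - L z) := by
  change _ = (t.val.map fun z => T - L z).prod
  rw [Multiset.prod_sub_eq_sum_esymm, Finset.card_val, ht, monicEval]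
  exact Finset.sum_congr rfl fun j _ => by rw [he j]

theorem tendsto_monicEval {X : Type*} [TopologicalSpace X] {n : ℕ} {e : ℕ → X → ℂ} {x : X}
    (he : ∀ j, ContinuousAt (e j) x) (T : ℂ) :
    Tendsto (fun y => monicEval n e y T) (𝓝 x) (𝓝 (monicEval n e x T)) :=
  tendsto_finsetSum _ fun j _ => (he j).mul_const _

theorem monicEval_mem_polyFun {F : Type*} [NormedAddCommGroup F] [NormedSpace ℂ F]
    {n : ℕ} {e : ℕ → F → ℂ} (he : ∀ j, e j ∈ polyFun F) (π : E →L[ℂ] F) (L : E →L[ℂ] ℂ) :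
    (fun z => monicEval n e (π z) (L z)) ∈ polyFun E := by
  have h : (fun z => monicEval n e (π z) (L z)) =
      ∑ j ∈ Finset.range (n + 1), (fun z => e j (π z)) * (fun z => L z) ^ (n - j) := by
    ext z
    simp [monicEval]
  rw [h]
  exact sum_mem fun j _ => mul_mem (polyFun_comp (he j) π) (pow_mem (clm_mem_polyFun L) _)

variable [FiniteDimensional ℂ E] {C : Set E} {d : ℕ}

/-- An analytic cone that is finite over `ℂ ^ (d + 1)` contains an algebraic cone which agrees
with it over a neighborhood of some point. -/
theorem exists_algebraic_subcone (π : E →L[ℂ] (Fin (d + 1) → ℂ)) (hπ : Function.Surjective π)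
    (hC : ∀ a, a ≠ 0 → AnaAt C a) (hcone : ∀ z ∈ C, ∀ s : ℂ, s ≠ 0 → s • z ∈ C)
    (h0 : (0 : E) ∉ C) (hker : ∀ z ∈ C, π z ≠ 0) :
    ∃ (Q : Set E) (𝓕 : Set (E → ℂ)) (x₁ : Fin (d + 1) → ℂ), (∀ f ∈ 𝓕, f ∈ polyFun E) ∧
      (∀ z, z ∈ Q ↔ ∀ f ∈ 𝓕, f z = 0) ∧ (∀ z ∈ Q, z ≠ 0 → z ∈ C) ∧
      (∀ z ∈ Q, ∀ s : ℂ, s ≠ 0 → s • z ∈ Q) ∧ x₁ ≠ 0 ∧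
      ∀ᶠ x in 𝓝 x₁, ∀ z ∈ C, π z = x → z ∈ Q := by
  classical
  obtain ⟨c, hc, hb⟩ := exists_cone_bound π hC hcone h0 hker
  obtain ⟨t, n, S, ht, hS, htS⟩ := exists_global_sheets π hπ hC h0 hc hb
  have hbt : ∀ x, x ≠ 0 → ∀ z ∈ t x, ‖z‖ ≤ c * ‖x‖ := by
    intro x hx z hz
    obtain ⟨hzC, rfl⟩ := (ht x hx z).1 hz
    exact hb z hzC
  choose e he1 he2 using fun L : E →L[ℂ] ℂ => exists_polyFun_esymm hS htS hc hbt L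
  have hlim : ∀ L x T, Tendsto (fun y => monicEval n (e L) y T) (𝓝 x)
      (𝓝 (monicEval n (e L) x T)) := fun L x T =>
    tendsto_monicEval (fun j => (holOn_of_mem_polyFun (he1 L j) univ x (mem_univ x)).1) T
  have hprod : ∀ L x T, x ≠ 0 → x ∉ S → monicEval n (e L) x T = ∏ z ∈ t x, (T - L z) :=
    fun L x T hx hxS => monicEval_eq_prod (htS x hx hxS).2 L (he2 L x hx hxS) T
  have hscale : ∀ L x T (s : ℂ), s ≠ 0 →
      monicEval n (e L) (s • x) (s * T) = s ^ n * monicEval n (e L) x T := by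
    intro L x T s hs
    refine tendsto_nhds_unique_of_frequently_eq
      ((hlim L (s • x) (s * T)).comp ((continuous_const_smul s).tendsto x))
      ((hlim L x T).const_mul _) ?_
    refine ((hS.union_preimage_smul hs).frequently_compl_zero x).mono fun y hy => ?_
    simp only [mem_union, mem_ofPred_eq, not_or] at hy
    obtain ⟨hy0, hyS, hyS'⟩ := hy
    have himg : (t y).image (fun z => s • z) = t (s • y) := by
      ext z
      rw [Finset.mem_image, ht _ (smul_ne_zero hs hy0)]
      constructor
      · rintro ⟨w, hw, rfl⟩
        obtain ⟨hwC, rfl⟩ := (ht y hy0 w).1 hw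
        exact ⟨hcone w hwC s hs, map_smul π s w⟩
      · rintro ⟨hzC, hz⟩
        refine ⟨s⁻¹ • z, (ht y hy0 _).2 ⟨hcone z hzC _ (inv_ne_zero hs), ?_⟩,
          smul_inv_smul₀ hs z⟩
        rw [map_smul, hz, inv_smul_smul₀ hs]
    rw [Function.comp_apply, hprod L y T hy0 hyS, hprod L _ _ (smul_ne_zero hs hy0) hyS', ← himg,
      Finset.prod_image fun a _ b _ hab => smul_right_injective E hs hab, ← (htS y hy0 hyS).2,
      ← Finset.prod_const, ← Finset.prod_mul_distrib]
    exact Finset.prod_congr rfl fun z _ => by rw [map_smul, smul_eq_mul, mul_sub]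
  obtain ⟨x₁, hx₁0, hx₁⟩ : ∃ x₁ : Fin (d + 1) → ℂ, x₁ ≠ 0 ∧ ∀ᶠ x in 𝓝 x₁, x ≠ 0 ∧ x ∉ S := by
    have hone : (fun _ => 1 : Fin (d + 1) → ℂ) ≠ 0 := fun h => one_ne_zero (congrFun h 0)
    obtain ⟨h, h1, h2⟩ := hS _ hone
    obtain ⟨x₁, hne, hx1, hx2, hx3⟩ := (h1.2.and_eventually (h1.1.and
      (h2.eventually_nhds.and (isOpen_ne.mem_nhds hone)))).exists
    refine ⟨x₁, hx3, ?_⟩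
    filter_upwards [hx2, hx1.1.eventually_ne hne, isOpen_ne.mem_nhds hx3] with x h4 h5 h6
    exact ⟨h6, h4 h5⟩
  refine ⟨{w | ∀ L : E →L[ℂ] ℂ, monicEval n (e L) (π w) (L w) = 0},
    range fun (L : E →L[ℂ] ℂ) w => monicEval n (e L) (π w) (L w), x₁, ?_, ?_, ?_, ?_, hx₁0, ?_⟩
  · rintro _ ⟨L, rfl⟩
    exact monicEval_mem_polyFun (he1 L) π L
  · intro z
    refine ⟨?_, fun h L => h _ ⟨L, rfl⟩⟩
    rintro hz _ ⟨L, rfl⟩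
    exact hz L
  · intro w hwQ hw0
    by_contra hwC
    have hfin : ((C ∩ {z | π z = π w}) ∪ {0}).Finite := by
      refine Finite.union ?_ (finite_singleton 0)
      by_cases hx : π w = 0
      · refine finite_empty.subset ?_
        rintro z ⟨hzC, hz⟩
        exact hker z hzC (hz.trans hx)
      · exact finite_cone_fibre π hC hb hx
    have hne : ∀ z ∈ hfin.toFinset, z ≠ w := by
      intro z hz
      rcases hfin.mem_toFinset.1 hz with hz | rfl
      · rintro rfl; exact hwC hz.1
      · exact hw0.symm
    obtain ⟨L, hL⟩ := exists_clm_forall_ne_zero (hfin.toFinset.image fun z => z - w) (by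
      intro y hy
      obtain ⟨z, hz, rfl⟩ := Finset.mem_image.1 hy
      exact sub_ne_zero.2 (hne z hz))
    obtain ⟨δ, hδ, hδL⟩ : ∃ δ > 0, ∀ z ∈ hfin.toFinset, δ < ‖L z - L w‖ := by
      have h1 : ∀ z ∈ hfin.toFinset, ∀ᶠ δ in 𝓝[>] (0 : ℝ), δ < ‖L z - L w‖ := by
        intro z hz
        refine nhdsWithin_le_nhds (Iio_mem_nhds (norm_pos_iff.2 ?_))
        have := hL (z - w) (Finset.mem_image.2 ⟨z, hz, rfl⟩)
        rwa [map_sub] at this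
      obtain ⟨δ, h2, h3⟩ := (((Finset.eventually_all _).2 h1).and self_mem_nhdsWithin).exists
      exact ⟨δ, h3, h2⟩
    have hev := eventually_fibre_subset π hC hc hb (x₀ := π w) (Ω := {z | δ < ‖L z - L w‖})
      (isOpen_lt continuous_const (by fun_prop)) fun z hz hzw => hδL z (hfin.mem_toFinset.2
        (hz.imp (fun h => ⟨h, hzw⟩) id))
    have hbound : ∃ᶠ x in 𝓝 (π w), δ ^ n ≤ ‖monicEval n (e L) x (L w)‖ := by
      refine ((hS.frequently_compl_zero (π w)).and_eventually hev).mono ?_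
      rintro x ⟨⟨hx0, hxS⟩, hx⟩
      rw [hprod L x _ hx0 hxS, ← (htS x hx0 hxS).2, norm_prod, ← Finset.prod_const]
      refine Finset.prod_le_prod (fun _ _ => hδ.le) fun z hz => ?_
      obtain ⟨hzC, hzx⟩ := (ht x hx0 z).1 hz
      rw [norm_sub_rev]
      exact (hx z hzC hzx).le
    have hsmall : ∀ᶠ x in 𝓝 (π w), ‖monicEval n (e L) x (L w)‖ < δ ^ n := by
      refine (hlim L (π w) (L w)).norm.eventually_lt_const ?_
      rw [hwQ L, norm_zero]
      exact pow_pos hδ n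
    obtain ⟨x, hx1, hx2⟩ := (hbound.and_eventually hsmall).exists
    exact absurd hx1 hx2.not_ge
  · intro z hz s hs L
    rw [map_smul, map_smul, smul_eq_mul, hscale L _ _ s hs, hz L, mul_zero]
  · filter_upwards [hx₁] with x hx z hzC hzx L
    subst hzx
    rw [hprod L _ _ hx.1 hx.2]
    exact Finset.prod_eq_zero ((ht _ hx.1 z).2 ⟨hzC, rfl⟩) (sub_self _)

end GenericPart

section Cone

variable {E : Type*} [NormedAddCommGroup E] [NormedSpace ℂ E] [FiniteDimensional ℂ E]

theorem exists_polyFun_family_of_projection (d : ℕ) : ∀ {C : Set E} (π : E →L[ℂ] (Fin d → ℂ)),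
    Function.Surjective π → (∀ a, a ≠ 0 → AnaAt C a) →
    (∀ z ∈ C, ∀ s : ℂ, s ≠ 0 → s • z ∈ C) → (∀ z ∈ C, π z ≠ 0) →
    ∃ 𝓕 : Set (E → ℂ), (∀ f ∈ 𝓕, f ∈ polyFun E) ∧
      ∀ w, w ≠ 0 → (w ∈ C ↔ ∀ f ∈ 𝓕, f w = 0) := by
  induction d with
  | zero =>
    intro C π _ _ _ hker
    refine ⟨{1}, ?_, fun w _ => ⟨fun hw => absurd (Subsingleton.elim _ _) (hker w hw), fun h => ?_⟩⟩
    · rintro f rfl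
      exact one_mem _
    · exact absurd (h 1 rfl) one_ne_zero
  | succ d ih =>
    intro C π hπ hC hcone hker
    have h0 : (0 : E) ∉ C := fun h => hker 0 h (map_zero π)
    obtain ⟨Q, 𝓕, x₁, h𝓕, hQ, hQC, hQcone, hx₁, hev⟩ :=
      exists_algebraic_subcone π hπ hC hcone h0 hker
    have hQana : ∀ a, AnaAt Q a := fun a => (anaAt_of_polyFun 𝓕 h𝓕 a).congr
      (Eventually.of_forall fun z => (hQ z).symm)
    have hRC : closure (C \ Q) \ {0} ⊆ C := by
      rintro z ⟨hz, hz0⟩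
      by_contra hzC
      obtain ⟨y, hy1, hy2⟩ := ((mem_closure_iff_frequently.1 hz).and_eventually
        ((hC z hz0).eventually_notMem hzC)).exists
      exact hy2 hy1.1
    have hRcone : ∀ z ∈ closure (C \ Q) \ {0}, ∀ s : ℂ, s ≠ 0 →
        s • z ∈ closure (C \ Q) \ {0} := by
      rintro z ⟨hz, hz0⟩ s hs
      refine ⟨map_mem_closure (continuous_const_smul s) hz ?_, smul_ne_zero hs hz0⟩
      rintro w ⟨hw1, hw2⟩
      refine ⟨hcone w hw1 s hs, fun h => hw2 ?_⟩
      simpa [inv_smul_smul₀ hs] using hQcone _ h s⁻¹ (inv_ne_zero hs)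
    obtain ⟨κ, ψ, hκ, -, hψ⟩ := exists_clm_ker_eq_span hx₁
    obtain ⟨𝓖, h𝓖, hR⟩ := ih (C := closure (C \ Q) \ {0}) (κ.comp π) (hκ.comp hπ)
      (fun a ha => ((hC a ha).closure_diff (hQana a)).congr (by
        filter_upwards [isOpen_ne.mem_nhds ha] with z hz
        exact ⟨fun h => ⟨h, hz⟩, fun h => h.1⟩)) hRcone (by
        intro w hw hκw
        have h1 := hψ (π w) hκw
        have h2 : ψ (π w) ≠ 0 := by
          intro h
          rw [h, zero_smul] at h1
          exact hker w (hRC hw) h1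
        have h3 := (hRcone w hw _ (inv_ne_zero h2)).1
        have h4 : π ((ψ (π w))⁻¹ • w) = x₁ := by
          rw [map_smul]
          nth_rewrite 2 [h1]
          exact inv_smul_smul₀ h2 x₁
        have h5 := (h4 ▸ π.continuous.tendsto ((ψ (π w))⁻¹ • w)).eventually hev
        obtain ⟨y, hy1, hy2⟩ := ((mem_closure_iff_frequently.1 h3).and_eventually h5).exists
        exact hy1.2 (hy2 y hy1.1 rfl))
    refine ⟨{h | ∃ f ∈ 𝓕, ∃ g ∈ 𝓖, h = f * g}, ?_, fun w hw => ⟨?_, fun h => ?_⟩⟩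
    · rintro _ ⟨f, hf, g, hg, rfl⟩
      exact mul_mem (h𝓕 f hf) (h𝓖 g hg)
    · rintro hwC _ ⟨f, hf, g, hg, rfl⟩
      rw [Pi.mul_apply]
      by_cases hwQ : w ∈ Q
      · rw [(hQ w).1 hwQ f hf, zero_mul]
      · rw [(hR w hw).1 ⟨subset_closure ⟨hwC, hwQ⟩, hw⟩ g hg, mul_zero]
    · by_cases hwQ : w ∈ Q
      · exact hQC w hwQ hw
      · have h1 := mt (hQ w).2 hwQ
        push Not at h1
        obtain ⟨f, hf, hfw⟩ := h1
        refine hRC ((hR w hw).2 fun g hg => ?_)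
        exact (mul_eq_zero.1 (h _ ⟨f, hf, g, hg, rfl⟩)).resolve_left hfw

/-- **Chow's theorem** for cones: an analytic cone is cut out by polynomial functions. -/
theorem exists_polyFun_family {C : Set E} (hC : ∀ a, a ≠ 0 → AnaAt C a)
    (hcone : ∀ z ∈ C, ∀ s : ℂ, s ≠ 0 → s • z ∈ C) (h0 : (0 : E) ∉ C) :
    ∃ 𝓕 : Set (E → ℂ), (∀ f ∈ 𝓕, f ∈ polyFun E) ∧
      ∀ w, w ≠ 0 → (w ∈ C ↔ ∀ f ∈ 𝓕, f w = 0) := by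
  have π : E ≃L[ℂ] (Fin (Module.finrank ℂ E) → ℂ) :=
    ContinuousLinearEquiv.ofFinrankEq (by simp)
  refine exists_polyFun_family_of_projection _ π.toContinuousLinearMap π.surjective hC hcone ?_
  intro z hz hz0
  rw [ContinuousLinearEquiv.coe_coe, map_eq_zero_iff π π.injective] at hz0
  exact h0 (hz0 ▸ hz)

end Cone

section Homogeneous

open MvPolynomial

theorem exists_mvPolynomial_of_mem_polyFun {m : ℕ} {f : EuclideanSpace ℂ (Fin m) → ℂ}
    (hf : f ∈ polyFun (EuclideanSpace ℂ (Fin m))) :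
    ∃ p : MvPolynomial (Fin m) ℂ, ∀ v, f v = eval (fun j => v j) p := by
  induction hf using Algebra.adjoin_induction with
  | mem f hf =>
    obtain ⟨L, rfl⟩ := hf
    refine ⟨∑ j, C (L (EuclideanSpace.single j 1)) * X j, fun v => ?_⟩
    have hv : v = ∑ j, v j • EuclideanSpace.single j (1 : ℂ) := by
      ext i
      simp [Pi.single_apply]
    conv_lhs => rw [hv]
    simp [mul_comm]
  | algebraMap r => exact ⟨C r, fun v => by simp⟩
  | add f g _ _ hf hg =>
    obtain ⟨p, hp⟩ := hf
    obtain ⟨q, hq⟩ := hg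
    exact ⟨p + q, fun v => by simp [hp, hq]⟩
  | mul f g _ _ hf hg =>
    obtain ⟨p, hp⟩ := hf
    obtain ⟨q, hq⟩ := hg
    exact ⟨p * q, fun v => by simp [hp, hq]⟩

theorem eval_smul_of_isHomogeneous {σ : Type*} {p : MvPolynomial σ ℂ} {k : ℕ}
    (hp : p.IsHomogeneous k) (s : ℂ) (v : σ → ℂ) : eval (s • v) p = s ^ k * eval v p := by
  rw [eval_eq, eval_eq, Finset.mul_sum]
  refine Finset.sum_congr rfl fun m hm => ?_
  have hk : ∑ i ∈ m.support, m i = k := by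
    rw [← hp (mem_support_iff.1 hm), Finsupp.weight_apply, Finsupp.sum]
    simp
  simp only [Pi.smul_apply, smul_eq_mul, mul_pow, Finset.prod_mul_distrib,
    Finset.prod_pow_eq_pow_sum, hk]
  ring

theorem eval_homogeneousComponent_eq_zero {σ : Type*} {p : MvPolynomial σ ℂ} {v : σ → ℂ}
    (h : ∀ s : ℂ, s ≠ 0 → eval (s • v) p = 0) (k : ℕ) :
    eval v (homogeneousComponent k p) = 0 := by
  have key : ∀ s : ℂ, eval (s • v) p =
      (∑ i ∈ Finset.range (p.totalDegree + 1),
        Polynomial.C (eval v (homogeneousComponent i p)) * Polynomial.X ^ i).eval s := by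
    intro s
    conv_lhs => rw [← sum_homogeneousComponent p]
    rw [map_sum, Polynomial.eval_finsetSum]
    refine Finset.sum_congr rfl fun i _ => ?_
    rw [eval_smul_of_isHomogeneous (homogeneousComponent_isHomogeneous i p), Polynomial.eval_mul,
      Polynomial.eval_C, Polynomial.eval_X_pow, mul_comm]
  have hzero : (∑ i ∈ Finset.range (p.totalDegree + 1),
      Polynomial.C (eval v (homogeneousComponent i p)) * Polynomial.X ^ i) = 0 := by
    refine Polynomial.eq_zero_of_infinite_isRoot _ (Infinite.mono (s := {(0 : ℂ)}ᶜ) ?_ ?_)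
    · intro s hs
      exact (key s).symm.trans (h s hs)
    · exact (finite_singleton (0 : ℂ)).infinite_compl
  by_cases hk : k < p.totalDegree + 1
  · have := congrArg (fun P => P.coeff k) hzero
    simpa [Polynomial.finsetSum_coeff, Polynomial.coeff_C_mul_X_pow, hk] using this
  · rw [homogeneousComponent_eq_zero _ _ (by omega), map_zero]

theorem exists_finite_subfamily {σ : Type*} [Finite σ] (P : Set (MvPolynomial σ ℂ)) :
    ∃ (k : ℕ) (p : Fin k → MvPolynomial σ ℂ), (∀ i, p i ∈ P) ∧
      ∀ v : σ → ℂ, (∀ i, eval v (p i) = 0) → ∀ q ∈ P, eval v q = 0 := by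
  obtain ⟨T, hT, hspan⟩ := (Submodule.fg_span_iff_fg_span_finset_subset P).1
    (IsNoetherian.noetherian (Ideal.span P))
  refine ⟨T.card, fun i => (T.equivFin.symm i : MvPolynomial σ ℂ), fun i => hT (Subtype.prop _),
    fun v hv q hq => ?_⟩
  have hle : Ideal.span (T : Set (MvPolynomial σ ℂ)) ≤ RingHom.ker (eval v) := by
    refine Ideal.span_le.2 fun r hr => ?_
    simpa using hv (T.equivFin ⟨r, hr⟩)
  refine hle ?_
  change q ∈ Submodule.span _ _
  rw [← hspan]
  exact Submodule.subset_span hq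

end Homogeneous

theorem IsAnalyticSubset.anaAt {m : ℕ} {C : Set (EuclideanSpace ℂ (Fin m))}
    (hC : IsAnalyticSubset {(0 : EuclideanSpace ℂ (Fin m))}ᶜ C) (a : EuclideanSpace ℂ (Fin m))
    (ha : a ≠ 0) : AnaAt C a := by
  obtain ⟨-, hclosed, hloc⟩ := hC
  by_cases haC : a ∈ C
  · obtain ⟨W, hW, haW, -, k, f, hf, hCW⟩ := hloc a haC
    refine AnaAt.of_family hW haW (range f) ?_ fun z hz => ?_
    · rintro _ ⟨i, rfl⟩ z hz
      exact ((hf i).differentiableAt (hW.mem_nhds hz)).holAt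
    · rw [forall_mem_range]
      have := Set.ext_iff.1 hCW z
      exact ⟨fun h => (this.1 ⟨h, hz⟩).2, fun h => (this.2 ⟨hz, h⟩).1⟩
  · refine anaAt_empty.congr ?_
    have h1 : ∀ᶠ z in 𝓝 a, z ∉ C := by
      refine not_frequently.1 fun h => haC (hclosed a ha (mem_closure_iff_frequently.2 h))
    filter_upwards [h1] with z hz
    exact ⟨fun h => h.elim, fun h => hz h⟩

end Development

/-- **Chow's theorem.** Let `V` be a closed subset of complex projective space `ℙₙ(ℂ)` whose
affine cone `C ⊆ ℂ^{n+1} \ {0}` is an analytic subset of `ℂ^{n+1} \ {0}`.  Then `V` is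
algebraic: the cone `C` is the common zero set in `ℂ^{n+1} \ {0}` of finitely many homogeneous
polynomials. -/
theorem chow_theorem (n : ℕ)
    (V : Set (ℙ ℂ (EuclideanSpace ℂ (Fin (n + 1))))) (hV : IsClosed V)
    (C : Set (EuclideanSpace ℂ (Fin (n + 1))))
    (hC : C = {v : EuclideanSpace ℂ (Fin (n + 1)) |
      ∃ hv : v ≠ 0, Projectivization.mk ℂ v hv ∈ V})
    (hCanalytic : IsAnalyticSubset {(0 : EuclideanSpace ℂ (Fin (n + 1)))}ᶜ C) :
    ∃ (k : ℕ) (p : Fin k → MvPolynomial (Fin (n + 1)) ℂ),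
      (∀ i, ∃ d : ℕ, (p i).IsHomogeneous d) ∧
      C = {v : EuclideanSpace ℂ (Fin (n + 1)) |
        v ≠ 0 ∧ ∀ i, MvPolynomial.eval (fun j => v j) (p i) = 0} := by
  have hsub := hCanalytic.1
  have hcone : ∀ z ∈ C, ∀ s : ℂ, s ≠ 0 → s • z ∈ C := by
    rw [hC]
    rintro z ⟨hz0, hzV⟩ s hs
    refine ⟨smul_ne_zero hs hz0, ?_⟩
    rwa [(Projectivization.mk_eq_mk_iff' ℂ (s • z) z (smul_ne_zero hs hz0) hz0).2 ⟨s, rfl⟩]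
  have h0 : (0 : EuclideanSpace ℂ (Fin (n + 1))) ∉ C := fun h => hsub h rfl
  obtain ⟨𝓕, h𝓕, hmem⟩ := exists_polyFun_family hCanalytic.anaAt hcone h0
  obtain ⟨k, p, hp, hfin⟩ := exists_finite_subfamily
    {q : MvPolynomial (Fin (n + 1)) ℂ | (∃ d, q.IsHomogeneous d) ∧
      ∀ v ∈ C, MvPolynomial.eval (fun j => v j) q = 0}
  refine ⟨k, p, fun i => (hp i).1, Set.ext fun v =>
    ⟨fun hv => ⟨hsub hv, fun i => (hp i).2 v hv⟩, ?_⟩⟩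
  rintro ⟨hv0, hv⟩
  refine (hmem v hv0).2 fun f hf => ?_
  obtain ⟨q, hq⟩ := exists_mvPolynomial_of_mem_polyFun (h𝓕 f hf)
  rw [hq, ← MvPolynomial.sum_homogeneousComponent q, map_sum]
  refine Finset.sum_eq_zero fun i _ => hfin _ hv _
    ⟨⟨i, MvPolynomial.homogeneousComponent_isHomogeneous i q⟩, fun w hw => ?_⟩
  refine eval_homogeneousComponent_eq_zero (fun s hs => ?_) i
  have := (hmem (s • w) (smul_ne_zero hs (hsub hw))).1 (hcone w hw s hs) f hf
  rwa [hq] at this
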